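/- Every irreducible near-brick G different from K_4 and the triangular prism C̄_6 has at least Δ(G) - 2 removable edges. -/

import Mathlib

open Classical in
/-- A finite multigraph: loops are forbidden, multiple edges are allowed. -/
structure Multigraph where
  V : Type
  E : Type
  [fintV : Fintype V]
  [fintE : Fintype E]
  ends : E → Sym2 V
  no_loops : ∀ e, ¬ (ends e).IsDiag

attribute [instance] Multigraph.fintV Multigraph.fintE

namespace Multigraph

variable (G : Multigraph)

/-- Vertex `v` is incident with edge `e`. -/
def Inc (v : G.V) (e : G.E) : Prop := v ∈ G.ends e

/-- Adjacency of vertices. -/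
def Adj (u v : G.V) : Prop := u ≠ v ∧ ∃ e, G.ends e = s(u, v)

/-- A multigraph is connected. -/
def Connected : Prop := Nonempty G.V ∧ ∀ u v : G.V, Relation.ReflTransGen G.Adj u v

/-- A set of edges is a perfect matching: every vertex is covered exactly once. -/
def IsPerfectMatching (M : Set G.E) : Prop :=
  ∀ v : G.V, ∃! e, e ∈ M ∧ G.Inc v e

/-- Matching covered: nontrivial, connected, every edge lies in a perfect matching. -/
def MatchingCovered : Prop :=
  2 ≤ Nat.card G.V ∧ G.Connected ∧ ∀ e : G.E, ∃ M, G.IsPerfectMatching M ∧ e ∈ M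

/-- Degree of a vertex. -/
noncomputable def degree (v : G.V) : ℕ := Nat.card {e : G.E // G.Inc v e}

/-- Maximum degree `Δ(G)`. -/
noncomputable def maxDegree : ℕ := Finset.univ.sup G.degree

/-- The graph obtained by deleting the edge `e`. -/
noncomputable def deleteEdge (e : G.E) : Multigraph where
  V := G.V
  E := {f : G.E // f ≠ e}
  fintE := Fintype.ofFinite _
  ends f := G.ends f.1
  no_loops f := G.no_loops f.1

/-- An edge of `G` is removable if `G - e` is matching covered. -/
noncomputable def Removable (e : G.E) : Prop := (G.deleteEdge e).MatchingCovered

/-- The graph obtained by deleting a set of vertices (and all incident edges). -/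
noncomputable def deleteVerts (S : Set G.V) : Multigraph where
  V := {v : G.V // v ∉ S}
  E := {e : G.E // ∀ v ∈ G.ends e, v ∉ S}
  fintV := Fintype.ofFinite _
  fintE := Fintype.ofFinite _
  ends e := (G.ends e.1).attachWith e.2
  no_loops e h := G.no_loops e.1 (by
    have := (Sym2.isDiag_map Subtype.val_injective).mpr h
    simpa using this)

/-- Two-connectedness: at least three vertices, and deleting any vertex
leaves a connected graph. -/
noncomputable def TwoConnected : Prop :=
  3 ≤ Nat.card G.V ∧ ∀ v : G.V, (G.deleteVerts {v}).Connected

/-- Three-connectedness: at least four vertices, and deleting any two distinct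
vertices leaves a connected graph. -/
noncomputable def ThreeConnected : Prop :=
  4 ≤ Nat.card G.V ∧ ∀ u v : G.V, u ≠ v → (G.deleteVerts {u, v}).Connected

/-- The cut `∂(X)`: edges with exactly one end in `X`. -/
def cut (X : Set G.V) : Set G.E :=
  {e | ∃ u ∈ X, ∃ w ∈ Xᶜ, G.ends e = s(u, w)}

/-- A tight cut: a cut (with both shores nonempty) met by every perfect matching
in exactly one edge. -/
def IsTightCut (X : Set G.V) : Prop :=
  X.Nonempty ∧ Xᶜ.Nonempty ∧
    ∀ M : Set G.E, G.IsPerfectMatching M → ∃! e, e ∈ M ∧ e ∈ G.cut X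

/-- A cut `∂(X)` is trivial if one of its shores is a singleton. -/
def TrivialShore (X : Set G.V) : Prop := (∃ v, X = {v}) ∨ (∃ v, Xᶜ = {v})

/-- `G` is bipartite. -/
def Bipartite : Prop :=
  ∃ c : G.V → Bool, ∀ (e : G.E) (a b : G.V), G.ends e = s(a, b) → c a ≠ c b

/-- The subgraph of `G` induced by `X` is bipartite. -/
def BipartiteOn (X : Set G.V) : Prop :=
  ∃ c : G.V → Bool, ∀ (e : G.E) (a b : G.V),
    G.ends e = s(a, b) → a ∈ X → b ∈ X → c a ≠ c b

lemma Sym2.exists_eq_mk {α : Type*} (z : Sym2 α) : ∃ a b, z = s(a, b) := by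
  induction z using Sym2.ind with
  | _ x y => exact ⟨x, y, rfl⟩

open Classical in
/-- Contraction `G/X`: the shore `X` is shrunk to a single new vertex.
Edges with both ends in `X` disappear. -/
noncomputable def contract (X : Set G.V) : Multigraph where
  V := {v : G.V // v ∉ X} ⊕ Unit
  E := {e : G.E // ¬ ∀ v ∈ G.ends e, v ∈ X}
  fintV := Fintype.ofFinite _
  fintE := Fintype.ofFinite _
  ends e := (G.ends e.1).map
    (fun v => if h : v ∈ X then Sum.inr () else Sum.inl ⟨v, h⟩)
  no_loops := by
    rintro ⟨e, he⟩ hdiag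
    obtain ⟨a, b, hab⟩ := Sym2.exists_eq_mk (G.ends e)
    have hne : a ≠ b := by
      have := G.no_loops e
      rw [hab, Sym2.mk_isDiag_iff] at this
      exact this
    simp only [hab, Sym2.map_pair_eq, Sym2.mk_isDiag_iff] at hdiag
    by_cases ha : a ∈ X <;> by_cases hb : b ∈ X
    · exact he (by
        rw [hab]; intro v hv
        rcases Sym2.mem_iff.mp hv with h | h <;> subst h <;> assumption)
    · rw [dif_pos ha, dif_neg hb] at hdiag; simp at hdiag
    · rw [dif_neg ha, dif_pos hb] at hdiag; simp at hdiag
    · rw [dif_neg ha, dif_neg hb] at hdiag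
      simp only [Sum.inl.injEq, Subtype.mk.injEq] at hdiag
      exact hne hdiag

/-- A brick: a nonbipartite matching covered graph all of whose tight cuts are
trivial. -/
def IsBrick : Prop :=
  G.MatchingCovered ∧ ¬ G.Bipartite ∧ ∀ X : Set G.V, G.IsTightCut X → G.TrivialShore X

/-- A brace: a bipartite matching covered graph all of whose tight cuts are
trivial. -/
def IsBrace : Prop :=
  G.MatchingCovered ∧ G.Bipartite ∧ ∀ X : Set G.V, G.IsTightCut X → G.TrivialShore X

/-- `BrickCount G n` holds if some tight cut decomposition of `G` produces
exactly `n` bricks.  (By Lovász's theorem the number `n` is independent of the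
decomposition.) -/
inductive BrickCount : (G : Multigraph) → ℕ → Prop
  | brick (G : Multigraph) (h : G.IsBrick) : BrickCount G 1
  | brace (G : Multigraph) (h : G.IsBrace) : BrickCount G 0
  | cut (G : Multigraph) (X : Set G.V) (ht : G.IsTightCut X) (hnt : ¬ G.TrivialShore X)
      {n m : ℕ} (h1 : BrickCount (G.contract X) n) (h2 : BrickCount (G.contract Xᶜ) m) :
      BrickCount G (n + m)

/-- A near-brick: a matching covered graph whose tight cut decompositions
have exactly one brick. -/
def IsNearBrick : Prop := G.MatchingCovered ∧ BrickCount G 1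

/-- A single ear of length at least 3: an odd path of length `k ≥ 3` all of whose
internal vertices have degree two. -/
def HasLongSingleEar : Prop :=
  ∃ (k : ℕ) (v : Fin (k + 1) → G.V) (e : Fin k → G.E),
    Odd k ∧ 3 ≤ k ∧ Function.Injective v ∧ Function.Injective e ∧
    (∀ i : Fin k, G.ends (e i) = s(v i.castSucc, v i.succ)) ∧
    (∀ i : Fin (k + 1), i ≠ 0 → i ≠ Fin.last k → G.degree (v i) = 2)

/-- Irreducible: no single ear of length three or more. -/
def Irreducible : Prop := ¬ G.HasLongSingleEar

/-- Isomorphism of multigraphs. -/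
def IsIso (G H : Multigraph) : Prop :=
  ∃ (φ : G.V ≃ H.V) (ψ : G.E ≃ H.E), ∀ e, H.ends (ψ e) = (G.ends e).map φ

end Multigraph

open Multigraph

/-- The complete graph `K₂`. -/
def K2 : Multigraph where
  V := Fin 2
  E := Unit
  ends _ := s(0, 1)
  no_loops _ := by simp [Sym2.mk_isDiag_iff]

/-- The complete graph `K₄`. -/
noncomputable def K4 : Multigraph where
  V := Fin 4
  E := {p : Sym2 (Fin 4) // ¬ p.IsDiag}
  fintE := Fintype.ofFinite _
  ends p := p.1
  no_loops p := p.2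

/-- The cycle `C₄`. -/
def C4 : Multigraph where
  V := ZMod 4
  E := ZMod 4
  ends i := s(i, i + 1)
  no_loops i := by
    have h : ∀ j : ZMod 4, j ≠ j + 1 := by decide
    simpa [Sym2.mk_isDiag_iff] using h i

/-- `C̄₆`, the complement of the 6-cycle (the triangular prism). -/
noncomputable def C6bar : Multigraph where
  V := ZMod 6
  E := {p : Sym2 (ZMod 6) // ¬ p.IsDiag ∧ ∀ a b : ZMod 6, p = s(a, b) → b ≠ a + 1 ∧ a ≠ b + 1}
  fintE := Fintype.ofFinite _
  ends p := p.1
  no_loops p := p.2.1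

namespace Multigraph

variable {G : Multigraph}

/-! ### Edges, cuts and perfect matchings -/

lemma ends_ne {e : G.E} {a b : G.V} (h : G.ends e = s(a, b)) : a ≠ b := by
  have := G.no_loops e
  rwa [h, Sym2.mk_isDiag_iff] at this

lemma inc_iff {e : G.E} {a b v : G.V} (h : G.ends e = s(a, b)) : G.Inc v e ↔ v = a ∨ v = b := by
  unfold Inc; rw [h, Sym2.mem_iff]

lemma exists_ends (e : G.E) : ∃ a b, G.ends e = s(a, b) := Sym2.exists_eq_mk _

lemma Inc.exists_other {v : G.V} {e : G.E} (h : G.Inc v e) : ∃ w, G.ends e = s(v, w) := by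
  obtain ⟨w, hw⟩ := h
  exact ⟨w, hw⟩

lemma inc_left {e : G.E} {a b : G.V} (h : G.ends e = s(a, b)) : G.Inc a e :=
  (inc_iff h).2 (Or.inl rfl)

lemma inc_right {e : G.E} {a b : G.V} (h : G.ends e = s(a, b)) : G.Inc b e :=
  (inc_iff h).2 (Or.inr rfl)

lemma ends_eq_of_inc {e : G.E} {a b : G.V} (ha : G.Inc a e) (hb : G.Inc b e) (hne : a ≠ b) :
    G.ends e = s(a, b) := by
  obtain ⟨w, hw⟩ := ha.exists_other
  rcases (inc_iff hw).1 hb with h | h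
  · exact absurd h.symm hne
  · rw [hw, h]

lemma mem_cut_iff {e : G.E} {a b : G.V} {X : Set G.V} (h : G.ends e = s(a, b)) :
    e ∈ G.cut X ↔ (a ∈ X ∧ b ∉ X) ∨ (a ∉ X ∧ b ∈ X) := by
  constructor
  · rintro ⟨u, hu, w, hw, huw⟩
    rw [h, Sym2.eq_iff] at huw
    rcases huw with ⟨rfl, rfl⟩ | ⟨rfl, rfl⟩
    · exact Or.inl ⟨hu, hw⟩
    · exact Or.inr ⟨hw, hu⟩
  · rintro (⟨h1, h2⟩ | ⟨h1, h2⟩)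
    · exact ⟨a, h1, b, h2, h⟩
    · exact ⟨b, h2, a, h1, by rw [h, Sym2.eq_swap]⟩

lemma cut_compl (X : Set G.V) : G.cut Xᶜ = G.cut X := by
  ext e
  obtain ⟨a, b, h⟩ := exists_ends e
  rw [mem_cut_iff h, mem_cut_iff h]
  simp only [Set.mem_compl_iff]
  tauto

/-- Both ends of `e` lie in `X`. -/
def Inside (X : Set G.V) (e : G.E) : Prop := ∀ v ∈ G.ends e, v ∈ X

lemma inside_iff {e : G.E} {a b : G.V} {X : Set G.V} (h : G.ends e = s(a, b)) :
    Inside X e ↔ a ∈ X ∧ b ∈ X := by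
  unfold Inside; rw [h]; simp

lemma inside_or_cut_of_inc {X : Set G.V} {v : G.V} {e : G.E} (hv : v ∈ X) (h : G.Inc v e) :
    Inside X e ∨ e ∈ G.cut X := by
  obtain ⟨w, hw⟩ := h.exists_other
  rw [inside_iff hw, mem_cut_iff hw]
  tauto

namespace IsPerfectMatching

variable {M M' : Set G.E}

lemma eq_of_inc (hM : G.IsPerfectMatching M) {v : G.V} {e f : G.E} (he : e ∈ M) (hf : f ∈ M)
    (hve : G.Inc v e) (hvf : G.Inc v f) : e = f :=
  (hM v).unique ⟨he, hve⟩ ⟨hf, hvf⟩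

lemma exists_edge (hM : G.IsPerfectMatching M) (v : G.V) : ∃ e ∈ M, G.Inc v e :=
  (hM v).exists

/-- The partner of a vertex in a perfect matching. -/
noncomputable def mate (hM : G.IsPerfectMatching M) (v : G.V) : G.V :=
  (hM.exists_edge v).choose_spec.2.exists_other.choose

lemma mate_spec (hM : G.IsPerfectMatching M) (v : G.V) :
    ∃ e ∈ M, G.ends e = s(v, hM.mate v) :=
  ⟨_, (hM.exists_edge v).choose_spec.1,
    (hM.exists_edge v).choose_spec.2.exists_other.choose_spec⟩

lemma mate_eq (hM : G.IsPerfectMatching M) {e : G.E} {a b : G.V} (he : e ∈ M)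
    (h : G.ends e = s(a, b)) : hM.mate a = b := by
  obtain ⟨f, hf, hfe⟩ := hM.mate_spec a
  have := hM.eq_of_inc hf he (inc_left hfe) (inc_left h)
  subst this
  rw [h, Sym2.congr_right] at hfe
  exact hfe.symm

lemma mate_mate (hM : G.IsPerfectMatching M) (v : G.V) : hM.mate (hM.mate v) = v := by
  obtain ⟨f, hf, hfe⟩ := hM.mate_spec v
  exact hM.mate_eq hf (by rw [hfe, Sym2.eq_swap])

lemma mate_ne (hM : G.IsPerfectMatching M) (v : G.V) : hM.mate v ≠ v := by
  obtain ⟨f, hf, hfe⟩ := hM.mate_spec v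
  exact (ends_ne hfe).symm

/-- Two perfect matchings agreeing on a cut can be exchanged along it. -/
lemma splice (hM : G.IsPerfectMatching M) (hM' : G.IsPerfectMatching M') {X : Set G.V}
    (h : ∀ e ∈ G.cut X, e ∈ M ↔ e ∈ M') :
    G.IsPerfectMatching {e | (Inside X e ∧ e ∈ M) ∨ (¬ Inside X e ∧ e ∈ M')} := by
  intro v
  by_cases hv : v ∈ X
  · obtain ⟨e, he, hve⟩ := hM.exists_edge v
    refine ⟨e, ⟨?_, hve⟩, ?_⟩
    · by_cases hi : Inside X e
      · exact Or.inl ⟨hi, he⟩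
      · have := (inside_or_cut_of_inc hv hve).resolve_left hi
        exact Or.inr ⟨hi, (h e this).1 he⟩
    · rintro f ⟨hf, hvf⟩
      rcases hf with ⟨_, hf⟩ | ⟨hi, hf⟩
      · exact hM.eq_of_inc hf he hvf hve
      · have := (inside_or_cut_of_inc hv hvf).resolve_left hi
        exact hM.eq_of_inc ((h f this).2 hf) he hvf hve
  · have key : ∀ f, G.Inc v f → ¬ Inside X f := fun f hf hi => hv (hi v hf)
    obtain ⟨e, he, hve⟩ := hM'.exists_edge v
    refine ⟨e, ⟨Or.inr ⟨key e hve, he⟩, hve⟩, ?_⟩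
    rintro f ⟨hf, hvf⟩
    rcases hf with ⟨hi, hf⟩ | ⟨hi, hf⟩
    · exact absurd hi (key f hvf)
    · exact hM'.eq_of_inc hf he hvf hve

section Sums

variable {A : Type*} [AddCommGroup A]

lemma sum_indicator_eq (hM : G.IsPerfectMatching M) (X : Set G.V) (w : G.V → A)
    (h : ∀ e ∈ M, ∀ a b, G.ends e = s(a, b) → a ∈ X → b ∈ X → w a + w b = 0) :
    ∑ v, X.indicator w v = ∑ v, {v | v ∈ X ∧ hM.mate v ∉ X}.indicator w v := by
  classical
  rw [← sub_eq_zero, ← Finset.sum_sub_distrib]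
  refine Finset.sum_involution (fun v _ => hM.mate v) ?_ ?_ ?_ ?_
  · intro v _
    obtain ⟨e, he, hev⟩ := hM.mate_spec v
    have := h e he _ _ hev
    by_cases h1 : v ∈ X <;> by_cases h2 : hM.mate v ∈ X <;>
      simp [Set.indicator, h1, h2, hM.mate_mate, this]
  · intro v _ _
    exact hM.mate_ne v
  · intro v _; exact Finset.mem_univ _
  · intro v _; exact hM.mate_mate v

lemma sum_eq_zero (hM : G.IsPerfectMatching M) {X : Set G.V} {w : G.V → A}
    (h : ∀ e ∈ M, ∀ a b, G.ends e = s(a, b) → a ∈ X → b ∈ X → w a + w b = 0)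
    (hc : ∀ e ∈ M, e ∉ G.cut X) : ∑ v, X.indicator w v = 0 := by
  rw [hM.sum_indicator_eq X w h]
  refine Finset.sum_eq_zero fun v _ => Set.indicator_of_notMem ?_ _
  rintro ⟨h1, h2⟩
  obtain ⟨e, he, hev⟩ := hM.mate_spec v
  exact hc e he ((mem_cut_iff hev).2 (Or.inl ⟨h1, h2⟩))

lemma sum_eq_one (hM : G.IsPerfectMatching M) {X : Set G.V} {w : G.V → A}
    (h : ∀ e ∈ M, ∀ a b, G.ends e = s(a, b) → a ∈ X → b ∈ X → w a + w b = 0)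
    {e : G.E} {a b : G.V} (he : e ∈ M) (hab : G.ends e = s(a, b)) (ha : a ∈ X) (hb : b ∉ X)
    (hc : ∀ f ∈ M, f ∈ G.cut X → f = e) : ∑ v, X.indicator w v = w a := by
  classical
  rw [hM.sum_indicator_eq X w h, Finset.sum_eq_single a]
  · have hm : a ∈ {v | v ∈ X ∧ hM.mate v ∉ X} := ⟨ha, by rwa [hM.mate_eq he hab]⟩
    exact Set.indicator_of_mem hm _
  · intro v _ hv
    refine Set.indicator_of_notMem ?_ _
    rintro ⟨h1, h2⟩
    obtain ⟨f, hf, hfv⟩ := hM.mate_spec v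
    have := hc f hf ((mem_cut_iff hfv).2 (Or.inl ⟨h1, h2⟩))
    subst this
    have := (inc_iff hab).1 (inc_left hfv)
    rcases this with h | h
    · exact hv h
    · subst h; exact hb h1
  · simp

lemma sum_eq_two (hM : G.IsPerfectMatching M) {X : Set G.V} {w : G.V → A}
    (h : ∀ e ∈ M, ∀ a b, G.ends e = s(a, b) → a ∈ X → b ∈ X → w a + w b = 0)
    {e e' : G.E} {a b a' b' : G.V} (hne : e ≠ e') (he : e ∈ M) (hab : G.ends e = s(a, b))
    (ha : a ∈ X) (hb : b ∉ X) (he' : e' ∈ M) (hab' : G.ends e' = s(a', b'))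
    (ha' : a' ∈ X) (hb' : b' ∉ X)
    (hc : ∀ f ∈ M, f ∈ G.cut X → f = e ∨ f = e') : ∑ v, X.indicator w v = w a + w a' := by
  classical
  have haa : a ≠ a' := by
    rintro rfl
    exact hne (hM.eq_of_inc he he' (inc_left hab) (inc_left hab'))
  rw [hM.sum_indicator_eq X w h, ← Finset.sum_pair haa]
  symm
  rw [← Finset.sum_subset (Finset.subset_univ {a, a'})]
  · refine Finset.sum_congr rfl fun v hv => ?_
    symm
    refine Set.indicator_of_mem ?_ _
    simp only [Finset.mem_insert, Finset.mem_singleton] at hv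
    rcases hv with rfl | rfl
    · exact ⟨ha, by rwa [hM.mate_eq he hab]⟩
    · exact ⟨ha', by rwa [hM.mate_eq he' hab']⟩
  · intro v _ hv
    simp only [Finset.mem_insert, Finset.mem_singleton, not_or] at hv
    refine Set.indicator_of_notMem ?_ _
    rintro ⟨h1, h2⟩
    obtain ⟨f, hf, hfv⟩ := hM.mate_spec v
    rcases hc f hf ((mem_cut_iff hfv).2 (Or.inl ⟨h1, h2⟩)) with rfl | rfl
    · rcases (inc_iff hab).1 (inc_left hfv) with h | h
      · exact hv.1 h
      · subst h; exact hb h1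
    · rcases (inc_iff hab').1 (inc_left hfv) with h | h
      · exact hv.2 h
      · subst h; exact hb' h1

end Sums

end IsPerfectMatching

/-- The parity of a vertex set. -/
noncomputable def par (X : Set G.V) : ZMod 2 := ∑ v, X.indicator (fun _ => 1) v

lemma par_eq_ncard (X : Set G.V) : par X = (X.ncard : ZMod 2) := by
  classical
  unfold par
  rw [Set.ncard_eq_toFinset_card' X, Finset.sum_indicator_eq_sum_filter]
  simp [Set.toFinset]

lemma IsPerfectMatching.exists_cut_of_par {M : Set G.E} (hM : G.IsPerfectMatching M) {X : Set G.V}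
    (h : par X = 1) : ∃ e ∈ M, e ∈ G.cut X := by
  by_contra! hc
  have := hM.sum_eq_zero (X := X) (w := fun _ => (1 : ZMod 2)) (fun _ _ _ _ _ _ _ => by decide) hc
  unfold par at h
  rw [this] at h
  exact absurd h (by decide)

lemma IsPerfectMatching.par_eq_one {M : Set G.E} (hM : G.IsPerfectMatching M) {X : Set G.V}
    (h : ∃! e, e ∈ M ∧ e ∈ G.cut X) : par X = 1 := by
  obtain ⟨e, ⟨he, hc⟩, hu⟩ := h
  obtain ⟨a, ha, b, hb, hab⟩ := hc
  exact hM.sum_eq_one (w := fun _ => (1 : ZMod 2)) (fun _ _ _ _ _ _ _ => by decide) he hab ha hb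
    fun f hf hfc => hu f ⟨hf, hfc⟩

lemma Connected.cut_nonempty (hG : G.Connected) {X : Set G.V} (h1 : X.Nonempty)
    (h2 : X ≠ Set.univ) : (G.cut X).Nonempty := by
  by_contra hc
  obtain ⟨u, hu⟩ := h1
  obtain ⟨v, hv⟩ := (Set.ne_univ_iff_exists_notMem X).1 h2
  apply hv
  have := hG.2 u v
  induction this with
  | refl => exact hu
  | tail _ h ih =>
    by_contra hw
    obtain ⟨_, e, he⟩ := h
    refine hc ⟨e, (mem_cut_iff he).2 ?_⟩
    by_contra hh
    exact hv (by tauto)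

/-! ### Matching covered graphs and dependence -/

lemma MatchingCovered.connected (hG : G.MatchingCovered) : G.Connected := hG.2.1

lemma MatchingCovered.exists_mem (hG : G.MatchingCovered) (e : G.E) :
    ∃ M, G.IsPerfectMatching M ∧ e ∈ M := hG.2.2 e

lemma pair_ne_univ (h3 : 3 ≤ Nat.card G.V) (a b : G.V) : ({a, b} : Set G.V) ≠ Set.univ := by
  intro h
  have h1 := Set.ncard_univ G.V
  rw [← h] at h1
  have h2 := Set.ncard_insert_le a ({b} : Set G.V)
  rw [Set.ncard_singleton] at h2
  omega

lemma MatchingCovered.exists_notMem (hG : G.MatchingCovered) (h3 : 3 ≤ Nat.card G.V) (e : G.E) :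
    ∃ M, G.IsPerfectMatching M ∧ e ∉ M := by
  obtain ⟨a, b, hab⟩ := exists_ends e
  obtain ⟨f, hf⟩ := hG.connected.cut_nonempty (X := {a, b}) ⟨a, by simp⟩ (pair_ne_univ h3 a b)
  obtain ⟨M, hM, hfM⟩ := hG.exists_mem f
  refine ⟨M, hM, fun he => ?_⟩
  have hne : f ≠ e := by
    rintro rfl
    rw [mem_cut_iff hab] at hf
    simp at hf
  obtain ⟨u, hu, w, hw, huw⟩ := hf
  rcases hu with rfl | rfl
  · exact hne (hM.eq_of_inc hfM he (inc_left huw) (inc_left hab))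
  · exact hne (hM.eq_of_inc hfM he (inc_left huw) (inc_right hab))

lemma MatchingCovered.eq_empty_or_univ (hG : G.MatchingCovered) {Y : Set G.V}
    (h : G.cut Y = ∅) : Y = ∅ ∨ Y = Set.univ := by
  by_contra! hc
  exact (hG.connected.cut_nonempty hc.1 hc.2).ne_empty h

/-- A matching covered graph on more than two vertices has no bridge. -/
lemma MatchingCovered.eq_empty_or_univ_of_subset (hG : G.MatchingCovered)
    (h3 : 3 ≤ Nat.card G.V) {Y : Set G.V} {e : G.E} (h : G.cut Y ⊆ {e}) :
    Y = ∅ ∨ Y = Set.univ := by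
  by_cases hn : G.cut Y = ∅
  · exact hG.eq_empty_or_univ hn
  exfalso
  have he : e ∈ G.cut Y := by
    obtain ⟨f, hf⟩ := Set.nonempty_iff_ne_empty.2 hn
    have := h hf
    rw [Set.mem_singleton_iff] at this
    rwa [this] at hf
  obtain ⟨M, hM, heM⟩ := hG.exists_mem e
  obtain ⟨M', hM', heM'⟩ := hG.exists_notMem h3 e
  have h1 := hM.par_eq_one (X := Y) ⟨e, ⟨heM, he⟩, fun f hf => h hf.2⟩
  obtain ⟨f, hf, hfc⟩ := hM'.exists_cut_of_par h1
  have := h hfc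
  rw [Set.mem_singleton_iff] at this
  subst this
  exact heM' hf

lemma MatchingCovered.exists_inc_ne (hG : G.MatchingCovered) (h3 : 3 ≤ Nat.card G.V) (v : G.V)
    (e : G.E) : ∃ f, G.Inc v f ∧ f ≠ e := by
  obtain ⟨M, hM, he⟩ := hG.exists_notMem h3 e
  obtain ⟨f, hf, hv⟩ := hM.exists_edge v
  exact ⟨f, hv, fun h => he (h ▸ hf)⟩

/-! ### Degrees -/

lemma degree_eq_ncard (v : G.V) : G.degree v = {e | G.Inc v e}.ncard := rfl

lemma degree_eq_two_iff {v : G.V} :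
    G.degree v = 2 ↔ ∃ e f, e ≠ f ∧ ∀ g, G.Inc v g ↔ g = e ∨ g = f := by
  rw [degree_eq_ncard, Set.ncard_eq_two]
  simp [Set.ext_iff]

lemma exists_inc_of_three_le {v : G.V} (h : 3 ≤ G.degree v) (e f : G.E) :
    ∃ g, G.Inc v g ∧ g ≠ e ∧ g ≠ f := by
  by_contra! hc
  have h1 : {e | G.Inc v e} ⊆ {e, f} := by
    intro g hg
    by_cases h : g = e
    · exact Or.inl h
    · exact Or.inr (hc g hg h)
  have h2 := Set.ncard_le_ncard h1
  have h3 := Set.ncard_insert_le e ({f} : Set G.E)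
  rw [Set.ncard_singleton] at h3
  rw [degree_eq_ncard] at h
  omega

lemma MatchingCovered.two_le_degree (hG : G.MatchingCovered) (h3 : 3 ≤ Nat.card G.V) (v : G.V) :
    2 ≤ G.degree v := by
  obtain ⟨M, hM, he⟩ := (hG.exists_mem (hG.connected.cut_nonempty (X := {v}) ⟨v, rfl⟩ (by
    have := pair_ne_univ h3 v v
    simpa using this)).choose)
  obtain ⟨e, -, hev⟩ := hM.exists_edge v
  obtain ⟨f, hf, hfe⟩ := hG.exists_inc_ne h3 v e
  rw [degree_eq_ncard, ← Set.ncard_pair hfe]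
  refine Set.ncard_le_ncard ?_
  rintro g (rfl | rfl)
  · exact hf
  · exact hev

/-- In an irreducible graph no two vertices of degree two are adjacent. -/
lemma Irreducible.not_adj_degree_two (hirr : G.Irreducible) (hG : G.MatchingCovered)
    (h3 : 3 ≤ Nat.card G.V) {e : G.E} {a b : G.V} (hab : G.ends e = s(a, b))
    (ha : G.degree a = 2) (hb : G.degree b = 2) : False := by
  have key : ∀ {u v : G.V}, G.ends e = s(u, v) → G.degree u = 2 →
      ∃ f w, G.ends f = s(u, w) ∧ f ≠ e ∧ ∀ g, G.Inc u g ↔ g = e ∨ g = f := by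
    intro u v huv hu
    obtain ⟨p, q, hpq, hi⟩ := degree_eq_two_iff.1 hu
    rcases (hi e).1 (inc_left huv) with rfl | rfl
    · obtain ⟨w, hw⟩ := ((hi q).2 (Or.inr rfl)).exists_other
      exact ⟨q, w, hw, hpq.symm, hi⟩
    · obtain ⟨w, hw⟩ := ((hi p).2 (Or.inl rfl)).exists_other
      exact ⟨p, w, hw, hpq, fun g => by rw [hi g, or_comm]⟩
  obtain ⟨f, x, hf, hfe, hfa⟩ := key hab ha
  obtain ⟨g, y, hg, hge, hgb⟩ := key (by rw [hab, Sym2.eq_swap]) hb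
  have hne := ends_ne hab
  have hax := ends_ne hf
  have hby := ends_ne hg
  have hfg : f ≠ g := by
    rintro rfl
    obtain ⟨k, hk⟩ := hG.connected.cut_nonempty (X := {a, b}) ⟨a, by simp⟩ (pair_ne_univ h3 a b)
    have hk' : k ∈ G.cut {a, b} := hk
    have hfab : G.ends f = s(a, b) := ends_eq_of_inc (inc_left hf) (inc_left hg) hne
    obtain ⟨u, hu, w, hw, huw⟩ := hk
    have : k = e ∨ k = f := by
      rcases hu with rfl | rfl
      · exact (hfa k).1 (inc_left huw)
      · exact (hgb k).1 (inc_left huw)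
    rcases this with rfl | rfl
    · rw [mem_cut_iff hab] at hk'; simp at hk'
    · rw [mem_cut_iff hfab] at hk'; simp at hk'
  have hxb : x ≠ b := by
    rintro rfl
    rcases (hgb f).1 (inc_right hf) with h | h
    · exact hfe h
    · exact hfg h
  have hya : y ≠ a := by
    rintro rfl
    rcases (hfa g).1 (inc_right hg) with h | h
    · exact hge h
    · exact hfg h.symm
  have hxy : x ≠ y := by
    rintro rfl
    obtain ⟨M, hM, hfM⟩ := hG.exists_mem f
    obtain ⟨k, hk, hkb⟩ := hM.exists_edge b
    rcases (hgb k).1 hkb with rfl | rfl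
    · exact hfe (hM.eq_of_inc hfM hk (inc_left hf) (inc_left hab))
    · exact hfg (hM.eq_of_inc hfM hk (inc_right hf) (inc_right hg))
  refine hirr ⟨3, ![x, a, b, y], ![f, e, g], by decide, le_refl _, ?_, ?_, ?_, ?_⟩
  · intro i j hij
    fin_cases i <;> fin_cases j <;> simp_all
  · intro i j hij
    fin_cases i <;> fin_cases j <;> simp_all
  · intro i
    fin_cases i
    · simp [hf, Sym2.eq_swap]
    · simp [hab]
    · simp [hg]
  · intro i hi hi'
    fin_cases i
    · simp at hi
    · simpa using ha
    · simpa using hb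
    · exact absurd rfl hi'

/-! ### Colourings -/

/-- A function with values `1` and `-1`. -/
def IsSign (c : G.V → ℤ) : Prop := ∀ v, c v = 1 ∨ c v = -1

lemma IsSign.neg {c : G.V → ℤ} (h : IsSign c) : IsSign (-c) := fun v => by
  rcases h v with h | h <;> simp [h]

/-- A proper colouring of the subgraph induced by `X`, with colours `1` and `-1`. -/
def ProperOn (X : Set G.V) (c : G.V → ℤ) : Prop :=
  IsSign c ∧ ∀ e a b, G.ends e = s(a, b) → a ∈ X → b ∈ X → c a + c b = 0

lemma ProperOn.neg {X : Set G.V} {c : G.V → ℤ} (h : ProperOn X c) : ProperOn X (-c) :=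
  ⟨h.1.neg, fun e a b he ha hb => by have := h.2 e a b he ha hb; simp only [Pi.neg_apply]; omega⟩

lemma ProperOn.mono {X Y : Set G.V} {c : G.V → ℤ} (h : ProperOn X c) (hY : Y ⊆ X) :
    ProperOn Y c :=
  ⟨h.1, fun e a b he ha hb => h.2 e a b he (hY ha) (hY hb)⟩

lemma ProperOn.ite {X Y : Set G.V} {c c' : G.V → ℤ} (h : ProperOn X c) (h' : ProperOn Y c')
    (hXY : ∀ e a b, G.ends e = s(a, b) → a ∈ X → b ∈ Y → b ∉ X → c a + c' b = 0) :
    ∃ d, ProperOn (X ∪ Y) d := by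
  classical
  refine ⟨fun v => if v ∈ X then c v else c' v, fun v => ?_, fun e a b he ha hb => ?_⟩
  · dsimp only
    split_ifs
    · exact h.1 v
    · exact h'.1 v
  · by_cases h1 : a ∈ X <;> by_cases h2 : b ∈ X
    · simpa [h1, h2] using h.2 e a b he h1 h2
    · simpa [h1, h2] using hXY e a b he h1 (hb.resolve_left h2) h2
    · have := hXY e b a (by rw [he, Sym2.eq_swap]) h2 (ha.resolve_left h1) h1
      simp only [h1, h2, if_true, if_false]
      omega
    · simpa [h1, h2] using h'.2 e a b he (ha.resolve_left h1) (hb.resolve_left h2)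

lemma bipartiteOn_iff {X : Set G.V} : G.BipartiteOn X ↔ ∃ c, ProperOn X c := by
  constructor
  · rintro ⟨c, hc⟩
    refine ⟨fun v => if c v then 1 else -1, fun v => ?_, fun e a b he ha hb => ?_⟩
    · dsimp only
      split_ifs <;> simp
    · have := hc e a b he ha hb
      cases h1 : c a <;> cases h2 : c b <;> simp_all
  · rintro ⟨c, hs, hc⟩
    refine ⟨fun v => decide (c v = 1), fun e a b he ha hb h => ?_⟩
    have h1 := hc e a b he ha hb
    rw [decide_eq_decide] at h
    rcases hs a with h2 | h2 <;> rcases hs b with h3 | h3 <;> simp_all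

lemma bipartite_iff : G.Bipartite ↔ G.BipartiteOn Set.univ := by
  unfold Bipartite BipartiteOn
  simp

lemma BipartiteOn.mono {X Y : Set G.V} (h : G.BipartiteOn X) (hY : Y ⊆ X) : G.BipartiteOn Y := by
  obtain ⟨c, hc⟩ := h
  exact ⟨c, fun e a b he ha hb => hc e a b he (hY ha) (hY hb)⟩

lemma card_ge_three_of_not_bipartite (h : ¬ G.Bipartite) : 3 ≤ Nat.card G.V := by
  by_contra hc
  apply h
  have hc' : Nat.card G.V ≤ 2 := by omega
  rw [Nat.card_eq_fintype_card] at hc'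
  obtain ⟨f⟩ : Nonempty (G.V ↪ Bool) := Function.Embedding.nonempty_of_card_le (by simpa using hc')
  exact ⟨f, fun e a b he hab => ends_ne he (f.injective hab)⟩

/-- The colour of the ends in `X` of the edges of a tight cut with bipartite shore `X`. -/
lemma IsTightCut.color_eq (hG : G.MatchingCovered) {X : Set G.V} (hX : G.IsTightCut X)
    {c : G.V → ℤ} (hc : ProperOn X c) {e : G.E} {a b : G.V} (he : G.ends e = s(a, b))
    (ha : a ∈ X) (hb : b ∉ X) : c a = ∑ v, X.indicator c v := by
  obtain ⟨M, hM, heM⟩ := hG.exists_mem e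
  have hec : e ∈ G.cut X := (mem_cut_iff he).2 (Or.inl ⟨ha, hb⟩)
  exact (hM.sum_eq_one (fun f _ => hc.2 f) heM he ha hb
    fun f hf hfc => (hX.2.2 M hM).unique ⟨hf, hfc⟩ ⟨heM, hec⟩).symm

lemma IsTightCut.compl {X : Set G.V} (hX : G.IsTightCut X) : G.IsTightCut Xᶜ :=
  ⟨hX.2.1, by rw [compl_compl]; exact hX.1, fun M hM => by rw [cut_compl]; exact hX.2.2 M hM⟩

/-! ### Dependence -/

/-- Every perfect matching containing `g` contains `h`. -/
def Dep (g h : G.E) : Prop := ∀ M, G.IsPerfectMatching M → g ∈ M → h ∈ M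

lemma Dep.refl (g : G.E) : Dep g g := fun _ _ h => h

lemma Dep.trans {f g h : G.E} (h1 : Dep f g) (h2 : Dep g h) : Dep f h :=
  fun M hM hf => h2 M hM (h1 M hM hf)

/-- A minimal element for dependence. -/
def IsSource (s : G.E) : Prop := ∀ g, Dep g s → Dep s g

lemma exists_source (h : G.E) : ∃ s, IsSource s ∧ Dep s h := by
  induction hn : {g | Dep g h}.ncard using Nat.strong_induction_on generalizing h with
  | _ n ih =>
    by_cases hs : IsSource h
    · exact ⟨h, hs, Dep.refl h⟩
    · unfold IsSource at hs
      push Not at hs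
      obtain ⟨g, hg, hg'⟩ := hs
      have hlt : {x | Dep x g}.ncard < n := by
        rw [← hn]
        refine Set.ncard_lt_ncard ⟨fun x hx => Dep.trans hx hg, fun hh => ?_⟩
        exact hg' (hh (Dep.refl h))
      obtain ⟨s, hs, hsg⟩ := ih _ hlt g rfl
      exact ⟨s, hs, hsg.trans hg⟩

lemma IsSource.of_dep {s g : G.E} (hs : IsSource s) (h : Dep g s) : IsSource g :=
  fun _ hx => h.trans (hs _ (hx.trans h))

lemma removable_of_forall_dep (hG : G.MatchingCovered) (h3 : 3 ≤ Nat.card G.V) {r : G.E}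
    (hr : ∀ g, Dep g r → g = r) : G.Removable r := by
  refine ⟨hG.1, ⟨hG.connected.1, fun u v => ?_⟩, ?_⟩
  · set X : Set G.V := {w | Relation.ReflTransGen (G.deleteEdge r).Adj u w} with hX
    have hcut : G.cut X ⊆ {r} := by
      rintro e ⟨a, ha, b, hb, hab⟩
      by_contra he
      apply hb
      refine Relation.ReflTransGen.tail ha ⟨ends_ne hab, ⟨e, he⟩, hab⟩
    rcases hG.eq_empty_or_univ_of_subset h3 hcut with h | h
    · have : u ∈ X := Relation.ReflTransGen.refl
      rw [h] at this
      exact absurd this (Set.notMem_empty u)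
    · have : v ∈ X := by rw [h]; trivial
      exact this
  · rintro ⟨g, hg⟩
    have : ¬ Dep g r := fun h => hg (hr g h)
    unfold Dep at this
    push Not at this
    obtain ⟨M, hM, hgM, hrM⟩ := this
    refine ⟨{f | f.1 ∈ M}, fun v => ?_, hgM⟩
    obtain ⟨e, he, hev⟩ := hM.exists_edge v
    refine ⟨⟨e, fun h => hrM (h ▸ he)⟩, ⟨he, hev⟩, ?_⟩
    rintro ⟨f, hf⟩ ⟨h1, h2⟩
    exact Subtype.ext (hM.eq_of_inc h1 he h2 hev)

/-- In a bipartite shore of a cut consisting of two equivalent edges, the ends of the two edges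
have opposite colours. -/
lemma color_two_cut (hG : G.MatchingCovered) (h3 : 3 ≤ Nat.card G.V) {X : Set G.V} {t t' : G.E}
    (hne : t ≠ t') (hX : G.cut X = {t, t'}) (h1 : Dep t t') (h2 : Dep t' t) {c : G.V → ℤ}
    (hc : ProperOn X c) {a b a' b' : G.V} (ht : G.ends t = s(a, b)) (ha : a ∈ X)
    (ht' : G.ends t' = s(a', b')) (ha' : a' ∈ X) : c a + c a' = 0 := by
  obtain ⟨M, hM, htM⟩ := hG.exists_mem t
  obtain ⟨M', hM', htM'⟩ := hG.exists_notMem h3 t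
  have hb : b ∉ X := by
    have : t ∈ G.cut X := by rw [hX]; simp
    rw [mem_cut_iff ht] at this
    tauto
  have hb' : b' ∉ X := by
    have : t' ∈ G.cut X := by rw [hX]; simp
    rw [mem_cut_iff ht'] at this
    tauto
  rw [← hM.sum_eq_two (fun f _ => hc.2 f) hne htM ht ha hb (h1 M hM htM) ht' ha' hb'
    fun f _ hf => by rw [hX] at hf; exact hf]
  refine hM'.sum_eq_zero (fun f _ => hc.2 f) fun e he hec => ?_
  rw [hX] at hec
  rcases hec with rfl | rfl
  · exact htM' he
  · exact htM' (h2 M' hM' he)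

/-! ### Contractions -/

open Classical in
/-- The projection onto the contraction of `X`. -/
noncomputable def proj (X : Set G.V) (v : G.V) : (G.contract X).V :=
  if h : v ∈ X then Sum.inr () else Sum.inl ⟨v, h⟩

/-- The vertex of `G.contract X` obtained by shrinking `X`. -/
def apex (X : Set G.V) : (G.contract X).V := (Sum.inr () : {v : G.V // v ∉ X} ⊕ Unit)

lemma proj_of_mem {X : Set G.V} {v : G.V} (h : v ∈ X) : proj X v = apex X := dif_pos h

lemma proj_eq_apex_iff {X : Set G.V} {v : G.V} : proj X v = apex X ↔ v ∈ X := by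
  refine ⟨fun h => ?_, proj_of_mem⟩
  by_contra hv
  have h' : (Sum.inl ⟨v, hv⟩ : {v : G.V // v ∉ X} ⊕ Unit) = Sum.inr () := (dif_neg hv).symm.trans h
  exact Sum.inl_ne_inr h'

lemma proj_inj {X : Set G.V} {v w : G.V} (hv : v ∉ X) (h : proj X v = proj X w) : v = w := by
  by_cases hw : w ∈ X
  · rw [proj_of_mem hw] at h
    exact absurd (proj_eq_apex_iff.1 h) hv
  · have h' : (Sum.inl ⟨v, hv⟩ : {v : G.V // v ∉ X} ⊕ Unit) = Sum.inl ⟨w, hw⟩ :=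
      (dif_neg hv).symm.trans (h.trans (dif_neg hw))
    exact congrArg Subtype.val (Sum.inl_injective h')

lemma proj_surj {X : Set G.V} (hX : X.Nonempty) (x : (G.contract X).V) : ∃ v, proj X v = x := by
  rcases x with ⟨v, hv⟩ | ⟨⟩
  · exact ⟨v, dif_neg hv⟩
  · obtain ⟨v, hv⟩ := hX
    exact ⟨v, dif_pos hv⟩

lemma contract_ends {X : Set G.V} {e : G.E} (he : ¬ Inside X e) {a b : G.V}
    (h : G.ends e = s(a, b)) : (G.contract X).ends ⟨e, he⟩ = s(proj X a, proj X b) := by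
  change (G.ends e).map _ = _
  rw [h, Sym2.map_mk]
  rfl

lemma contract_inc {X : Set G.V} {e : G.E} (he : ¬ Inside X e) {v : G.V} (hv : v ∉ X) :
    (G.contract X).Inc (proj X v) ⟨e, he⟩ ↔ G.Inc v e := by
  obtain ⟨a, b, hab⟩ := exists_ends e
  rw [inc_iff (contract_ends he hab), inc_iff hab]
  refine or_congr ⟨proj_inj hv, fun h => by rw [h]⟩ ⟨proj_inj hv, fun h => by rw [h]⟩

lemma contract_inc_apex {X : Set G.V} {e : G.E} (he : ¬ Inside X e) :
    (G.contract X).Inc (apex X) ⟨e, he⟩ ↔ e ∈ G.cut X := by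
  obtain ⟨a, b, hab⟩ := exists_ends e
  rw [inc_iff (contract_ends he hab), mem_cut_iff hab, eq_comm, proj_eq_apex_iff, eq_comm,
    proj_eq_apex_iff]
  rw [inside_iff hab] at he
  tauto

lemma contract_mem_cut {X : Set G.V} {e : G.E} (he : ¬ Inside X e) (Y : Set (G.contract X).V) :
    (⟨e, he⟩ : (G.contract X).E) ∈ (G.contract X).cut Y ↔ e ∈ G.cut (proj X ⁻¹' Y) := by
  obtain ⟨a, b, hab⟩ := exists_ends e
  exact (mem_cut_iff (contract_ends he hab)).trans
    (mem_cut_iff (X := proj X ⁻¹' Y) hab).symm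

lemma not_inside_of_cut_preimage {X : Set G.V} {e : G.E} {Y : Set (G.contract X).V}
    (h : e ∈ G.cut (proj X ⁻¹' Y)) : ¬ Inside X e := by
  obtain ⟨a, b, hab⟩ := exists_ends e
  rw [mem_cut_iff hab] at h
  rw [inside_iff hab]
  rintro ⟨ha, hb⟩
  simp only [Set.mem_preimage, proj_of_mem ha, proj_of_mem hb] at h
  tauto

lemma not_inside_of_cut {X : Set G.V} {e : G.E} (h : e ∈ G.cut X) : ¬ Inside X e := by
  obtain ⟨a, b, hab⟩ := exists_ends e
  rw [mem_cut_iff hab] at h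
  rw [inside_iff hab]
  tauto

lemma IsTightCut.restrict {X : Set G.V} (hX : G.IsTightCut X) {M : Set G.E}
    (hM : G.IsPerfectMatching M) : (G.contract X).IsPerfectMatching {e | e.1 ∈ M} := by
  intro x
  by_cases hx : x = apex X
  · subst hx
    obtain ⟨e, ⟨he, hec⟩, hu⟩ := hX.2.2 M hM
    refine ⟨⟨e, not_inside_of_cut hec⟩, ⟨he, (contract_inc_apex _).2 hec⟩, ?_⟩
    rintro ⟨f, hf⟩ ⟨h1, h2⟩
    exact Subtype.ext (hu f ⟨h1, (contract_inc_apex _).1 h2⟩)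
  · obtain ⟨v, rfl⟩ := proj_surj hX.1 x
    rw [proj_eq_apex_iff] at hx
    obtain ⟨e, he, hev⟩ := hM.exists_edge v
    refine ⟨⟨e, fun h => hx (h v hev)⟩, ⟨he, (contract_inc _ hx).2 hev⟩, ?_⟩
    rintro ⟨f, hf⟩ ⟨h1, h2⟩
    exact Subtype.ext (hM.eq_of_inc h1 he ((contract_inc _ hx).1 h2) hev)

lemma IsTightCut.extend (hG : G.MatchingCovered) {X : Set G.V} (hX : G.IsTightCut X)
    {N : Set (G.contract X).E} (hN : (G.contract X).IsPerfectMatching N) :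
    ∃ M, G.IsPerfectMatching M ∧
      ∀ (e : G.E) (he : ¬ Inside X e), e ∈ M ↔ (⟨e, he⟩ : (G.contract X).E) ∈ N := by
  obtain ⟨⟨f, hf⟩, hfN, hfa⟩ := hN.exists_edge (apex X)
  have hfc := (contract_inc_apex hf).1 hfa
  obtain ⟨M, hM, hfM⟩ := hG.exists_mem f
  have hcut : ∀ e (hec : e ∈ G.cut X), e ∈ M ↔
      (⟨e, not_inside_of_cut hec⟩ : (G.contract X).E) ∈ N := by
    intro e hec
    constructor
    · intro he
      have := (hX.2.2 M hM).unique ⟨he, hec⟩ ⟨hfM, hfc⟩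
      subst this
      exact hfN
    · intro he
      have := congrArg Subtype.val
        (hN.eq_of_inc he hfN ((contract_inc_apex (not_inside_of_cut hec)).2 hec) hfa)
      change e = f at this
      rwa [this]
  refine ⟨{e | (Inside X e ∧ e ∈ M) ∨ ∃ he : ¬ Inside X e, (⟨e, he⟩ : (G.contract X).E) ∈ N},
    fun v => ?_, fun e he => ?_⟩
  · by_cases hv : v ∈ X
    · obtain ⟨e, he, hev⟩ := hM.exists_edge v
      refine ⟨e, ⟨?_, hev⟩, ?_⟩
      · rcases inside_or_cut_of_inc hv hev with h | h
        · exact Or.inl ⟨h, he⟩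
        · exact Or.inr ⟨_, (hcut e h).1 he⟩
      · rintro g ⟨⟨_, hg⟩ | ⟨hi, hg⟩, hgv⟩
        · exact hM.eq_of_inc hg he hgv hev
        · have := (inside_or_cut_of_inc hv hgv).resolve_left hi
          exact hM.eq_of_inc ((hcut g this).2 hg) he hgv hev
    · have key : ∀ g, G.Inc v g → ¬ Inside X g := fun g hg hi => hv (hi v hg)
      obtain ⟨⟨e, hi⟩, he, hev⟩ := hN.exists_edge (proj X v)
      refine ⟨e, ⟨Or.inr ⟨hi, he⟩, (contract_inc hi hv).1 hev⟩, ?_⟩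
      rintro g ⟨⟨h, -⟩ | ⟨hi', hg⟩, hgv⟩
      · exact absurd h (key g hgv)
      · exact congrArg Subtype.val (hN.eq_of_inc hg he ((contract_inc hi' hv).2 hgv) hev)
  · simp [he]

lemma connected_of_cut_nonempty (h : Nonempty G.V)
    (hc : ∀ X : Set G.V, X.Nonempty → X ≠ Set.univ → (G.cut X).Nonempty) : G.Connected := by
  refine ⟨h, fun u v => ?_⟩
  by_contra hv
  obtain ⟨e, a, ha, b, hb, hab⟩ := hc {w | Relation.ReflTransGen G.Adj u w}
    ⟨u, Relation.ReflTransGen.refl⟩ (fun h => hv (by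
      have : v ∈ {w | Relation.ReflTransGen G.Adj u w} := by rw [h]; trivial
      exact this))
  exact hb (Relation.ReflTransGen.tail ha ⟨ends_ne hab, e, hab⟩)

lemma IsTightCut.contract_matchingCovered (hG : G.MatchingCovered) {X : Set G.V}
    (hX : G.IsTightCut X) : (G.contract X).MatchingCovered := by
  refine ⟨?_, connected_of_cut_nonempty ⟨apex X⟩ fun Y h1 h2 => ?_, ?_⟩
  · obtain ⟨v, hv⟩ := hX.2.1
    have : proj X v ≠ apex X := fun h => hv (proj_eq_apex_iff.1 h)
    rw [← Set.ncard_pair this, ← Set.ncard_univ]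
    exact Set.ncard_le_ncard (Set.subset_univ _)
  · obtain ⟨y, hy⟩ := h1
    obtain ⟨z, hz⟩ := (Set.ne_univ_iff_exists_notMem Y).1 h2
    obtain ⟨v, rfl⟩ := proj_surj hX.1 y
    obtain ⟨w, rfl⟩ := proj_surj hX.1 z
    obtain ⟨e, he⟩ := hG.connected.cut_nonempty (X := proj X ⁻¹' Y) ⟨v, hy⟩
      ((Set.ne_univ_iff_exists_notMem _).2 ⟨w, hz⟩)
    exact ⟨⟨e, not_inside_of_cut_preimage he⟩, (contract_mem_cut _ Y).2 he⟩
  · rintro ⟨e, he⟩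
    obtain ⟨M, hM, heM⟩ := hG.exists_mem e
    exact ⟨_, hX.restrict hM, heM⟩

lemma IsTightCut.of_preimage (hG : G.MatchingCovered) {X : Set G.V} (hX : G.IsTightCut X)
    {Y : Set (G.contract X).V} (hY : G.IsTightCut (proj X ⁻¹' Y)) :
    (G.contract X).IsTightCut Y := by
  refine ⟨?_, ?_, fun N hN => ?_⟩
  · obtain ⟨v, hv⟩ := hY.1
    exact ⟨_, hv⟩
  · obtain ⟨v, hv⟩ := hY.2.1
    exact ⟨_, hv⟩
  · obtain ⟨M, hM, hMN⟩ := hX.extend hG hN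
    obtain ⟨e, ⟨he, hec⟩, hu⟩ := hY.2.2 M hM
    have hi := not_inside_of_cut_preimage hec
    refine ⟨⟨e, hi⟩, ⟨(hMN e hi).1 he, (contract_mem_cut hi Y).2 hec⟩, ?_⟩
    rintro ⟨f, hf⟩ ⟨h1, h2⟩
    exact Subtype.ext (hu f ⟨(hMN f hf).2 h1, (contract_mem_cut hf Y).1 h2⟩)

lemma BipartiteOn.preimage {X : Set G.V} {Y : Set (G.contract X).V}
    (hY : (G.contract X).BipartiteOn Y) (ha : apex X ∉ Y) : G.BipartiteOn (proj X ⁻¹' Y) := by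
  obtain ⟨c, hc⟩ := hY
  refine ⟨c ∘ proj X, fun e a b hab h1 h2 => ?_⟩
  have : ¬ Inside X e := by
    rw [inside_iff hab]
    rintro ⟨h, -⟩
    rw [Set.mem_preimage, proj_of_mem h] at h1
    exact ha h1
  exact hc _ _ _ (contract_ends this hab) h1 h2

lemma IsTightCut.bipartiteOn_preimage (hG : G.MatchingCovered) {X : Set G.V}
    (hX : G.IsTightCut X) (hbX : G.BipartiteOn X) {Y : Set (G.contract X).V}
    (hY : (G.contract X).BipartiteOn Y) (ha : apex X ∈ Y) : G.BipartiteOn (proj X ⁻¹' Y) := by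
  obtain ⟨c, hc⟩ := bipartiteOn_iff.1 hbX
  obtain ⟨d, hd⟩ := bipartiteOn_iff.1 hY
  obtain ⟨c', hc', hcol⟩ : ∃ c', ProperOn X c' ∧ ∀ e a b, G.ends e = s(a, b) → a ∈ X → b ∉ X →
      c' a = d (apex X) := by
    have hσ := fun e a b => hX.color_eq hG hc (e := e) (a := a) (b := b)
    generalize ∑ v, X.indicator c v = σ at hσ
    by_cases h : σ = d (apex X)
    · exact ⟨c, hc, fun e a b he ha hb => (hσ e a b he ha hb).trans h⟩
    · refine ⟨-c, hc.neg, fun e a b he ha hb => ?_⟩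
      have h1 := hσ e a b he ha hb
      have h2 := hc.1 a
      have h3 := hd.1 (apex X)
      simp only [Pi.neg_apply]
      omega
  have hd' : ProperOn (proj X ⁻¹' Y ∩ Xᶜ) (d ∘ proj X) := by
    refine ⟨fun v => hd.1 _, fun e a b hab h1 h2 => ?_⟩
    have : ¬ Inside X e := by
      rw [inside_iff hab]
      rintro ⟨h, -⟩
      exact h1.2 h
    exact hd.2 _ _ _ (contract_ends this hab) h1.1 h2.1
  have := hc'.ite hd' fun e a b hab h1 h2 h3 => by
    have hi : ¬ Inside X e := by
      rw [inside_iff hab]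
      tauto
    rw [hcol e a b hab h1 h3]
    have := hd.2 _ _ _ (contract_ends hi hab) (by rwa [proj_of_mem h1]) h2.1
    rwa [proj_of_mem h1] at this
  refine (bipartiteOn_iff.2 this).mono fun v hv => ?_
  by_cases h : v ∈ X
  · exact Or.inl h
  · exact Or.inr ⟨hv, h⟩

lemma IsTightCut.contract_bipartite (hG : G.MatchingCovered) {X : Set G.V}
    (hX : G.IsTightCut X) (hb : G.Bipartite) : (G.contract X).Bipartite := by
  classical
  obtain ⟨c, hc⟩ := bipartiteOn_iff.1 (bipartite_iff.1 hb)
  have hσ := fun e a b => hX.color_eq hG (hc.mono (Set.subset_univ X)) (e := e) (a := a) (b := b)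
  generalize ∑ v, X.indicator c v = σ at hσ
  have hσs : σ = 1 ∨ σ = -1 := by
    obtain ⟨e, a, ha, b, hb, hab⟩ := hG.connected.cut_nonempty hX.1 (by
      intro h
      obtain ⟨v, hv⟩ := hX.2.1
      exact hv (h ▸ Set.mem_univ v))
    rw [← hσ e a b hab ha hb]
    exact hc.1 a
  have key : ∀ x : (G.contract X).V, ∃ s : ℤ, (s = 1 ∨ s = -1) ∧
      (∀ v, v ∉ X → proj X v = x → s = c v) ∧ (x = apex X → s = σ) := by
    intro x
    by_cases hx : x = apex X
    · refine ⟨σ, hσs, fun v hv h => ?_, fun _ => rfl⟩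
      exact absurd (proj_eq_apex_iff.1 (h.trans hx)) hv
    · obtain ⟨v, rfl⟩ := proj_surj hX.1 x
      refine ⟨c v, hc.1 v, fun w hw h => by rw [proj_inj hw h], fun h => absurd h hx⟩
  choose d hd1 hd2 hd3 using key
  rw [bipartite_iff, bipartiteOn_iff]
  refine ⟨d, hd1, ?_⟩
  have main : ∀ (e : G.E) a b, G.ends e = s(a, b) → b ∉ X →
      d (proj X a) + d (proj X b) = 0 := by
    intro e a b hab hb
    rw [hd2 _ b hb rfl]
    have h0 := hc.2 e a b hab trivial trivial
    by_cases ha : a ∈ X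
    · rw [hd3 _ (proj_of_mem ha), ← hσ e a b hab ha hb, h0]
    · rw [hd2 _ a ha rfl, h0]
  rintro ⟨e, he⟩ x y hxy - -
  obtain ⟨a, b, hab⟩ := exists_ends e
  rw [contract_ends he hab] at hxy
  have hi : a ∉ X ∨ b ∉ X := by
    rw [← not_and_or, ← inside_iff hab]; exact he
  have h1 : d (proj X a) + d (proj X b) = 0 := by
    rcases hi with h | h
    · have := main e b a (by rw [hab, Sym2.eq_swap]) h
      omega
    · exact main e a b hab h
  rcases Sym2.eq_iff.1 hxy with ⟨h1, h2⟩ | ⟨h1, h2⟩ <;> rw [← h1, ← h2] <;> omega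

/-! ### Tight cuts in near-bricks -/

/-- Nonbipartite, and every tight cut has a bipartite shore. -/
def TightShoresBipartite (G : Multigraph) : Prop :=
  ¬ G.Bipartite ∧ ∀ Y : Set G.V, G.IsTightCut Y → G.BipartiteOn Y ∨ G.BipartiteOn Yᶜ

lemma par_add {X Y : Set G.V} (h : Disjoint X Y) : par (X ∪ Y) = par X + par Y := by
  unfold par
  rw [← Finset.sum_add_distrib]
  refine Finset.sum_congr rfl fun v _ => ?_
  rw [Set.indicator_union_of_disjoint h]

lemma par_inter_add (X Y : Set G.V) : par X = par (X ∩ Y) + par (X ∩ Yᶜ) := by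
  rw [← par_add]
  · rw [Set.inter_union_compl]
  · exact (disjoint_compl_right.mono Set.inter_subset_right Set.inter_subset_right)

lemma par_empty : par (∅ : Set G.V) = 0 := by simp [par]

lemma MatchingCovered.par_eq_one (hG : G.MatchingCovered) {X : Set G.V} (hX : G.IsTightCut X) :
    par X = 1 := by
  obtain ⟨e, -⟩ := hG.connected.cut_nonempty hX.1 (by
      intro h
      obtain ⟨v, hv⟩ := hX.2.1
      exact hv (h ▸ Set.mem_univ v))
  obtain ⟨M, hM, -⟩ := hG.exists_mem e
  exact hM.par_eq_one (hX.2.2 M hM)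

/-- Uncrossing of tight cuts. -/
lemma IsTightCut.inter (hG : G.MatchingCovered) {X Y : Set G.V} (hX : G.IsTightCut X)
    (hY : G.IsTightCut Y) (hp : par (X ∩ Y) = 1) : G.IsTightCut (Xᶜ ∩ Yᶜ) := by
  have hq : par (Xᶜ ∩ Yᶜ) = 1 := by
    have h1 := hG.par_eq_one hX
    have h2 := hG.par_eq_one hY.compl
    have h3 := par_inter_add X Y
    have h4 := par_inter_add Yᶜ X
    rw [Set.inter_comm Yᶜ X, Set.inter_comm Yᶜ] at h4
    rw [h1, hp] at h3
    rw [h2] at h4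
    have : par (X ∩ Yᶜ) = 0 := by simpa using h3
    rw [this, zero_add] at h4
    exact h4.symm
  refine ⟨?_, ?_, fun M hM => ?_⟩
  · by_contra h
    rw [Set.not_nonempty_iff_eq_empty] at h
    rw [h, par_empty] at hq
    exact absurd hq (by decide)
  · obtain ⟨x, hx⟩ := hX.1
    exact ⟨x, fun h => h.1 hx⟩
  · obtain ⟨e, he, hec⟩ := hM.exists_cut_of_par hq
    obtain ⟨g, hg, hgc⟩ := hM.exists_cut_of_par hp
    refine ⟨e, ⟨he, hec⟩, ?_⟩
    rintro f ⟨hf, hfc⟩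
    by_contra hne
    have hxu : ∀ p ∈ M, ∀ q ∈ M, p ∈ G.cut X → q ∈ G.cut X → p = q := fun p hp q hq h1 h2 =>
      (hX.2.2 M hM).unique ⟨hp, h1⟩ ⟨hq, h2⟩
    have hyu : ∀ p ∈ M, ∀ q ∈ M, p ∈ G.cut Y → q ∈ G.cut Y → p = q := fun p hp q hq h1 h2 =>
      (hY.2.2 M hM).unique ⟨hp, h1⟩ ⟨hq, h2⟩
    have key : ∀ p, (p ∈ G.cut (Xᶜ ∩ Yᶜ) → p ∈ G.cut X ∨ p ∈ G.cut Y) ∧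
        (p ∈ G.cut (X ∩ Y) → p ∈ G.cut X ∨ p ∈ G.cut Y) ∧
        (p ∈ G.cut (X ∩ Y) → p ∈ G.cut (Xᶜ ∩ Yᶜ) → p ∈ G.cut X ∧ p ∈ G.cut Y) := by
      intro p
      obtain ⟨a, b, hab⟩ := exists_ends p
      rw [mem_cut_iff hab, mem_cut_iff hab, mem_cut_iff hab, mem_cut_iff hab]
      simp only [Set.mem_inter_iff, Set.mem_compl_iff]
      tauto
    have he' := (key e).1 hec
    have hf' := (key f).1 hfc
    have hg' := (key g).2.1 hgc
    have hgk := (key g).2.2 hgc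
    grind

lemma glue_shores (hG : G.MatchingCovered) {X Y : Set G.V} (hX : G.IsTightCut X)
    (hY : G.IsTightCut Y) (hXY : Disjoint X Y) (hbX : G.BipartiteOn X) (hbY : G.BipartiteOn Y) :
    G.BipartiteOn (X ∪ Y) := by
  obtain ⟨c, hc⟩ := bipartiteOn_iff.1 hbX
  obtain ⟨d, hd⟩ := bipartiteOn_iff.1 hbY
  have hσ := fun e a b => hX.color_eq hG hc (e := e) (a := a) (b := b)
  have hτ := fun e a b => hY.color_eq hG hd (e := e) (a := a) (b := b)
  generalize ∑ v, X.indicator c v = σ at hσ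
  generalize ∑ v, Y.indicator d v = τ at hτ
  rw [bipartiteOn_iff]
  have key : ∀ e a b, G.ends e = s(a, b) → a ∈ X → b ∈ Y → b ∉ X → c a = σ ∧ d b = τ := by
    intro e a b hab ha hb hb'
    exact ⟨hσ e a b hab ha hb', hτ e b a (by rw [hab, Sym2.eq_swap]) hb
      fun h => Set.disjoint_left.1 hXY ha h⟩
  by_cases h : σ + τ = 0
  · refine hc.ite hd fun e a b hab ha hb hb' => ?_
    obtain ⟨h1, h2⟩ := key e a b hab ha hb hb'
    rw [h1, h2, h]
  · refine hc.ite hd.neg fun e a b hab ha hb hb' => ?_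
    obtain ⟨h1, h2⟩ := key e a b hab ha hb hb'
    have h3 := hc.1 a
    have h4 := hd.1 b
    simp only [Pi.neg_apply]
    omega

lemma TightShoresBipartite.of_contract (hG : G.MatchingCovered) {X : Set G.V}
    (hX : G.IsTightCut X) (hbX : G.BipartiteOn X) (hP : (G.contract X).TightShoresBipartite) :
    G.TightShoresBipartite := by
  refine ⟨fun h => hP.1 (hX.contract_bipartite hG h), ?_⟩
  have main : ∀ Y, G.IsTightCut Y → par (X ∩ Y) = 1 → G.BipartiteOn Y ∨ G.BipartiteOn Yᶜ := by
    intro Y hY hp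
    have hZ := hX.inter hG hY hp
    set Z := Xᶜ ∩ Yᶜ with hZdef
    set Z' : Set (G.contract X).V := proj X '' Z with hZ'
    have hpre : proj X ⁻¹' Z' = Z := by
      ext v
      constructor
      · rintro ⟨z, hz, hzv⟩
        rwa [← proj_inj hz.1 hzv]
      · exact fun h => ⟨v, h, rfl⟩
    have hapex : apex X ∉ Z' := by
      rintro ⟨z, hz, hzv⟩
      exact hz.1 (proj_eq_apex_iff.1 hzv)
    have hZ't : (G.contract X).IsTightCut Z' := IsTightCut.of_preimage hG hX (by rwa [hpre])
    rcases hP.2 Z' hZ't with h | h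
    · right
      have hbZ := h.preimage hapex
      rw [hpre] at hbZ
      refine (glue_shores hG hX hZ ?_ hbX hbZ).mono fun v hv => ?_
      · exact Set.disjoint_left.2 fun v h1 h2 => h2.1 h1
      · by_cases hvX : v ∈ X
        · exact Or.inl hvX
        · exact Or.inr ⟨hvX, hv⟩
    · left
      have := hX.bipartiteOn_preimage hG hbX h hapex
      rw [Set.preimage_compl, hpre] at this
      exact this.mono fun v hv h => h.2 hv
  intro Y hY
  have h1 := hG.par_eq_one hX
  rw [par_inter_add X Y] at h1
  have h2 : ∀ x y : ZMod 2, x + y = 1 → x = 1 ∨ y = 1 := by decide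
  rcases h2 _ _ h1 with h | h
  · exact main Y hY h
  · have := main Yᶜ hY.compl h
    rw [compl_compl] at this
    exact this.symm

lemma IsTightCut.bipartiteOn_compl {X : Set G.V} (h : (G.contract X).Bipartite) :
    G.BipartiteOn Xᶜ := by
  have h1 : (G.contract X).BipartiteOn {apex X}ᶜ := (bipartite_iff.1 h).mono (Set.subset_univ _)
  refine (h1.preimage (by simp)).mono fun v hv => ?_
  rw [Set.mem_preimage, Set.mem_compl_iff, Set.mem_singleton_iff, proj_eq_apex_iff]
  exact hv

lemma bipartiteOn_singleton (v : G.V) : G.BipartiteOn {v} :=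
  ⟨fun _ => true, fun _ a b hab ha hb => by
    rw [Set.mem_singleton_iff] at ha hb
    exact absurd (ha.trans hb.symm) (ends_ne hab)⟩

lemma BrickCount.bipartite_or {n : ℕ} (h : BrickCount G n) (hG : G.MatchingCovered) :
    (n = 0 → G.Bipartite) ∧ (n = 1 → G.TightShoresBipartite) := by
  induction h with
  | brick G h =>
    refine ⟨by simp, fun _ => ⟨h.2.1, fun Y hY => ?_⟩⟩
    rcases h.2.2 Y hY with ⟨v, hv⟩ | ⟨v, hv⟩
    · left; rw [hv]; exact bipartiteOn_singleton v
    · right; rw [hv]; exact bipartiteOn_singleton v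
  | brace G h => exact ⟨fun _ => h.2.1, by simp⟩
  | @cut G X hX _ n m h1 h2 ih1 ih2 =>
    have hi1 := ih1 (hX.contract_matchingCovered hG)
    have hi2 := ih2 (hX.compl.contract_matchingCovered hG)
    have hbX : m = 0 → G.BipartiteOn X := fun h => by
      have := IsTightCut.bipartiteOn_compl (hi2.1 h)
      rwa [compl_compl] at this
    constructor
    · intro h
      have := hX.bipartiteOn_preimage hG (hbX (by omega)) (bipartite_iff.1 (hi1.1 (by omega)))
        trivial
      rw [Set.preimage_univ] at this
      exact bipartite_iff.2 this
    · intro h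
      have : n = 1 ∧ m = 0 ∨ n = 0 ∧ m = 1 := by omega
      rcases this with ⟨hn, hm⟩ | ⟨hn, hm⟩
      · exact TightShoresBipartite.of_contract hG hX (hbX hm) (hi1.2 hn)
      · exact TightShoresBipartite.of_contract hG hX.compl
          (IsTightCut.bipartiteOn_compl (hi1.1 hn)) (hi2.2 hm)

/-! ### Pairs of equivalent edges -/

lemma exists_isPerfectMatching_subset {μ : G.V → G.V} (hμ : ∀ v, μ (μ v) = v) {A : Set G.E}
    (hA : ∀ v, ∃ g ∈ A, G.ends g = s(v, μ v)) : ∃ M, G.IsPerfectMatching M ∧ M ⊆ A := by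
  classical
  have key : ∀ p : Sym2 G.V, (∃ g ∈ A, G.ends g = p) → ∃ g ∈ A, G.ends g = p := fun _ h => h
  rcases isEmpty_or_nonempty G.E with hE | ⟨⟨e0⟩⟩
  · exact ⟨∅, fun v => by obtain ⟨g, -⟩ := hA v; exact (hE.false g).elim, Set.empty_subset _⟩
  have : ∀ p : Sym2 G.V, ∃ g, (∃ g ∈ A, G.ends g = p) → g ∈ A ∧ G.ends g = p := by
    intro p
    by_cases h : ∃ g ∈ A, G.ends g = p
    · obtain ⟨g, hg⟩ := h
      exact ⟨g, fun _ => hg⟩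
    · exact ⟨e0, fun h' => absurd h' h⟩
  choose pick hpick using this
  refine ⟨Set.range fun v => pick s(v, μ v), fun v => ?_, ?_⟩
  · refine ⟨pick s(v, μ v), ⟨⟨v, rfl⟩, inc_left (hpick _ (hA v)).2⟩, ?_⟩
    rintro _ ⟨⟨w, rfl⟩, hw⟩
    have := (inc_iff (hpick _ (hA w)).2).1 hw
    dsimp only
    rcases this with rfl | rfl
    · rfl
    · rw [hμ, Sym2.eq_swap]
  · rintro _ ⟨v, rfl⟩
    exact (hpick _ (hA v)).1

/-- The consequence of Tutte's theorem for the graph obtained by deleting the ends of `e` and the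
edge `f`. -/
lemma exists_barrier (hG : G.MatchingCovered) {e f : G.E} (hne : e ≠ f) (hd : Dep e f)
    {u v : G.V} (he : G.ends e = s(u, v)) :
    ∃ (ι : Type) (_ : Finite ι) (B : Set G.V) (K : ι → Set G.V), u ∈ B ∧ v ∈ B ∧
      (∀ i, par (K i) = 1) ∧ (∀ i j x, x ∈ K i → x ∈ K j → i = j) ∧ (∀ i x, x ∈ K i → x ∉ B) ∧
      B.ncard ≤ Nat.card ι ∧
      ∀ i g a b, G.ends g = s(a, b) → a ∈ K i → b ∉ K i → g ≠ f → b ∈ B := by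
  classical
  have huv := ends_ne he
  let W := {x : G.V // x ≠ u ∧ x ≠ v}
  let H : SimpleGraph W :=
    { Adj := fun x y => x ≠ y ∧ ∃ g, g ≠ f ∧ G.ends g = s(x.1, y.1)
      symm := ⟨fun x y ⟨h, g, hg, hg'⟩ => ⟨h.symm, g, hg, by rw [hg', Sym2.eq_swap]⟩⟩
      loopless := ⟨fun x h => h.1 rfl⟩ }
  have hno : ¬ ∃ P : SimpleGraph.Subgraph H, P.IsPerfectMatching := by
    rintro ⟨P, hP⟩
    rw [SimpleGraph.Subgraph.isPerfectMatching_iff] at hP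
    choose ν hν hνu using hP
    have hνν : ∀ x, ν (ν x) = x := fun x => (hνu _ _ (hν x).symm).symm
    let μ : G.V → G.V := fun x => if h : x ≠ u ∧ x ≠ v then (ν ⟨x, h⟩).1 else if x = u then v else u
    have hμ1 : ∀ (x : G.V) (h : x ≠ u ∧ x ≠ v), μ x = (ν ⟨x, h⟩).1 := fun x h => dif_pos h
    have hμu : μ u = v := by simp [μ]
    have hμv : μ v = u := by simp [μ, huv.symm]
    have hcases : ∀ x, (x ≠ u ∧ x ≠ v) ∨ x = u ∨ x = v := fun x => by tauto
    obtain ⟨M, hM, hMA⟩ := exists_isPerfectMatching_subset (G := G) (μ := μ)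
      (A := {g | g ≠ f ∧ (G.Inc u g → g = e)}) (by
        intro x
        rcases hcases x with h | rfl | rfl
        · rw [hμ1 x h, hμ1 _ (ν ⟨x, h⟩).2]
          exact congrArg Subtype.val (hνν ⟨x, h⟩)
        · rw [hμu, hμv]
        · rw [hμv, hμu]) (by
        intro x
        rcases hcases x with h | rfl | rfl
        · obtain ⟨-, g, hg, hgx⟩ := P.adj_sub (hν ⟨x, h⟩)
          refine ⟨g, ⟨hg, fun hi => ?_⟩, by rw [hμ1 x h, hgx]⟩
          rcases (inc_iff hgx).1 hi with h1 | h1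
          · exact absurd h1.symm h.1
          · exact absurd h1.symm (ν ⟨x, h⟩).2.1
        · exact ⟨e, ⟨hne, fun _ => rfl⟩, by rw [hμu, he]⟩
        · exact ⟨e, ⟨hne, fun _ => rfl⟩, by rw [hμv, he, Sym2.eq_swap]⟩)
    obtain ⟨g, hg, hgu⟩ := hM.exists_edge u
    have := (hMA hg).2 hgu
    subst this
    exact (hMA (hd M hM hg)).1 rfl
  rw [SimpleGraph.tutte] at hno
  push Not at hno
  obtain ⟨S, hS⟩ := hno
  unfold SimpleGraph.IsTutteViolator at hS
  set D := ((⊤ : H.Subgraph).deleteVerts S) with hD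
  have hVeven : Even (Nat.card G.V) := by
    obtain ⟨M, hM, -⟩ := hG.exists_mem e
    have h0 : par (Set.univ : Set G.V) = 0 :=
      hM.sum_eq_zero (w := fun _ => (1 : ZMod 2)) (fun _ _ _ _ _ _ _ => by decide)
        (by rintro g - ⟨a, -, b, hb, -⟩; exact hb trivial)
    rw [par_eq_ncard, Set.ncard_univ, ZMod.natCast_eq_zero_iff] at h0
    exact even_iff_two_dvd.2 h0
  have hWV : Nat.card W + 2 = Nat.card G.V := by
    have h1 := Set.ncard_add_ncard_compl ({u, v} : Set G.V)
    rw [Set.ncard_pair huv] at h1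
    have h2 : Nat.card W = ({u, v}ᶜ : Set G.V).ncard := by
      rw [← Nat.card_coe_set_eq]
      exact Nat.card_congr (Equiv.subtypeEquivRight fun x => by simp)
    omega
  have hDW : S.ncard + Nat.card D.verts = Nat.card W := by
    have h1 := Set.ncard_add_ncard_compl S
    have h2 : D.verts = Sᶜ := by
      rw [hD, SimpleGraph.Subgraph.deleteVerts_verts]; ext; simp
    rw [h2, Nat.card_coe_set_eq, h1]
  have hpar := SimpleGraph.odd_ncard_oddComponents (G := D.coe)
  have hbig : S.ncard + 2 ≤ D.coe.oddComponents.ncard := by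
    rw [Nat.odd_iff, Nat.odd_iff] at hpar
    rw [Nat.even_iff] at hVeven
    omega
  refine ⟨D.coe.oddComponents, inferInstance, {u, v} ∪ Subtype.val '' S,
    fun C => (fun y : D.verts => y.1.1) '' C.1.supp, by simp, by simp, ?_, ?_, ?_, ?_, ?_⟩
  · intro C
    rw [par_eq_ncard, Set.ncard_image_of_injective _
      (fun x y h => Subtype.ext (Subtype.ext h))]
    have := C.2
    exact (ZMod.natCast_eq_one_iff_odd).2 this
  · rintro C C' _ ⟨y, hy, rfl⟩ ⟨z, hz, hzy⟩
    have : z = y := Subtype.ext (Subtype.ext hzy)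
    subst this
    rw [SimpleGraph.ConnectedComponent.mem_supp_iff] at hy hz
    exact Subtype.ext (hy.symm.trans hz)
  · rintro C _ ⟨y, hy, rfl⟩ hB
    rcases hB with hB | ⟨z, hz, hzy⟩
    · have := y.1.2
      rcases hB with h | h
      · exact this.1 h
      · exact this.2 h
    · have : z = y.1 := Subtype.ext hzy
      subst this
      exact y.2.2 hz
  · refine (Set.ncard_union_le _ _).trans ?_
    rw [Set.ncard_pair huv, Set.ncard_image_of_injective _ Subtype.val_injective,
      Nat.card_coe_set_eq]
    omega
  · rintro C g _ b hg ⟨y, hy, rfl⟩ hb hgf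
    by_contra hB
    simp only [Set.mem_union, Set.mem_insert_iff, Set.mem_singleton_iff, not_or] at hB
    have hbS : (⟨b, hB.1⟩ : W) ∉ S := fun h => hB.2 ⟨_, h, rfl⟩
    have hbD : (⟨b, hB.1⟩ : W) ∈ D.verts := ⟨trivial, hbS⟩
    refine hb ⟨⟨⟨b, hB.1⟩, hbD⟩, ?_, rfl⟩
    rw [SimpleGraph.ConnectedComponent.mem_supp_iff] at hy ⊢
    rw [← hy]
    refine SimpleGraph.ConnectedComponent.sound (SimpleGraph.Adj.reachable ?_)
    refine SimpleGraph.Subgraph.deleteVerts_adj.2 ⟨trivial, hbS, trivial, y.2.2, ?_⟩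
    rw [SimpleGraph.Subgraph.top_adj]
    exact ⟨fun h => ends_ne hg (congrArg Subtype.val h).symm, g, hgf, by rw [hg, Sym2.eq_swap]⟩

section Counting

variable {M : Set G.E} {J : Type} {K : J → Set G.V} {T : Set G.V}

lemma IsPerfectMatching.exists_injective_exit (hM : G.IsPerfectMatching M)
    (hpar : ∀ j, par (K j) = 1) (hdisj : ∀ i j x, x ∈ K i → x ∈ K j → i = j)
    (hT : ∀ j g a b, g ∈ M → G.ends g = s(a, b) → a ∈ K j → b ∉ K j → b ∈ T) :
    ∃ φ : J → G.V, Function.Injective φ ∧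
      ∀ j, φ j ∈ T ∧ ∃ g ∈ M, ∃ a ∈ K j, φ j ∉ K j ∧ G.ends g = s(a, φ j) := by
  have : ∀ j, ∃ b, b ∈ T ∧ ∃ g ∈ M, ∃ a ∈ K j, b ∉ K j ∧ G.ends g = s(a, b) := by
    intro j
    obtain ⟨g, hg, a, ha, b, hb, hab⟩ := hM.exists_cut_of_par (hpar j)
    exact ⟨b, hT j g a b hg hab ha hb, g, hg, a, ha, hb, hab⟩
  choose φ hφ using this
  refine ⟨φ, fun i j hij => ?_, hφ⟩
  obtain ⟨-, g, hg, a, ha, -, hga⟩ := hφ i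
  obtain ⟨-, g', hg', a', ha', -, hga'⟩ := hφ j
  rw [hij] at hga
  have := hM.eq_of_inc hg hg' (inc_right hga) (inc_right hga')
  subst this
  rw [hga, Sym2.congr_left] at hga'
  subst hga'
  exact hdisj i j _ ha ha'

lemma IsPerfectMatching.card_le_of_exits [Finite J] (hM : G.IsPerfectMatching M)
    (hpar : ∀ j, par (K j) = 1) (hdisj : ∀ i j x, x ∈ K i → x ∈ K j → i = j)
    (hT : ∀ j g a b, g ∈ M → G.ends g = s(a, b) → a ∈ K j → b ∉ K j → b ∈ T) :
    Nat.card J ≤ T.ncard := by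
  obtain ⟨φ, hφ, hφT⟩ := hM.exists_injective_exit hpar hdisj hT
  have : (Set.range φ).ncard = Nat.card J := by
    rw [← Set.image_univ, Set.ncard_image_of_injective _ hφ, Set.ncard_univ]
  rw [← this]
  exact Set.ncard_le_ncard (by rintro _ ⟨j, rfl⟩; exact (hφT j).1)

lemma IsPerfectMatching.exits_of_card_le [Finite J] (hM : G.IsPerfectMatching M)
    (hpar : ∀ j, par (K j) = 1) (hdisj : ∀ i j x, x ∈ K i → x ∈ K j → i = j)
    (hT : ∀ j g a b, g ∈ M → G.ends g = s(a, b) → a ∈ K j → b ∉ K j → b ∈ T)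
    (hcard : T.ncard ≤ Nat.card J) :
    (∀ b ∈ T, ∃ j, ∃ g ∈ M, ∃ a ∈ K j, G.ends g = s(a, b)) ∧
      ∀ j, ∃! g, g ∈ M ∧ g ∈ G.cut (K j) := by
  obtain ⟨φ, hφ, hφT⟩ := hM.exists_injective_exit hpar hdisj hT
  have hr : (Set.range φ).ncard = Nat.card J := by
    rw [← Set.image_univ, Set.ncard_image_of_injective _ hφ, Set.ncard_univ]
  have hrT : Set.range φ = T :=
    Set.eq_of_subset_of_ncard_le (by rintro _ ⟨j, rfl⟩; exact (hφT j).1) (by omega)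
  constructor
  · rintro b hb
    rw [← hrT] at hb
    obtain ⟨j, rfl⟩ := hb
    obtain ⟨-, g, hg, a, ha, -, hga⟩ := hφT j
    exact ⟨j, g, hg, a, ha, hga⟩
  · intro j
    obtain ⟨-, g, hg, a, ha, hb, hga⟩ := hφT j
    refine ⟨g, ⟨hg, a, ha, _, hb, hga⟩, ?_⟩
    rintro h ⟨hh, a', ha', b, hb', hab⟩
    have hbT := hT j h a' b hh hab ha' hb'
    rw [← hrT] at hbT
    obtain ⟨k, rfl⟩ := hbT
    obtain ⟨-, g', hg', a'', ha'', -, hga'⟩ := hφT k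
    have := hM.eq_of_inc hh hg' (inc_right hab) (inc_right hga')
    subst this
    rw [hab, Sym2.congr_left] at hga'
    subst hga'
    obtain rfl := hdisj j k _ ha' ha''
    exact hM.eq_of_inc hh hg (inc_right hab) (inc_right hga)

end Counting

/-- The structure around a pair of equivalent edges. -/
lemma exists_tight_partition (hG : G.MatchingCovered) {e f : G.E} (hne : e ≠ f) (hef : Dep e f)
    (hfe : Dep f e) {u v : G.V} (he : G.ends e = s(u, v)) :
    ∃ (ι : Type) (B : Set G.V) (K : ι → Set G.V), u ∈ B ∧ v ∈ B ∧
      (∀ i, G.IsTightCut (K i)) ∧ (∀ i j x, x ∈ K i → x ∈ K j → i = j) ∧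
      (∀ i x, x ∈ K i → x ∉ B) ∧ (∀ x, x ∈ B ∨ ∃ i, x ∈ K i) ∧
      (∀ g a b, G.ends g = s(a, b) → a ∈ B → b ∈ B → g = e) ∧
      (∀ i g a b, G.ends g = s(a, b) → a ∈ K i → b ∉ K i → g ≠ f → b ∈ B) ∧
      ∃ i j p q, i ≠ j ∧ G.ends f = s(p, q) ∧ p ∈ K i ∧ q ∈ K j := by
  classical
  obtain ⟨ι, _, B, K, hu, hv, hpar, hdisj, hKB, hcard, hX⟩ := exists_barrier hG hne hef he
  have huv := ends_ne he
  -- perfect matchings avoiding `f`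
  have hoff : ∀ M, G.IsPerfectMatching M → f ∉ M →
      (∀ b ∈ B, ∃ j, ∃ g ∈ M, ∃ a ∈ K j, G.ends g = s(a, b)) ∧
        ∀ j, ∃! g, g ∈ M ∧ g ∈ G.cut (K j) := fun M hM hf =>
    hM.exits_of_card_le hpar hdisj
      (fun j g a b hg hab ha hb => hX j g a b hab ha hb fun h => hf (h ▸ hg)) hcard
  -- perfect matchings containing `f`
  let F : Set ι := {i | f ∈ G.cut (K i)}
  have hT : ∀ M, G.IsPerfectMatching M → f ∈ M → ∀ i g a b, g ∈ M → G.ends g = s(a, b) → a ∈ K i →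
      b ∉ K i → g ≠ f → b ∈ B \ {u, v} := by
    intro M hM hf i g a b hg hab ha hb hgf
    refine ⟨hX i g a b hab ha hb hgf, fun hbuv => ?_⟩
    have heM := hfe M hM hf
    have : g = e := by
      rcases hbuv with rfl | rfl
      · exact hM.eq_of_inc hg heM (inc_right hab) (inc_left he)
      · exact hM.eq_of_inc hg heM (inc_right hab) (inc_right he)
    subst this
    rcases (inc_iff he).1 (inc_left hab) with rfl | rfl
    · exact hKB i _ ha hu
    · exact hKB i _ ha hv
  have hTJ : ∀ M, G.IsPerfectMatching M → f ∈ M → ∀ (i : {i // i ∉ F}) g a b, g ∈ M →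
      G.ends g = s(a, b) → a ∈ K i → b ∉ K i → b ∈ B \ {u, v} := by
    intro M hM hf i g a b hg hab ha hb
    refine hT M hM hf i g a b hg hab ha hb ?_
    rintro rfl
    exact i.2 ⟨a, ha, b, hb, hab⟩
  have hdJ : ∀ (i j : {i // i ∉ F}) x, x ∈ K i → x ∈ K j → i = j :=
    fun i j x hi hj => Subtype.ext (hdisj _ _ x hi hj)
  have hTcard : (B \ {u, v}).ncard + 2 = B.ncard := by
    rw [← Set.ncard_pair huv]
    exact Set.ncard_sdiff_add_ncard_of_subset (by rintro x (rfl | rfl) <;> assumption)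
  have hFcard : F.ncard + Nat.card {i // i ∉ F} = Nat.card ι := by
    rw [← Set.ncard_add_ncard_compl F]
    rfl
  obtain ⟨i0, j0, p, q, hij, hf, hp, hq⟩ :
      ∃ i j p q, i ≠ j ∧ G.ends f = s(p, q) ∧ p ∈ K i ∧ q ∈ K j := by
    obtain ⟨M, hM, hfM⟩ := hG.exists_mem f
    have := hM.card_le_of_exits (fun i : {i // i ∉ F} => hpar i) hdJ (hTJ M hM hfM)
    have h1 : 1 < F.ncard := by omega
    obtain ⟨i, hi, j, hj, hij⟩ := (Set.one_lt_ncard).1 h1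
    obtain ⟨p, hp, q, hq, hpq⟩ := hi
    have hj' := (mem_cut_iff hpq).1 hj
    refine ⟨i, j, p, q, hij, hpq, hp, ?_⟩
    rcases hj' with h | h
    · exact absurd (hdisj i j p hp h.1) hij
    · exact h.2
  have hF2 : F.ncard ≤ 2 := by
    rw [← Set.ncard_pair hij]
    refine Set.ncard_le_ncard fun k hk => ?_
    rcases (mem_cut_iff hf).1 hk with h | h
    · exact Or.inl (hdisj _ _ p h.1 hp)
    · exact Or.inr (hdisj _ _ q h.2 hq)
  have hon : ∀ M, G.IsPerfectMatching M → f ∈ M →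
      (∀ b ∈ B \ {u, v}, ∃ j : {i // i ∉ F}, ∃ g ∈ M, ∃ a ∈ K j, G.ends g = s(a, b)) ∧
        ∀ j : {i // i ∉ F}, ∃! g, g ∈ M ∧ g ∈ G.cut (K j) := fun M hM hf =>
    hM.exits_of_card_le (fun i : {i // i ∉ F} => hpar i) hdJ (hTJ M hM hf) (by omega)
  have htight : ∀ i, G.IsTightCut (K i) := by
    intro i
    refine ⟨?_, ⟨u, fun h => hKB i u h hu⟩, fun M hM => ?_⟩
    · by_contra h
      have := hpar i
      rw [Set.not_nonempty_iff_eq_empty.1 h, par_empty] at this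
      exact absurd this (by decide)
    by_cases hfM : f ∈ M
    · by_cases hi : i ∈ F
      · refine ⟨f, ⟨hfM, hi⟩, ?_⟩
        rintro g ⟨hg, a, ha, b, hb, hab⟩
        by_contra hgf
        obtain ⟨j, g', hg', a', ha', hab'⟩ := (hon M hM hfM).1 b
          (hT M hM hfM i g a b hg hab ha hb hgf)
        have := hM.eq_of_inc hg hg' (inc_right hab) (inc_right hab')
        subst this
        rw [hab, Sym2.congr_left] at hab'
        subst hab'
        have := hdisj _ _ _ ha ha'
        subst this
        exact j.2 hi
      · exact (hon M hM hfM).2 ⟨i, hi⟩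
    · exact (hoff M hM hfM).2 i
  have hBK : ∀ g a b, G.ends g = s(a, b) → a ∈ B → g ≠ e → ∃ i, b ∈ K i := by
    intro g a b hab ha hge
    obtain ⟨M, hM, hg⟩ := hG.exists_mem g
    obtain ⟨j, g', hg', a', ha', hab'⟩ : ∃ j, ∃ g ∈ M, ∃ x ∈ K j, G.ends g = s(x, a) := by
      by_cases hfM : f ∈ M
      · obtain ⟨j, h⟩ := (hon M hM hfM).1 a ⟨ha, fun h => hge (by
          have heM := hfe M hM hfM
          rcases h with rfl | rfl
          · exact hM.eq_of_inc hg heM (inc_left hab) (inc_left he)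
          · exact hM.eq_of_inc hg heM (inc_left hab) (inc_right he))⟩
        exact ⟨j, h⟩
      · exact (hoff M hM hfM).1 a ha
    have := hM.eq_of_inc hg hg' (inc_left hab) (inc_right hab')
    subst this
    rw [hab, Sym2.eq_swap, Sym2.congr_left] at hab'
    subst hab'
    exact ⟨j, ha'⟩
  have hE : ∀ g a b, G.ends g = s(a, b) → a ∈ B → b ∈ B → g = e := by
    intro g a b hab ha hb
    by_contra hge
    obtain ⟨i, hi⟩ := hBK g a b hab ha hge
    exact hKB i b hi hb
  have hcover : ∀ x, x ∈ B ∨ ∃ i, x ∈ K i := by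
    have : G.cut {x | x ∈ B ∨ ∃ i, x ∈ K i} = ∅ := by
      rw [Set.eq_empty_iff_forall_notMem]
      rintro g ⟨a, ha, b, hb, hab⟩
      apply hb
      rcases ha with ha | ⟨i, ha⟩
      · by_cases hge : g = e
        · subst hge
          rcases (inc_iff he).1 (inc_right hab) with rfl | rfl
          · exact Or.inl hu
          · exact Or.inl hv
        · exact Or.inr (hBK g a b hab ha hge)
      · by_cases hbi : b ∈ K i
        · exact Or.inr ⟨i, hbi⟩
        by_cases hgf : g = f
        · subst hgf
          rcases (inc_iff hf).1 (inc_right hab) with rfl | rfl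
          · exact Or.inr ⟨_, hp⟩
          · exact Or.inr ⟨_, hq⟩
        · exact Or.inl (hX i g a b hab ha hbi hgf)
    rcases hG.eq_empty_or_univ this with h | h
    · have : u ∈ {x | x ∈ B ∨ ∃ i, x ∈ K i} := Or.inl hu
      rw [h] at this
      exact absurd this (Set.notMem_empty u)
    · intro x
      have : x ∈ {x | x ∈ B ∨ ∃ i, x ∈ K i} := by rw [h]; trivial
      exact this
  exact ⟨ι, B, K, hu, hv, htight, hdisj, hKB, hcover, hE, hX, i0, j0, p, q, hij, hf, hp, hq⟩

/-- A colouring of the vertices for which every edge other than `e` and `f` has ends of distinct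
colours, while the ends of `e` have colour `1` and those of `f` colour `-1`. -/
def PairColoring (e f : G.E) (c : G.V → ℤ) : Prop :=
  IsSign c ∧ (∀ g a b, G.ends g = s(a, b) → g ≠ e → g ≠ f → c a + c b = 0) ∧
    (∀ x, G.Inc x e → c x = 1) ∧ ∀ x, G.Inc x f → c x = -1

/-- Two equivalent edges in a near-brick are either the two monochromatic edges of a colouring or
the edges of a cut with a bipartite shore. -/
lemma exists_pairColoring_or_cut (hG : G.MatchingCovered) (hP : G.TightShoresBipartite) {e f : G.E}
    (hne : e ≠ f) (hef : Dep e f) (hfe : Dep f e) :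
    (∃ c, PairColoring e f c) ∨ ∃ Y, G.cut Y = {e, f} ∧ G.BipartiteOn Y := by
  obtain ⟨u, v, he⟩ := exists_ends e
  obtain ⟨ι, B, K, hu, hv, ht, hdisj, hKB, hcover, hE, hX, i0, j0, p, q, hij, hf, hp, hq⟩ :=
    exists_tight_partition hG hne hef hfe he
  have hBe : ∀ g a b, G.ends g = s(a, b) → a ∈ B → g ≠ e → ∃ i, b ∈ K i := fun g a b hab ha hge =>
    (hcover b).resolve_left fun hb => hge (hE g a b hab ha hb)
  by_cases hall : ∀ i, G.BipartiteOn (K i)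
  · left
    simp only [bipartiteOn_iff] at hall
    choose c hc using hall
    have hcol := fun i e a b => (ht i).color_eq hG (hc i) (e := e) (a := a) (b := b)
    replace hcol : ∀ i e a b, G.ends e = s(a, b) → a ∈ K i → b ∉ K i →
      c i a = ∑ v, (K i).indicator (c i) v := hcol
    have : ∀ x, ∃ t : ℤ, (t = 1 ∨ t = -1) ∧ (x ∈ B → t = 1) ∧ ∀ i, x ∈ K i →
        t = - (∑ v, (K i).indicator (c i) v) * c i x ∨
        (∑ v, (K i).indicator (c i) v ≠ 1 ∧ ∑ v, (K i).indicator (c i) v ≠ -1) := by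
      intro x
      rcases hcover x with h | ⟨i, h⟩
      · exact ⟨1, Or.inl rfl, fun _ => rfl, fun i hi => absurd h (hKB i x hi)⟩
      · generalize hσ : ∑ v, (K i).indicator (c i) v = σ
        by_cases h1 : σ = 1 ∨ σ = -1
        · refine ⟨-σ * c i x, ?_, fun hb => absurd hb (hKB i x h), fun j hj => ?_⟩
          · rcases h1 with rfl | rfl <;> rcases (hc i).1 x with h | h <;> simp [h]
          · obtain rfl := hdisj i j x h hj
            left; rw [hσ]
        · push Not at h1
          refine ⟨1, Or.inl rfl, fun _ => rfl, fun j hj => ?_⟩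
          obtain rfl := hdisj i j x h hj
          right; rw [hσ]; exact h1
    choose t hts htB htK using this
    have hex : ∀ i g a b, G.ends g = s(a, b) → a ∈ K i → b ∉ K i → t a = -1 := by
      intro i g a b hab ha hb
      have h1 := hcol i g a b hab ha hb
      have h2 := htK a i ha
      rw [← h1] at h2
      rcases (hc i).1 a with h | h <;> rw [h] at h2 <;> simpa using h2
    refine ⟨t, hts, fun g a b hab hge hgf => ?_, fun x hx => ?_, fun x hx => ?_⟩
    · have key : ∀ a b, G.ends g = s(a, b) → a ∈ B → t a + t b = 0 := by
        intro a b hab ha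
        obtain ⟨i, hi⟩ := hBe g a b hab ha hge
        rw [htB a ha, hex i g b a (by rw [hab, Sym2.eq_swap]) hi fun h => hKB i a h ha]
        rfl
      rcases hcover a with ha | ⟨i, ha⟩
      · exact key a b hab ha
      · by_cases hb : b ∈ K i
        · have h1 := (hc i).2 g a b hab ha hb
          have h2 := ht i
          have hσ : ∑ v, (K i).indicator (c i) v = 1 ∨ ∑ v, (K i).indicator (c i) v = -1 := by
            obtain ⟨k, x, hx, y, hy, hxy⟩ := hG.connected.cut_nonempty (X := K i) ⟨a, ha⟩ (by
              intro h
              exact hKB i u (h ▸ trivial) hu)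
            rw [← hcol i k x y hxy hx hy]
            exact (hc i).1 x
          have ha' := (htK a i ha).resolve_right (by tauto)
          have hb' := (htK b i hb).resolve_right (by tauto)
          rw [ha', hb', ← mul_add, h1, mul_zero]
        · have := key b a (by rw [hab, Sym2.eq_swap]) (hX i g a b hab ha hb hgf)
          omega
    · rcases (inc_iff he).1 hx with rfl | rfl
      · exact htB _ hu
      · exact htB _ hv
    · rcases (inc_iff hf).1 hx with rfl | rfl
      · exact hex i0 f _ _ hf hp fun h => hij (hdisj _ _ _ h hq)
      · exact hex j0 f _ _ (by rw [hf, Sym2.eq_swap]) hq fun h => hij (hdisj _ _ _ hp h)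
  · right
    push Not at hall
    obtain ⟨k, hk⟩ := hall
    obtain ⟨c, hc⟩ := bipartiteOn_iff.1 ((hP.2 _ (ht k)).resolve_left hk)
    have hsub : ∀ i, i ≠ k → K i ⊆ (K k)ᶜ := fun i hi x hx hx' => hi (hdisj i k x hx hx')
    have hcol : ∀ i, i ≠ k → ∃ s, ∀ g a b, G.ends g = s(a, b) → a ∈ K i → b ∉ K i → c a = s :=
      fun i hi => ⟨_, fun g a b => (ht i).color_eq hG (hc.mono (hsub i hi))⟩
    obtain ⟨τ, hτ⟩ : ∃ τ, ∀ g a b, G.ends g = s(a, b) → a ∉ K k → b ∈ K k → c a = τ :=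
      ⟨_, fun g a b hab ha hb => (ht k).compl.color_eq hG hc hab ha (fun h => h hb)⟩
    choose! s hs using hcol
    have : ∀ x, ∃ t : ℤ, (x ∈ B → t = c x) ∧ (∀ i, i ≠ k → x ∈ K i → t = - s i) ∧
        (x ∈ K k → t = τ) := by
      intro x
      rcases hcover x with h | ⟨i, h⟩
      · exact ⟨c x, fun _ => rfl, fun i _ hi => absurd h (hKB i x hi),
          fun hi => absurd h (hKB k x hi)⟩
      · by_cases hik : i = k
        · subst hik
          exact ⟨τ, fun hb => absurd hb (hKB i x h), fun j hj hxj => absurd (hdisj _ _ x hxj h) hj,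
            fun _ => rfl⟩
        · exact ⟨-s i, fun hb => absurd hb (hKB i x h), fun j hj hxj => by
            rw [hdisj _ _ x h hxj], fun h' => absurd (hdisj _ _ x h h') hik⟩
    choose t htB htK htk using this
    have hmono : ∀ g a b, G.ends g = s(a, b) → g ≠ e → g ≠ f → t a = t b := by
      intro g a b hab hge hgf
      have key : ∀ a b, G.ends g = s(a, b) → a ∈ B → t a = t b := by
        intro a b hab ha
        obtain ⟨i, hi⟩ := hBe g a b hab ha hge
        rw [htB a ha]
        by_cases hik : i = k
        · subst hik
          rw [htk b hi]
          exact hτ g a b hab (fun h => hKB i a h ha) hi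
        · rw [htK b i hik hi, ← hs i hik g b a (by rw [hab, Sym2.eq_swap]) hi fun h => hKB i a h ha]
          have := hc.2 g a b hab (fun h => hKB k a h ha) (hsub i hik hi)
          omega
      rcases hcover a with ha | ⟨i, ha⟩
      · exact key a b hab ha
      · by_cases hb : b ∈ K i
        · by_cases hik : i = k
          · subst hik
            rw [htk a ha, htk b hb]
          · rw [htK a i hik ha, htK b i hik hb]
        · exact (key b a (by rw [hab, Sym2.eq_swap]) (hX i g a b hab ha hb hgf)).symm
    have hYk : {x | t x = -τ} ⊆ (K k)ᶜ := by
      intro x hx hxk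
      have h1 := htk x hxk
      have h2 : t x = -τ := hx
      obtain ⟨g, a, ha, b, hb, hab⟩ := hG.connected.cut_nonempty (X := K k) ⟨x, hxk⟩ (by
        intro h
        exact hKB k u (h ▸ trivial) hu)
      have h3 := hτ g b a (by rw [hab, Sym2.eq_swap]) hb ha
      have := hc.1 b
      omega
    have hcut : G.cut {x | t x = -τ} ⊆ {e, f} := by
      rintro g ⟨a, ha, b, hb, hab⟩
      by_contra hg
      simp only [Set.mem_insert_iff, Set.mem_singleton_iff, not_or] at hg
      apply hb
      have : t a = -τ := ha
      change t b = -τ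
      rw [← this, hmono g a b hab hg.1 hg.2]
    have hτs : τ = 1 ∨ τ = -1 := by
      obtain ⟨g, a, ha, b, hb, hab⟩ := hG.connected.cut_nonempty (ht k).1 (by
        intro h
        exact hKB k u (h ▸ trivial) hu)
      rw [← hτ g b a (by rw [hab, Sym2.eq_swap]) hb ha]
      exact hc.1 b
    have hecut : e ∈ G.cut {x | t x = -τ} := by
      rw [mem_cut_iff he]
      simp only [Set.mem_ofPred_eq]
      rw [htB u hu, htB v hv]
      have h0 := hc.2 e u v he (fun h => hKB k u h hu) (fun h => hKB k v h hv)
      have h1 := hc.1 u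
      omega
    refine ⟨{x | t x = -τ}, Set.Subset.antisymm hcut ?_, bipartiteOn_iff.2 ⟨c, hc.mono hYk⟩⟩
    have hfcut : f ∈ G.cut {x | t x = -τ} := by
      by_contra hf'
      have hsub : G.cut {x | t x = -τ} ⊆ {e} := fun g hg => by
        rcases hcut hg with h | h
        · exact h
        · exact absurd (h ▸ hg) hf'
      obtain ⟨a, ha, b, hb, -⟩ := hecut
      rcases hG.eq_empty_or_univ_of_subset (card_ge_three_of_not_bipartite hP.1) hsub with h | h
      · rw [h] at ha; exact ha
      · rw [h] at hb; exact hb trivial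
    rintro g (rfl | rfl)
    · exact hecut
    · exact hfcut

/-! ### Equivalent edges forming a cut -/

/-- A cut with shore `Z` consisting of two equivalent edges `t` and `t'`. -/
def TwoCut (t t' : G.E) (Z : Set G.V) : Prop :=
  t ≠ t' ∧ Dep t t' ∧ Dep t' t ∧ G.cut Z = {t, t'}

lemma TwoCut.symm {t t' : G.E} {Z : Set G.V} (h : TwoCut t t' Z) : TwoCut t' t Z :=
  ⟨h.1.symm, h.2.2.1, h.2.1, by rw [h.2.2.2, Set.pair_comm]⟩

lemma TwoCut.compl {t t' : G.E} {Z : Set G.V} (h : TwoCut t t' Z) : TwoCut t t' Zᶜ :=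
  ⟨h.1, h.2.1, h.2.2.1, by rw [cut_compl, h.2.2.2]⟩

lemma TwoCut.exists_left {t t' : G.E} {Z : Set G.V} (h : TwoCut t t' Z) :
    ∃ a b, G.ends t = s(a, b) ∧ a ∈ Z ∧ b ∉ Z := by
  have : t ∈ G.cut Z := by rw [h.2.2.2]; simp
  obtain ⟨a, ha, b, hb, hab⟩ := this
  exact ⟨a, b, hab, ha, hb⟩

lemma TwoCut.mem_cut_iff {t t' : G.E} {Z : Set G.V} (h : TwoCut t t' Z) {e : G.E} :
    e ∈ G.cut Z ↔ e = t ∨ e = t' := by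
  rw [h.2.2.2]; rfl

lemma Inside.notMem_cut {Z : Set G.V} {e : G.E} (h : G.Inside Z e) : e ∉ G.cut Z := by
  rintro ⟨a, -, b, hb, hab⟩
  exact hb (h b (by rw [hab]; simp))

/-- Perfect matchings agreeing on one edge of a cut of two equivalent edges can be spliced. -/
lemma TwoCut.splice {t t' : G.E} {Z : Set G.V} (h : TwoCut t t' Z) {M M' : Set G.E}
    (hM : G.IsPerfectMatching M) (hM' : G.IsPerfectMatching M') (hMM : t ∈ M ↔ t ∈ M') :
    G.IsPerfectMatching {e | (G.Inside Z e ∧ e ∈ M) ∨ (¬ G.Inside Z e ∧ e ∈ M')} := by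
  refine hM.splice hM' fun e he => ?_
  rcases h.mem_cut_iff.1 he with rfl | rfl
  · exact hMM
  · exact ⟨fun h1 => h.2.1 _ hM' (hMM.1 (h.2.2.1 _ hM h1)),
      fun h1 => h.2.1 _ hM (hMM.2 (h.2.2.1 _ hM' h1))⟩

lemma TwoCut.bipartite (hG : G.MatchingCovered) (h3 : 3 ≤ Nat.card G.V) {t t' : G.E}
    {Z : Set G.V} (h : TwoCut t t' Z) (h1 : G.BipartiteOn Z) (h2 : G.BipartiteOn Zᶜ) :
    G.Bipartite := by
  rw [bipartiteOn_iff] at h1 h2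
  obtain ⟨c, hc⟩ := h1
  obtain ⟨d, hd⟩ := h2
  obtain ⟨a, b, hab, ha, hb⟩ := h.exists_left
  obtain ⟨a', b', hab', ha', hb'⟩ := h.symm.exists_left
  have hcc := color_two_cut hG h3 h.1 h.2.2.2 h.2.1 h.2.2.1 hc hab ha hab' ha'
  have hdd := color_two_cut hG h3 h.1 h.compl.2.2.2 h.2.1 h.2.2.1 hd
    (by rw [hab, Sym2.eq_swap]) hb (by rw [hab', Sym2.eq_swap]) hb'
  obtain ⟨d, hd, hdd, hab0⟩ : ∃ d, ProperOn Zᶜ d ∧ d b + d b' = 0 ∧ c a + d b = 0 := by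
    by_cases h0 : c a + d b = 0
    · exact ⟨d, hd, hdd, h0⟩
    · refine ⟨-d, hd.neg, by simp only [Pi.neg_apply]; omega, ?_⟩
      have := hc.1 a
      have := hd.1 b
      simp only [Pi.neg_apply]
      omega
  rw [bipartite_iff, bipartiteOn_iff, ← Set.union_compl_self Z]
  refine hc.ite hd fun e x y hxy hx hy _ => ?_
  rcases h.mem_cut_iff.1 ((Multigraph.mem_cut_iff hxy).2 (Or.inl ⟨hx, hy⟩)) with rfl | rfl
  · rw [hab] at hxy
    rcases Sym2.eq_iff.1 hxy with ⟨rfl, rfl⟩ | ⟨rfl, rfl⟩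
    · exact hab0
    · exact absurd ha hy
  · rw [hab'] at hxy
    rcases Sym2.eq_iff.1 hxy with ⟨rfl, rfl⟩ | ⟨rfl, rfl⟩
    · omega
    · exact absurd ha' hy

lemma PairColoring.symm {e f : G.E} {c : G.V → ℤ} (h : PairColoring e f c) :
    PairColoring f e (-c) :=
  ⟨h.1.neg, fun g a b hab h1 h2 => by
    have := h.2.1 g a b hab h2 h1
    simp only [Pi.neg_apply]; omega,
   fun x hx => by simp [h.2.2.2 x hx], fun x hx => by simp [h.2.2.1 x hx]⟩

lemma PairColoring.properOn {e f : G.E} {c : G.V → ℤ} (h : PairColoring e f c) {X : Set G.V}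
    (he : ¬ G.Inside X e) (hf : ¬ G.Inside X f) : ProperOn X c :=
  ⟨h.1, fun g a b hab ha hb => h.2.1 g a b hab
    (fun hg => he (hg ▸ (inside_iff hab).2 ⟨ha, hb⟩))
    (fun hg => hf (hg ▸ (inside_iff hab).2 ⟨ha, hb⟩))⟩

lemma not_inside_compl {Z : Set G.V} {e : G.E} (h : G.Inside Z e) : ¬ G.Inside Zᶜ e := by
  obtain ⟨a, b, hab⟩ := exists_ends e
  exact fun h' => h' a (by rw [hab]; simp) (h a (by rw [hab]; simp))

/-- If `g` is not inside the shore `Z`, an edge `k` incident with `Z` depending on `g` is forced by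
the status of `t`. -/
lemma TwoCut.mem_of_dep {t t' : G.E} {Z : Set G.V} (h : TwoCut t t' Z) {g k : G.E}
    (hgk : Dep g k) (hg : ¬ G.Inside Z g) {b : G.V} (hb : b ∈ Z) (hk : G.Inc b k) {N : Set G.E}
    (hN : G.IsPerfectMatching N) (hgN : g ∈ N) {M : Set G.E} (hM : G.IsPerfectMatching M)
    (hiff : t ∈ M ↔ t ∈ N) : k ∈ M := by
  have h1 := hgk _ (h.splice hM hN hiff) (Or.inr ⟨hg, hgN⟩)
  rcases h1 with h1 | ⟨h1, h2⟩
  · exact h1.2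
  · rcases inside_or_cut_of_inc hb hk with h4 | h4
    · exact absurd h4 h1
    · rcases h.mem_cut_iff.1 h4 with rfl | rfl
      · exact hiff.2 h2
      · exact h.2.1 _ hM (hiff.2 (h.2.2.1 _ hN h2))

/-- A bipartite shore of a cut of two equivalent edges induces a removable edge. -/
lemma TwoCut.exists_removable (hG : G.MatchingCovered) (hP : G.TightShoresBipartite)
    (hirr : G.Irreducible) {t t' : G.E} {Z : Set G.V} (h : TwoCut t t' Z)
    (hZ : G.BipartiteOn Z) : ∃ r, G.Removable r ∧ G.Inside Z r := by
  have h3 := card_ge_three_of_not_bipartite hP.1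
  induction hn : Z.ncard using Nat.strong_induction_on generalizing Z t t' with
  | _ n ih =>
  obtain ⟨M1, hM1, htM1⟩ := hG.exists_mem t
  obtain ⟨M2, hM2, htM2⟩ := hG.exists_notMem h3 t
  obtain ⟨a, a', hta, ha, ha'⟩ := h.exists_left
  have hb : ∃ b ∈ Z, 3 ≤ G.degree b := by
    by_contra! hc
    have hdeg : ∀ x ∈ Z, G.degree x = 2 := fun x hx => by
      have := hc x hx
      have := hG.two_le_degree h3 x
      omega
    obtain ⟨g, hg, hgt⟩ := hG.exists_inc_ne h3 a t
    obtain ⟨b, hab⟩ := hg.exists_other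
    have hgt' : g ≠ t' := by
      rintro rfl
      exact hgt (hM1.eq_of_inc (h.2.1 _ hM1 htM1) htM1 hg (inc_left hta))
    have hbZ : b ∈ Z := by
      by_contra hb
      rcases h.mem_cut_iff.1 ((Multigraph.mem_cut_iff hab).2 (Or.inl ⟨ha, hb⟩)) with h | h
      · exact hgt h
      · exact hgt' h
    exact hirr.not_adj_degree_two hG h3 hab (hdeg a ha) (hdeg b hbZ)
  obtain ⟨b, hb, hbd⟩ := hb
  obtain ⟨k1, hk1, hbk1⟩ := hM1.exists_edge b
  obtain ⟨k2, hk2, hbk2⟩ := hM2.exists_edge b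
  obtain ⟨k, hk, hkk1, hkk2⟩ := exists_inc_of_three_le hbd k1 k2
  have hall : ∀ g, Dep g k → G.Inside Z g := by
    intro g hg
    by_contra hgZ
    obtain ⟨N, hN, hgN⟩ := hG.exists_mem g
    by_cases htN : t ∈ N
    · exact hkk1 (hM1.eq_of_inc (h.mem_of_dep hg hgZ hb hk hN hgN hM1 (by simp [htN, htM1]))
        hk1 hk hbk1)
    · exact hkk2 (hM2.eq_of_inc (h.mem_of_dep hg hgZ hb hk hN hgN hM2 (by simp [htN, htM2]))
        hk2 hk hbk2)
  obtain ⟨e, hes, hek⟩ := exists_source k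
  by_cases hsing : ∀ g, Dep g e → g = e
  · exact ⟨e, removable_of_forall_dep hG h3 hsing, hall e hek⟩
  push Not at hsing
  obtain ⟨f, hfe, hne⟩ := hsing
  have heZ := hall e hek
  have hfZ := hall f (hfe.trans hek)
  rcases exists_pairColoring_or_cut hG hP hne.symm (hes f hfe) hfe with ⟨c, hc⟩ | ⟨Y, hY, -⟩
  · refine absurd (h.bipartite hG h3 hZ (bipartiteOn_iff.2 ⟨c, hc.properOn ?_ ?_⟩)) hP.1
    · exact not_inside_compl heZ
    · exact not_inside_compl hfZ
  · have hYc : TwoCut e f Y := ⟨hne.symm, hes f hfe, hfe, hY⟩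
    have key : ∀ Y, TwoCut e f Y → a' ∉ Y → ∃ r, G.Removable r ∧ G.Inside Z r := by
      intro Y hY haY
      have htY : t ∉ G.cut Y := by
        intro hh
        have : t ∈ G.cut Z := h.mem_cut_iff.2 (Or.inl rfl)
        rcases hY.mem_cut_iff.1 hh with rfl | rfl
        · exact heZ.notMem_cut this
        · exact hfZ.notMem_cut this
      have hsub : G.cut (Zᶜ ∩ Y) ⊆ {t'} := by
        rintro g ⟨x, hx, y, hy, hxy⟩
        by_cases hyZ : y ∈ Z
        · rcases h.mem_cut_iff.1 ((Multigraph.mem_cut_iff hxy).2 (Or.inr ⟨hx.1, hyZ⟩)) with rfl | h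
          · rw [hta] at hxy
            rcases Sym2.eq_iff.1 hxy with ⟨rfl, rfl⟩ | ⟨rfl, rfl⟩
            · exact absurd ha hx.1
            · exact absurd hx.2 haY
          · exact h
        · have hyY : y ∉ Y := fun h => hy ⟨hyZ, h⟩
          have h1 : ¬ G.Inside Z g := fun h => hx.1 ((inside_iff hxy).1 h).1
          rcases hY.mem_cut_iff.1 ((Multigraph.mem_cut_iff hxy).2 (Or.inl ⟨hx.2, hyY⟩)) with h | h
          · exact absurd (h ▸ heZ) h1
          · exact absurd (h ▸ hfZ) h1
      have hYZ : Y ⊆ Z := by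
        rcases hG.eq_empty_or_univ_of_subset h3 hsub with h | h
        · intro x hx
          by_contra hxZ
          have : x ∈ Zᶜ ∩ Y := ⟨hxZ, hx⟩
          rw [h] at this
          exact this
        · have : a ∈ Zᶜ ∩ Y := h ▸ trivial
          exact absurd ha this.1
      have hlt : Y.ncard < n := by
        rw [← hn]
        refine Set.ncard_lt_ncard ⟨hYZ, fun hZY => ?_⟩
        have : Y = Z := Set.Subset.antisymm hYZ hZY
        subst this
        exact htY (h.mem_cut_iff.2 (Or.inl rfl))
      obtain ⟨r, hr, hrY⟩ := ih _ hlt hY (hZ.mono hYZ) rfl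
      exact ⟨r, hr, fun v hv => hYZ (hrY v hv)⟩
    by_cases haY : a' ∈ Y
    · exact key Yᶜ hYc.compl fun h => h haY
    · exact key Y hYc haY

/-! ### Pure pairs -/

lemma eq_of_dep (hG : G.MatchingCovered) {v : G.V} {g h h' : G.E} (hh : G.Inc v h)
    (hh' : G.Inc v h') (h1 : Dep g h) (h2 : Dep g h') : h = h' := by
  obtain ⟨M, hM, hg⟩ := hG.exists_mem g
  exact hM.eq_of_inc (h1 M hM hg) (h2 M hM hg) hh hh'

lemma TwoCut.dep_of_inside (hG : G.MatchingCovered) {v : G.V} (hv : 3 ≤ G.degree v)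
    {t t' : G.E} {Z : Set G.V} (hZ : TwoCut t t' Z) (hvZ : v ∉ Z) {g h h' : G.E}
    (hh : G.Inc v h) (hth : Dep t h) (hh' : G.Inc v h') (hgh : Dep g h') (hg : G.Inside Z g) :
    Dep g t := by
  intro N hN hgN
  by_contra htN
  obtain ⟨k, hk, hkh, hkh'⟩ := exists_inc_of_three_le hv h h'
  obtain ⟨M, hM, hkM⟩ := hG.exists_mem k
  by_cases htM : t ∈ M
  · exact hkh (hM.eq_of_inc hkM (hth M hM htM) hk hh)
  · have := hZ.compl.mem_of_dep hgh (not_inside_compl hg) hvZ hh' hN hgN hM (by simp [htN, htM])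
    exact hkh' (hM.eq_of_inc hkM this hk hh')

lemma TwoCut.inter_eq_empty (hG : G.MatchingCovered) {v : G.V} (hv : 3 ≤ G.degree v)
    {t t' u u' : G.E} {Y Z : Set G.V} (hY : TwoCut t t' Y) (hZ : TwoCut u u' Z) (hvY : v ∉ Y)
    (hvZ : v ∉ Z) {h h' : G.E} (hh : G.Inc v h) (hh' : G.Inc v h') (hne : h ≠ h')
    (hth : Dep t h) (huh : Dep u h') : Y ∩ Z = ∅ := by
  have key : ∀ {t t' u u' : G.E} {Y Z : Set G.V}, TwoCut t t' Y → TwoCut u u' Z → v ∉ Z →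
      ∀ {h h' : G.E}, G.Inc v h → G.Inc v h' → h ≠ h' → Dep t h → Dep u h' →
      ∀ {e a b}, G.ends e = s(a, b) → a ∈ Z → e ∈ G.cut Y → False := by
    intro t t' u u' Y Z hY hZ hvZ h h' hh hh' hne hth huh e a b hab ha he
    have heh : Dep e h := by
      rcases hY.mem_cut_iff.1 he with rfl | rfl
      · exact hth
      · exact hY.2.2.1.trans hth
    have heh' : Dep e h' := by
      rcases inside_or_cut_of_inc ha (inc_left hab) with h1 | h1
      · exact (hZ.dep_of_inside hG hv hvZ hh' huh hh heh h1).trans huh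
      · rcases hZ.mem_cut_iff.1 h1 with rfl | rfl
        · exact huh
        · exact hZ.2.2.1.trans huh
    exact hne (eq_of_dep hG hh hh' heh heh')
  have hcut : G.cut (Y ∩ Z) = ∅ := by
    rw [Set.eq_empty_iff_forall_notMem]
    rintro e ⟨a, ha, b, hb, hab⟩
    by_cases hbY : b ∈ Y
    · exact key hZ hY hvY hh' hh hne.symm huh hth hab ha.1
        ((Multigraph.mem_cut_iff hab).2 (Or.inl ⟨ha.2, fun h => hb ⟨hbY, h⟩⟩))
    · exact key hY hZ hvZ hh hh' hne hth huh hab ha.2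
        ((Multigraph.mem_cut_iff hab).2 (Or.inl ⟨ha.1, hbY⟩))
  rcases hG.eq_empty_or_univ hcut with h | h
  · exact h
  · have : v ∈ Y ∩ Z := h ▸ trivial
    exact absurd this.1 hvY

/-- A pair of equivalent source edges with a pair colouring, no two edges of whose class form a cut
with a bipartite shore. -/
structure Pure (e f : G.E) (c : G.V → ℤ) : Prop where
  ne : e ≠ f
  dep : Dep e f
  dep' : Dep f e
  source : IsSource e
  notCut : ∀ t t' Y, Dep t e → TwoCut t t' Y → ¬ G.BipartiteOn Y
  col : PairColoring e f c

lemma Pure.symm {e f : G.E} {c : G.V → ℤ} (h : Pure e f c) : Pure f e (-c) :=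
  ⟨h.ne.symm, h.dep', h.dep, h.source.of_dep h.dep', fun t t' Y ht => h.notCut t t' Y
    (ht.trans h.dep'), h.col.symm⟩

/-- Three edges at `v` depending on three pure pairs. -/
structure Triple (v : G.V) (h e f : Fin 3 → G.E) (c : Fin 3 → G.V → ℤ) : Prop where
  inj : Function.Injective h
  inc : ∀ i, G.Inc v (h i)
  pure : ∀ i, Pure (e i) (f i) (c i)
  dep : ∀ i, Dep (e i) (h i)

lemma exists_triple_of {v : G.V} {h₀ h₁ h₂ e₀ e₁ e₂ f₀ f₁ f₂ : G.E} {c₀ c₁ c₂ : G.V → ℤ}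
    (i₀ : G.Inc v h₀) (i₁ : G.Inc v h₁) (i₂ : G.Inc v h₂) (n₀₁ : h₀ ≠ h₁) (n₀₂ : h₀ ≠ h₂)
    (n₁₂ : h₁ ≠ h₂) (p₀ : Pure e₀ f₀ c₀) (p₁ : Pure e₁ f₁ c₁) (p₂ : Pure e₂ f₂ c₂)
    (d₀ : Dep e₀ h₀) (d₁ : Dep e₁ h₁) (d₂ : Dep e₂ h₂) : ∃ h e f c, Triple v h e f c := by
  refine ⟨![h₀, h₁, h₂], ![e₀, e₁, e₂], ![f₀, f₁, f₂], ![c₀, c₁, c₂], ?_, ?_, ?_, ?_⟩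
  · intro i j hij
    fin_cases i <;> fin_cases j <;> simp_all
  · intro i
    fin_cases i
    exacts [i₀, i₁, i₂]
  · intro i
    fin_cases i
    exacts [p₀, p₁, p₂]
  · intro i
    fin_cases i
    exacts [d₀, d₁, d₂]

/-- Either at least `deg v - 2` edges are removable, or `v` has a triple. -/
lemma degree_le_or_exists_triple (hG : G.MatchingCovered) (hP : G.TightShoresBipartite)
    (hirr : G.Irreducible) {v : G.V} (hv : 3 ≤ G.degree v) :
    G.degree v ≤ Nat.card {e // G.Removable e} + 2 ∨ ∃ h e f c, Triple v h e f c := by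
  have h3 := card_ge_three_of_not_bipartite hP.1
  choose s hs hsh using exists_source (G := G)
  set Good : G.E → G.E → Prop := fun h r => G.Removable r ∧ (r = s h ∨ ∃ t t' Z, TwoCut t t' Z ∧
    Dep t (s h) ∧ v ∉ Z ∧ G.Inside Z r) with hGood
  have hgood_inj : ∀ h h' r, G.Inc v h → G.Inc v h' → Good h r → Good h' r → h = h' := by
    rintro h h' r hh hh' ⟨-, h1⟩ ⟨-, h2⟩
    by_contra hne
    rcases h1 with rfl | ⟨t, t', Z, hZ, ht, hvZ, hr⟩ <;>
      rcases h2 with h2 | ⟨u, u', Y, hY, hu, hvY, hr'⟩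
    · exact hne (eq_of_dep hG hh hh' (hsh h) (h2 ▸ hsh h'))
    · have huh := hu.trans (hsh h')
      exact hne (eq_of_dep hG hh hh' (hsh h)
        ((hY.dep_of_inside hG hv hvY hh' huh hh (hsh h) hr').trans huh))
    · subst h2
      have hth := ht.trans (hsh h)
      exact hne (eq_of_dep hG hh hh'
        ((hZ.dep_of_inside hG hv hvZ hh hth hh' (hsh h') hr).trans hth) (hsh h'))
    · have h0 := hZ.inter_eq_empty hG hv hY hvZ hvY hh hh' hne (ht.trans (hsh h))
        (hu.trans (hsh h'))
      obtain ⟨a, b, hab⟩ := exists_ends r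
      have : a ∈ Z ∩ Y := ⟨hr a (by rw [hab]; simp), hr' a (by rw [hab]; simp)⟩
      rw [h0] at this
      exact this
  have hbip : ∀ h, (¬ ∃ r, Good h r) → ∀ t t' Y, Dep t (s h) → TwoCut t t' Y →
      G.BipartiteOn Y → v ∈ Y := by
    intro h hbad t t' Y ht hY hYb
    by_contra hvY
    obtain ⟨r, hr, hrY⟩ := hY.exists_removable hG hP hirr hYb
    exact hbad ⟨r, hr, Or.inr ⟨t, t', Y, hY, ht, hvY, hrY⟩⟩
  have hpure : ∀ h, (¬ ∃ r, Good h r) → (∃ f c, Pure (s h) f c) ∨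
      ∃ t t' Z, TwoCut t t' Z ∧ Dep t (s h) ∧ v ∉ Z ∧ ¬ G.BipartiteOn Z ∧ G.BipartiteOn Zᶜ := by
    intro h hbad
    by_cases hN : ∃ t t' Y, Dep t (s h) ∧ TwoCut t t' Y ∧ G.BipartiteOn Y
    · obtain ⟨t, t', Y, ht, hY, hYb⟩ := hN
      right
      exact ⟨t, t', Yᶜ, hY.compl, ht, fun h' => h' (hbip h hbad t t' Y ht hY hYb),
        fun h' => hP.1 (hY.bipartite hG h3 hYb h'), by rwa [compl_compl]⟩
    left
    have hsing : ¬ ∀ g, Dep g (s h) → g = s h := fun hh =>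
      hbad ⟨s h, removable_of_forall_dep hG h3 hh, Or.inl rfl⟩
    push Not at hsing
    obtain ⟨f, hf, hne⟩ := hsing
    rcases exists_pairColoring_or_cut hG hP hne.symm (hs h f hf) hf with ⟨c, hc⟩ | ⟨Y, hY, hYb⟩
    · exact ⟨f, c, hne.symm, hs h f hf, hf, hs h,
        fun t t' Y ht hY hYb => hN ⟨t, t', Y, ht, hY, hYb⟩,
        hc⟩
    · exact absurd ⟨s h, f, Y, Dep.refl _, ⟨hne.symm, hs h f hf, hf, hY⟩, hYb⟩ hN
  have hexcl : ∀ h h', G.Inc v h → G.Inc v h' → h ≠ h' → (¬ ∃ r, Good h' r) → ∀ t t' Z,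
      TwoCut t t' Z → Dep t (s h) → v ∉ Z → ¬ G.BipartiteOn Z → G.BipartiteOn Zᶜ → False := by
    intro h h' hh hh' hne hbad t t' Z hZ ht hvZ hZn hZb
    rcases hpure h' hbad with ⟨f, c, hp⟩ | ⟨u, u', Y, hY, hu, hvY, hYn, -⟩
    · have hin : ∀ g, Dep g h' → ¬ G.Inside Z g := fun g hg hgZ =>
        hne (eq_of_dep hG hh hh'
          ((hZ.dep_of_inside hG hv hvZ hh (ht.trans (hsh h)) hh' hg hgZ).trans
          (ht.trans (hsh h))) hg)
      exact hZn (bipartiteOn_iff.2 ⟨c, hp.col.properOn (hin _ (hsh h'))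
        (hin f (hp.dep'.trans (hsh h')))⟩)
    · have h0 := hZ.inter_eq_empty hG hv hY hvZ hvY hh hh' hne (ht.trans (hsh h))
        (hu.trans (hsh h'))
      refine hYn (hZb.mono fun x hx hxZ => ?_)
      have : x ∈ Z ∩ Y := ⟨hxZ, hx⟩
      rw [h0] at this
      exact this
  set bad : Set G.E := {h | G.Inc v h ∧ ¬ ∃ r, Good h r} with hbad
  by_cases hcard : bad.ncard ≤ 2
  · left
    have h1 : {h | G.Inc v h} = {h | G.Inc v h ∧ ∃ r, Good h r} ∪ bad := by
      ext h
      simp only [hbad, Set.mem_union, Set.mem_ofPred_eq]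
      rw [← and_or_left]
      exact (and_iff_left (em _)).symm
    have h2 : {h | G.Inc v h ∧ ∃ r, Good h r}.ncard ≤ {e | G.Removable e}.ncard := by
      have : ∀ h, ∃ r, (∃ r, Good h r) → Good h r := fun h => by
        by_cases hh : ∃ r, Good h r
        · exact ⟨hh.choose, fun _ => hh.choose_spec⟩
        · exact ⟨h, fun h' => absurd h' hh⟩
      choose r hr using this
      refine Set.ncard_le_ncard_of_injOn r (fun h hh => (hr h hh.2).1) fun h hh h' hh' he => ?_
      exact hgood_inj h h' (r h) hh.1 hh'.1 (hr h hh.2) (he ▸ hr h' hh'.2)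
    rw [degree_eq_ncard, h1]
    refine (Set.ncard_union_le _ _).trans ?_
    exact Nat.add_le_add h2 hcard
  · right
    obtain ⟨a, ha, b, hb, c, hc, hab, hac, hbc⟩ := (Set.two_lt_ncard (Set.toFinite _)).1
      (not_le.1 hcard)
    have hall : ∀ x ∈ bad, (∃ y ∈ bad, x ≠ y) → ∃ f c, Pure (s x) f c := by
      rintro x hx ⟨y, hy, hxy⟩
      rcases hpure x hx.2 with h | ⟨t, t', Z, hZ, ht, hvZ, hZn, hZb⟩
      · exact h
      · exact (hexcl x y hx.1 hy.1 hxy hy.2 t t' Z hZ ht hvZ hZn hZb).elim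
    obtain ⟨f1, c1, h1⟩ := hall a ha ⟨b, hb, hab⟩
    obtain ⟨f2, c2, h2⟩ := hall b hb ⟨a, ha, hab.symm⟩
    obtain ⟨f3, c3, h3⟩ := hall c hc ⟨a, ha, hac.symm⟩
    exact exists_triple_of ha.1 hb.1 hc.1 hab hac hbc h1 h2 h3 (hsh a) (hsh b) (hsh c)

/-! ### Colourings of several pure pairs -/

lemma IsSign.sq {c : G.V → ℤ} (h : IsSign c) (x : G.V) : c x * c x = 1 := by
  rcases h x with h | h <;> simp [h]

/-- The two ends of `e` have the same colour. -/
lemma PairColoring.eq_of_inc {e f : G.E} {c : G.V → ℤ} (h : PairColoring e f c) {g : G.E}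
    (hg : g = e ∨ g = f) {x y : G.V} (hx : G.Inc x g) (hy : G.Inc y g) : c x = c y := by
  rcases hg with rfl | rfl
  · rw [h.2.2.1 x hx, h.2.2.1 y hy]
  · rw [h.2.2.2 x hx, h.2.2.2 y hy]

lemma PairColoring.add_eq_zero {e f : G.E} {c : G.V → ℤ} (h : PairColoring e f c) {M : Set G.E}
    (he : e ∉ M) (hf : f ∉ M) {g : G.E} (hg : g ∈ M) {a b : G.V} (hab : G.ends g = s(a, b)) :
    c a + c b = 0 :=
  h.2.1 g a b hab (fun h => he (h ▸ hg)) (fun h => hf (h ▸ hg))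

section Sum

variable {e₁ e₂ e₃ f₁ f₂ f₃ : G.E} {c₁ c₂ c₃ : G.V → ℤ}

lemma sum_mul_eq_zero {M : Set G.E} (hM : G.IsPerfectMatching M) (h₁ : Pure e₁ f₁ c₁)
    (h₂ : Pure e₂ f₂ c₂) (h₃ : Pure e₃ f₃ c₃) (n₁ : e₁ ∉ M) (n₂ : e₂ ∉ M) (n₃ : e₃ ∉ M) :
    ∑ v, c₁ v * (c₂ v * c₃ v) = 0 := by
  have := hM.sum_eq_zero (X := Set.univ) (w := fun v => c₁ v * (c₂ v * c₃ v))
    (fun g hg a b hab _ _ => ?_) (fun g hg h => ?_)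
  · simpa using this
  · have i₁ := h₁.col.add_eq_zero n₁ (fun h => n₁ (h₁.dep' M hM h)) hg hab
    have i₂ := h₂.col.add_eq_zero n₂ (fun h => n₂ (h₂.dep' M hM h)) hg hab
    have i₃ := h₃.col.add_eq_zero n₃ (fun h => n₃ (h₃.dep' M hM h)) hg hab
    rw [eq_neg_of_add_eq_zero_left i₁, eq_neg_of_add_eq_zero_left i₂,
      eq_neg_of_add_eq_zero_left i₃]
    ring
  · obtain ⟨a, -, b, hb, -⟩ := h
    exact hb trivial

lemma sum_mul_eq_sub {M : Set G.E} (hM : G.IsPerfectMatching M) (h₁ : Pure e₁ f₁ c₁)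
    (h₂ : Pure e₂ f₂ c₂) (h₃ : Pure e₃ f₃ c₃) (n₁ : e₁ ∈ M) (n₂ : e₂ ∉ M) (n₃ : e₃ ∉ M) {x y : G.V}
    (hx : G.Inc x e₁) (hy : G.Inc y f₁) :
    ∑ v, c₁ v * (c₂ v * c₃ v) = 2 * (c₂ x * c₃ x - c₂ y * c₃ y) := by
  obtain ⟨x', hxx⟩ := hx.exists_other
  obtain ⟨y', hyy⟩ := hy.exists_other
  have m₁ := h₁.dep M hM n₁
  set w : G.V → ℤ := fun v => c₁ v * (c₂ v * c₃ v) with hw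
  have i₂ : ∀ {g a b}, g ∈ M → G.ends g = s(a, b) → c₂ a = - c₂ b := fun hg hab =>
    eq_neg_of_add_eq_zero_left (h₂.col.add_eq_zero n₂ (fun h => n₂ (h₂.dep' M hM h)) hg hab)
  have i₃ : ∀ {g a b}, g ∈ M → G.ends g = s(a, b) → c₃ a = - c₃ b := fun hg hab =>
    eq_neg_of_add_eq_zero_left (h₃.col.add_eq_zero n₃ (fun h => n₃ (h₃.dep' M hM h)) hg hab)
  have hdis : ∀ {a}, G.Inc a e₁ → G.Inc a f₁ → False := fun h h' =>
    h₁.ne (hM.eq_of_inc n₁ m₁ h h')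
  have hne : x' ≠ y' := by
    rintro rfl
    exact hdis (inc_right hxx) (inc_right hyy)
  have h := hM.sum_eq_two (X := {x', y'}ᶜ) (w := w) (fun g hg a b hab ha hb => ?_) h₁.ne n₁ hxx
    (a := x) ?_ (by simp) m₁ hyy (a' := y) ?_ (by simp) (fun g hg h => ?_)
  · have hs := Finset.sum_add_distrib (f := ({x', y'}ᶜ : Set G.V).indicator w)
      (g := ({x', y'} : Set G.V).indicator w) (s := Finset.univ)
    have h2 : ∑ v, ({x', y'} : Set G.V).indicator w v = w x' + w y' := by
      classical
      rw [← Finset.sum_pair hne, Finset.sum_indicator_eq_sum_filter]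
      refine Finset.sum_congr ?_ fun _ _ => rfl
      ext v
      simp
    rw [h, h2] at hs
    have h3 : ∀ v, ({x', y'}ᶜ : Set G.V).indicator w v + ({x', y'} : Set G.V).indicator w v = w v :=
      fun v => by rw [Set.indicator_compl_add_self_apply]
    simp only [h3] at hs
    rw [hs, hw]
    dsimp only
    rw [i₂ n₁ hxx, i₃ n₁ hxx, i₂ m₁ hyy, i₃ m₁ hyy, h₁.col.2.2.1 x hx,
      h₁.col.2.2.1 x' (inc_right hxx), h₁.col.2.2.2 y hy, h₁.col.2.2.2 y' (inc_right hyy)]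
    ring
  · have hg1 : g ≠ e₁ := by
      rintro rfl
      rcases (inc_iff hab).1 (inc_right hxx) with rfl | rfl
      · exact ha (by simp)
      · exact hb (by simp)
    have hg2 : g ≠ f₁ := by
      rintro rfl
      rcases (inc_iff hab).1 (inc_right hyy) with rfl | rfl
      · exact ha (by simp)
      · exact hb (by simp)
    have := h₁.col.2.1 g a b hab hg1 hg2
    rw [hw]
    dsimp only
    rw [i₂ hg hab, i₃ hg hab, eq_neg_of_add_eq_zero_left this]
    ring
  · rintro (h | h)
    · exact ends_ne hxx h
    · exact hdis hx (h ▸ inc_right hyy)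
  · rintro (h | h)
    · exact hdis (h ▸ inc_right hxx) hy
    · exact ends_ne hyy h
  · obtain ⟨a, -, b, hb, hab⟩ := h
    replace hb : b ∈ ({x', y'} : Set G.V) := not_not.1 hb
    rcases hb with rfl | rfl
    · exact Or.inl (hM.eq_of_inc hg n₁ (inc_right hab) (inc_right hxx))
    · exact Or.inr (hM.eq_of_inc hg m₁ (inc_right hab) (inc_right hyy))

end Sum

/-- The class of a pure pair consists of just two edges. -/
lemma Pure.eq_or_eq_of_dep (hG : G.MatchingCovered) (hP : G.TightShoresBipartite) {e f g : G.E}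
    {c : G.V → ℤ} (h : Pure e f c) (hg : Dep g e) : g = e ∨ g = f := by
  by_contra! hne
  have h3 := card_ge_three_of_not_bipartite hP.1
  have heg := h.source g hg
  rcases exists_pairColoring_or_cut hG hP hne.1.symm heg hg with ⟨d, hd⟩ | ⟨Y, hY, hYb⟩
  swap
  · exact h.notCut e g Y (Dep.refl e) ⟨hne.1.symm, heg, hg, hY⟩ hYb
  have hc := h.col
  have hcut : G.cut {v | c v = d v} = {f, g} := by
    ext k
    obtain ⟨a, b, hab⟩ := exists_ends k
    rw [Multigraph.mem_cut_iff hab]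
    simp only [Set.mem_ofPred_eq, Set.mem_insert_iff, Set.mem_singleton_iff]
    have ca := hc.1 a
    have cb := hc.1 b
    have da := hd.1 a
    have db := hd.1 b
    have ia := inc_left hab
    have ib := inc_right hab
    by_cases h1 : k = e
    · subst h1
      have := hc.2.2.1 a ia
      have := hc.2.2.1 b ib
      have := hd.2.2.1 a ia
      have := hd.2.2.1 b ib
      have := h.ne
      have := hne.1.symm
      simp_all
    by_cases h2 : k = f
    · subst h2
      have := hc.2.2.2 a ia
      have := hc.2.2.2 b ib
      have := hd.2.1 k a b hab h1 hne.2.symm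
      simp only [true_or, iff_true]
      omega
    by_cases h4 : k = g
    · subst h4
      have := hd.2.2.2 a ia
      have := hd.2.2.2 b ib
      have := hc.2.1 k a b hab h1 h2
      simp only [or_true, iff_true]
      omega
    have := hc.2.1 k a b hab h1 h2
    have := hd.2.1 k a b hab h1 h4
    simp only [h2, h4, or_false, iff_false]
    omega
  have hfg : TwoCut f g {v | c v = d v} := ⟨hne.2.symm, h.dep'.trans heg, hg.trans h.dep, hcut⟩
  refine h.notCut f g _ h.dep' hfg.compl (bipartiteOn_iff.2 ⟨c, hc.properOn ?_ ?_⟩)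
  · obtain ⟨a, b, hab⟩ := exists_ends e
    intro hi
    refine hi a (inc_left hab) ?_
    change c a = d a
    rw [hc.2.2.1 a (inc_left hab), hd.2.2.1 a (inc_left hab)]
  · exact fun hi => hi.notMem_cut (hfg.compl.mem_cut_iff.2 (Or.inl rfl))

lemma Pure.exists_mem_notMem (hG : G.MatchingCovered) (hP : G.TightShoresBipartite)
    {e f g k : G.E} {c d : G.V → ℤ} (h : Pure e f c) (h' : Pure g k d) (hne : g ≠ e)
    (hne' : g ≠ f) :
    ∃ M, G.IsPerfectMatching M ∧ e ∈ M ∧ g ∉ M := by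
  by_contra! hc
  rcases h.eq_or_eq_of_dep hG hP (h'.source e hc) with h | h
  · exact hne h
  · exact hne' h

/-- The products of two colours agree on all ends of a pure pair. -/
lemma Pure.mul_eq {e₁ e₂ e₃ f₁ f₂ f₃ : G.E} {c₁ c₂ c₃ : G.V → ℤ} (h₁ : Pure e₁ f₁ c₁)
    (h₂ : Pure e₂ f₂ c₂) (h₃ : Pure e₃ f₃ c₃) (h0 : ∑ v, c₁ v * (c₂ v * c₃ v) = 0) {M : Set G.E}
    (hM : G.IsPerfectMatching M) (n₁ : e₁ ∈ M) (n₂ : e₂ ∉ M) (n₃ : e₃ ∉ M) {g k : G.E}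
    (hg : g = e₁ ∨ g = f₁) (hk : k = e₁ ∨ k = f₁) {x y : G.V} (hx : G.Inc x g)
    (hy : G.Inc y k) : c₂ x * c₃ x = c₂ y * c₃ y := by
  have key : ∀ {x y}, G.Inc x e₁ → G.Inc y f₁ → c₂ x * c₃ x = c₂ y * c₃ y := by
    intro x y hx hy
    have := sum_mul_eq_sub hM h₁ h₂ h₃ n₁ n₂ n₃ hx hy
    omega
  obtain ⟨a, b, hab⟩ := exists_ends e₁
  obtain ⟨a', b', hab'⟩ := exists_ends f₁
  rcases hg with rfl | rfl <;> rcases hk with rfl | rfl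
  · rw [key hx (inc_left hab'), key hy (inc_left hab')]
  · exact key hx hy
  · exact (key hy hx).symm
  · rw [← key (inc_left hab) hx, ← key (inc_left hab) hy]

lemma IsSign.mul {c d : G.V → ℤ} (hc : IsSign c) (hd : IsSign d) (x : G.V) :
    c x * d x = 1 ∨ c x * d x = -1 := by
  rcases hc x with h | h <;> rcases hd x with h' | h' <;> simp [h, h']

lemma Pure.add_eq_zero {e f : G.E} {c : G.V → ℤ} (h : Pure e f c) {g : G.E} {a b : G.V}
    (hab : G.ends g = s(a, b)) (hg : ¬ (g = e ∨ g = f)) : c a + c b = 0 :=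
  h.col.2.1 g a b hab (fun h => hg (Or.inl h)) (fun h => hg (Or.inr h))

/-- An edge outside both pairs preserves the product of the two colours. -/
lemma Pure.mul_eq_of_ends {e f e' f' : G.E} {c c' : G.V → ℤ} (h : Pure e f c) (h' : Pure e' f' c')
    {g : G.E} {a b : G.V} (hab : G.ends g = s(a, b)) (hg : ¬ (g = e ∨ g = f))
    (hg' : ¬ (g = e' ∨ g = f')) : c a * c' a = c b * c' b := by
  rw [eq_neg_of_add_eq_zero_left (h.add_eq_zero hab hg),
    eq_neg_of_add_eq_zero_left (h'.add_eq_zero hab hg')]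
  ring

/-- An edge of the first pair, outside the second, reverses the product of the two colours. -/
lemma Pure.mul_eq_neg_of_ends {e f e' f' : G.E} {c c' : G.V → ℤ} (h : Pure e f c)
    (h' : Pure e' f' c') {g : G.E} {a b : G.V} (hab : G.ends g = s(a, b)) (hg : g = e ∨ g = f)
    (hg' : ¬ (g = e' ∨ g = f')) : c a * c' a = -(c b * c' b) := by
  rw [eq_neg_of_add_eq_zero_left (h'.add_eq_zero hab hg'),
    h.col.eq_of_inc hg (inc_left hab) (inc_right hab)]
  ring

namespace Triple

variable {v : G.V} {h e f : Fin 3 → G.E} {c : Fin 3 → G.V → ℤ}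

lemma notMem (T : Triple v h e f c) {i j : Fin 3} (hij : i ≠ j) {M : Set G.E}
    (hM : G.IsPerfectMatching M) (hi : e i ∈ M) : e j ∉ M := fun hj =>
  hij (T.inj (hM.eq_of_inc (T.dep i M hM hi) (T.dep j M hM hj) (T.inc i) (T.inc j)))

lemma disjoint (T : Triple v h e f c) (hG : G.MatchingCovered) {i j : Fin 3} (hij : i ≠ j)
    {g : G.E} (hi : g = e i ∨ g = f i) : ¬ (g = e j ∨ g = f j) := by
  intro hj
  obtain ⟨M, hM, hg⟩ := hG.exists_mem g
  have h1 : e i ∈ M := by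
    rcases hi with rfl | rfl
    · exact hg
    · exact (T.pure i).dep' M hM hg
  have h2 : e j ∈ M := by
    rcases hj with rfl | rfl
    · exact hg
    · exact (T.pure j).dep' M hM hg
  exact T.notMem hij hM h1 h2

lemma perm (T : Triple v h e f c) (σ : Equiv.Perm (Fin 3)) :
    Triple v (h ∘ σ) (e ∘ σ) (f ∘ σ) (c ∘ σ) :=
  ⟨T.inj.comp σ.injective, fun _ => T.inc _, fun _ => T.pure _, fun _ => T.dep _⟩

/-- The product of the other two colours takes the value `s i` on the ends of the `i`th pair. -/
def HasSigns (e f : Fin 3 → G.E) (c : Fin 3 → G.V → ℤ) (s : Fin 3 → ℤ) : Prop :=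
  (∀ i, s i = 1 ∨ s i = -1) ∧ ∀ i j k, i ≠ j → i ≠ k → j ≠ k → ∀ g, (g = e i ∨ g = f i) → ∀ x,
    G.Inc x g → c j x * c k x = s i

lemma exists_hasSigns (T : Triple v h e f c) (hG : G.MatchingCovered)
    (h0 : ∑ x, c 0 x * (c 1 x * c 2 x) = 0) : ∃ s, HasSigns e f c s := by
  have hsum : ∀ i, ∑ x, c i x * (c (i + 1) x * c (i + 2) x) = 0 := by
    intro i
    rw [← h0]
    refine Finset.sum_congr rfl fun x _ => ?_
    fin_cases i
    · rfl
    · change c 1 x * (c 2 x * c 0 x) = _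
      ring
    · change c 2 x * (c 0 x * c 1 x) = _
      ring
  have hx : ∀ i, ∃ x, G.Inc x (e i) := fun i => by
    obtain ⟨a, b, hab⟩ := exists_ends (e i)
    exact ⟨a, inc_left hab⟩
  choose x hx using hx
  refine ⟨fun i => c (i + 1) (x i) * c (i + 2) (x i),
    fun i => (T.pure _).col.1.mul (T.pure _).col.1 _, fun i j k hij hik hjk g hg y hy => ?_⟩
  obtain ⟨M, hM, hi⟩ := hG.exists_mem (e i)
  have hne : ∀ i : Fin 3, i ≠ i + 1 ∧ i ≠ i + 2 := by decide
  have key := (T.pure i).mul_eq (T.pure (i + 1)) (T.pure (i + 2)) (hsum i) hM hi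
    (T.notMem (hne i).1 hM hi) (T.notMem (hne i).2 hM hi) hg (Or.inl rfl) hy (hx i)
  have : (j = i + 1 ∧ k = i + 2) ∨ (j = i + 2 ∧ k = i + 1) := by
    clear key hi hg hy
    revert i j k; decide
  rcases this with ⟨rfl, rfl⟩ | ⟨rfl, rfl⟩
  · exact key
  · rw [mul_comm]; exact key

lemma HasSigns.comp {s : Fin 3 → ℤ} (hs : HasSigns e f c s) (σ : Equiv.Perm (Fin 3)) :
    HasSigns (e ∘ σ) (f ∘ σ) (c ∘ σ) (s ∘ σ) :=
  ⟨fun _ => hs.1 _, fun _ _ _ hij hik hjk => hs.2 _ _ _ (σ.injective.ne hij) (σ.injective.ne hik)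
    (σ.injective.ne hjk)⟩

lemma prod_ne_one (T : Triple v h e f c) (hG : G.MatchingCovered) {s : Fin 3 → ℤ}
    (hs : HasSigns e f c s) : s 0 * s 1 * s 2 ≠ 1 := by
  intro hprod
  have hsign := fun i => (T.pure i).col.1
  set X : Set G.V := {x | c 1 x * c 2 x = s 1 * s 2 ∧ c 0 x * c 1 x ≠ s 0 * s 1} with hX
  have s0 := hs.1 0
  have s1 := hs.1 1
  have s2 := hs.1 2
  have e0 : s 1 * s 2 = s 0 := by
    rcases s0 with h | h <;> rcases s1 with h' | h' <;> rcases s2 with h'' | h'' <;>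
      simp [h, h', h''] at hprod ⊢
  have e1 : s 0 * s 1 = s 2 := by
    rcases s0 with h | h <;> rcases s1 with h' | h' <;> rcases s2 with h'' | h'' <;>
      simp [h, h', h''] at hprod ⊢
  have hX1 : ∀ g x, (g = e 1 ∨ g = f 1) → G.Inc x g → x ∉ X := by
    rintro g x hg hx ⟨h1, h2⟩
    have h3 := hs.2 1 0 2 (by decide) (by decide) (by decide) g hg x hx
    have q := (hsign 2).sq x
    apply h2
    calc c 0 x * c 1 x = (c 0 x * c 2 x) * (c 1 x * c 2 x) := by
          linear_combination (-c 0 x * c 1 x) * q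
      _ = s 1 * s 1 * s 2 := by rw [h3, h1]; ring
      _ = s 0 * s 1 := by rw [e1]; rcases s1 with h | h <;> simp [h]
  have hX2 : ∀ g x, (g = e 2 ∨ g = f 2) → G.Inc x g → x ∉ X := by
    rintro g x hg hx ⟨h1, h2⟩
    have h3 := hs.2 2 0 1 (by decide) (by decide) (by decide) g hg x hx
    exact h2 (h3.trans e1.symm)
  have hcut : G.cut X = {e 0, f 0} := by
    ext g
    obtain ⟨a, b, hab⟩ := exists_ends g
    rw [Multigraph.mem_cut_iff hab]
    change _ ↔ g = e 0 ∨ g = f 0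
    by_cases g0 : g = e 0 ∨ g = f 0
    · have ha := hs.2 0 1 2 (by decide) (by decide) (by decide) g g0 a (inc_left hab)
      have hb := hs.2 0 1 2 (by decide) (by decide) (by decide) g g0 b (inc_right hab)
      have hc := (T.pure 0).mul_eq_neg_of_ends (T.pure 1) hab g0
        (T.disjoint hG (by decide) g0)
      have hm := (hsign 0).mul (hsign 1) b
      simp only [g0, iff_true, hX, Set.mem_ofPred_eq, ha, hb, hc, e0, true_and]
      rw [e1]
      omega
    · simp only [g0, iff_false]
      by_cases g1 : g = e 1 ∨ g = f 1
      · have ha := hX1 g a g1 (inc_left hab)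
        have hb := hX1 g b g1 (inc_right hab)
        tauto
      by_cases g2 : g = e 2 ∨ g = f 2
      · have ha := hX2 g a g2 (inc_left hab)
        have hb := hX2 g b g2 (inc_right hab)
        tauto
      simp only [hX, Set.mem_ofPred_eq, (T.pure 0).mul_eq_of_ends (T.pure 1) hab g0 g1,
        (T.pure 1).mul_eq_of_ends (T.pure 2) hab g1 g2]
      tauto
  obtain ⟨a, b, hab⟩ := exists_ends (e 1)
  obtain ⟨a', b', hab'⟩ := exists_ends (f 1)
  refine (T.pure 0).notCut (e 0) (f 0) X (Dep.refl _)
    ⟨(T.pure 0).ne, (T.pure 0).dep, (T.pure 0).dep', hcut⟩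
    (bipartiteOn_iff.2 ⟨c 1, (T.pure 1).col.properOn (fun h => ?_) (fun h => ?_)⟩)
  · exact hX1 _ a (Or.inl rfl) (inc_left hab) ((inside_iff hab).1 h).1
  · exact hX1 _ a' (Or.inr rfl) (inc_left hab') ((inside_iff hab').1 h).1

end Triple

/-! ### Vertices of degree three -/

/-- A vertex of degree three all of whose edges belong to pure pairs, in the case in which every
perfect matching meets one of these pairs. -/
structure KAt (v : G.V) (e f : Fin 3 → G.E) (c : Fin 3 → G.V → ℤ) : Prop where
  inj : Function.Injective e
  inc : ∀ g, G.Inc v g ↔ ∃ i, g = e i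
  pure : ∀ i, Pure (e i) (f i) (c i)
  sum_ne : ∑ x, c 0 x * (c 1 x * c 2 x) ≠ 0

/-- A vertex of degree three incident with one edge of each of two pure pairs and with an edge `h`
forced by a third pure pair. -/
structure TriAt (v : G.V) (e₁ f₁ e₂ f₂ e₃ f₃ h : G.E) (c₁ c₂ c₃ : G.V → ℤ) (W : Set G.V) :
    Prop where
  pure₁ : Pure e₁ f₁ c₁
  pure₂ : Pure e₂ f₂ c₂
  pure₃ : Pure e₃ f₃ c₃
  excl₁₂ : ∀ M, G.IsPerfectMatching M → e₁ ∈ M → e₂ ∉ M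
  excl₁₃ : ∀ M, G.IsPerfectMatching M → e₁ ∈ M → e₃ ∉ M
  excl₂₃ : ∀ M, G.IsPerfectMatching M → e₂ ∈ M → e₃ ∉ M
  inc : ∀ g, G.Inc v g ↔ g = e₁ ∨ g = e₂ ∨ g = h
  dep : Dep e₃ h
  mem : v ∈ W
  inside : G.Inside W h
  cut : ∀ g, g ∈ G.cut W ↔ (g = e₁ ∨ g = f₁) ∨ g = e₂ ∨ g = f₂
  notInside : ∀ e f c, Pure e f c → ¬ G.Inside W e

namespace Triple

variable {v : G.V} {h e f : Fin 3 → G.E} {c : Fin 3 → G.V → ℤ}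

lemma exists_pure_of_dep (T : Triple v h e f c) (hG : G.MatchingCovered)
    (hP : G.TightShoresBipartite) {i : Fin 3} (hi : Dep (h i) (e i)) :
    ∃ f' c', Pure (h i) f' c' ∧ (c' = c i ∨ c' = -c i) ∧
      ∀ g, (g = h i ∨ g = f') ↔ (g = e i ∨ g = f i) := by
  rcases (T.pure i).eq_or_eq_of_dep hG hP hi with h | h
  · exact ⟨f i, c i, h ▸ T.pure i, Or.inl rfl, fun g => by rw [h]⟩
  · exact ⟨e i, -c i, h ▸ (T.pure i).symm, Or.inr rfl, fun g => by rw [h, or_comm]⟩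

lemma exists_kAt (T : Triple v h e f c) (hG : G.MatchingCovered) (hP : G.TightShoresBipartite)
    (h0 : ∑ x, c 0 x * (c 1 x * c 2 x) ≠ 0) : ∃ e f c, KAt v e f c := by
  have hmem : ∀ M, G.IsPerfectMatching M → ∃ i, e i ∈ M := by
    intro M hM
    by_contra! hc
    exact h0 (sum_mul_eq_zero hM (T.pure 0) (T.pure 1) (T.pure 2) (hc 0) (hc 1) (hc 2))
  have hinc : ∀ g, G.Inc v g → ∀ M, G.IsPerfectMatching M → g ∈ M → ∃ i, g = h i ∧ e i ∈ M := by
    intro g hg M hM hgM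
    obtain ⟨i, hi⟩ := hmem M hM
    exact ⟨i, hM.eq_of_inc hgM (T.dep i M hM hi) hg (T.inc i), hi⟩
  have hdep : ∀ i, Dep (h i) (e i) := by
    intro i M hM hi
    obtain ⟨j, hj, hjM⟩ := hinc (h i) (T.inc i) M hM hi
    rwa [T.inj hj]
  have := fun i => T.exists_pure_of_dep hG hP (hdep i)
  choose f' c' hp hc _ using this
  refine ⟨h, f', c', T.inj, fun g => ⟨fun hg => ?_, ?_⟩, hp, fun h1 => h0 ?_⟩
  · obtain ⟨M, hM, hgM⟩ := hG.exists_mem g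
    obtain ⟨i, hi, -⟩ := hinc g hg M hM hgM
    exact ⟨i, hi⟩
  · rintro ⟨i, rfl⟩
    exact T.inc i
  · rcases hc 0 with h | h <;> rcases hc 1 with h' | h' <;> rcases hc 2 with h'' | h'' <;>
      simpa [h, h', h''] using h1

lemma exists_triAt_of_mul_eq (T : Triple v h e f c) (hG : G.MatchingCovered)
    (hP : G.TightShoresBipartite) {s : Fin 3 → ℤ} (hs : HasSigns e f c s)
    (hprod : s 0 * s 1 * s 2 = -1) (hv : c 0 v * c 1 v = s 0 * s 1) :
    ∃ e₁ f₁ e₂ f₂ e₃ f₃ h c₁ c₂ c₃ W, TriAt v e₁ f₁ e₂ f₂ e₃ f₃ h c₁ c₂ c₃ W := by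
  have h3 := card_ge_three_of_not_bipartite hP.1
  have hsign := fun i => (T.pure i).col.1
  have hd := fun {i j : Fin 3} (hij : i ≠ j) {g : G.E} => T.disjoint hG hij (g := g)
  have s0 := hs.1 0
  have s1 := hs.1 1
  have s2 := hs.1 2
  have e1 : s 0 * s 1 = - s 2 := by
    rcases s0 with h | h <;> rcases s1 with h' | h' <;> rcases s2 with h'' | h'' <;>
      simp [h, h', h''] at hprod ⊢
  set W : Set G.V := {x | c 0 x * c 1 x = s 0 * s 1} with hW
  have hW2 : ∀ g x, (g = e 2 ∨ g = f 2) → G.Inc x g → x ∉ W := by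
    intro g x hg hx hxW
    have h2 := hs.2 2 0 1 (by decide) (by decide) (by decide) g hg x hx
    have h4 : c 0 x * c 1 x = s 0 * s 1 := hxW
    omega
  have hcut : ∀ g, g ∈ G.cut W ↔ (g = e 0 ∨ g = f 0) ∨ g = e 1 ∨ g = f 1 := by
    intro g
    obtain ⟨a, b, hab⟩ := exists_ends g
    rw [Multigraph.mem_cut_iff hab]
    simp only [hW, Set.mem_ofPred_eq]
    have hm := (hsign 0).mul (hsign 1) b
    by_cases g0 : g = e 0 ∨ g = f 0
    · rw [(T.pure 0).mul_eq_neg_of_ends (T.pure 1) hab g0 (hd (by decide) g0)]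
      simp only [g0, true_or, iff_true]
      omega
    by_cases g1 : g = e 1 ∨ g = f 1
    · have := (T.pure 1).mul_eq_neg_of_ends (T.pure 0) hab g1 (hd (by decide) g1)
      simp only [g1, or_true, iff_true]
      rw [mul_comm (c 0 a), this, mul_comm (c 0 b)]
      rw [mul_comm] at hm
      omega
    rw [(T.pure 0).mul_eq_of_ends (T.pure 1) hab g0 g1]
    simp only [g0, g1, or_false, iff_false]
    tauto
  obtain ⟨M0, hM0, heM0⟩ := hG.exists_mem (e 0)
  obtain ⟨M1, hM1, heM1⟩ := hG.exists_mem (e 1)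
  obtain ⟨M2, hM2, heM2⟩ := hG.exists_mem (e 2)
  have hcutM : ∀ M, G.IsPerfectMatching M → e 0 ∉ M → e 1 ∉ M → ∀ g ∈ G.cut W, g ∉ M := by
    intro M hM h0 h1 g hg hgM
    rcases (hcut g).1 hg with (rfl | rfl) | (rfl | rfl)
    · exact h0 hgM
    · exact h0 ((T.pure 0).dep' M hM hgM)
    · exact h1 hgM
    · exact h1 ((T.pure 1).dep' M hM hgM)
  have hM2c := hcutM M2 hM2 (T.notMem (by decide) hM2 heM2) (T.notMem (by decide) hM2 heM2)
  have hin : G.Inside W (h 2) := (inside_or_cut_of_inc hv (T.inc 2)).resolve_right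
    fun hc => hM2c _ hc (T.dep 2 M2 hM2 heM2)
  have hinc : ∀ g, G.Inc v g → g ≠ h 2 → ∀ M, G.IsPerfectMatching M → g ∈ M →
      e 0 ∈ M ∨ e 1 ∈ M := by
    intro g hg hne M hM hgM
    by_contra! hc
    have hMc := hcutM M hM hc.1 hc.2
    have hgin : G.Inside W g := (inside_or_cut_of_inc hv hg).resolve_right fun h => hMc g h hgM
    have hN := hM.splice hM2 (X := W) fun k hk => by simp [hMc k hk, hM2c k hk]
    refine hne (hN.eq_of_inc (Or.inl ⟨hgin, hgM⟩) (T.dep 2 _ hN (Or.inr ⟨fun hi => ?_, heM2⟩)) hg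
      (T.inc 2))
    obtain ⟨a, b, hab⟩ := exists_ends (e 2)
    exact hW2 _ a (Or.inl rfl) (inc_left hab) (hi a (inc_left hab))
  have hdep0 : Dep (h 0) (e 0) := by
    intro M hM h0
    refine (hinc _ (T.inc 0) (T.inj.ne (by decide)) M hM h0).resolve_right fun h1 => ?_
    exact T.inj.ne (by decide : (0 : Fin 3) ≠ 1)
      (hM.eq_of_inc h0 (T.dep 1 M hM h1) (T.inc 0) (T.inc 1))
  have hdep1 : Dep (h 1) (e 1) := by
    intro M hM h0
    refine (hinc _ (T.inc 1) (T.inj.ne (by decide)) M hM h0).resolve_left fun h1 => ?_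
    exact T.inj.ne (by decide : (1 : Fin 3) ≠ 0)
      (hM.eq_of_inc h0 (T.dep 0 M hM h1) (T.inc 1) (T.inc 0))
  obtain ⟨f₁, c₁, hp₁, -, hQ₁⟩ := T.exists_pure_of_dep hG hP hdep0
  obtain ⟨f₂, c₂, hp₂, -, hQ₂⟩ := T.exists_pure_of_dep hG hP hdep1
  refine ⟨h 0, f₁, h 1, f₂, e 2, f 2, h 2, c₁, c₂, c 2, W, hp₁, hp₂, T.pure 2,
    fun M hM h0 => fun h1 => T.notMem (by decide) hM (hdep0 M hM h0) (hdep1 M hM h1),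
    fun M hM h0 => T.notMem (by decide) hM (hdep0 M hM h0),
    fun M hM h0 => T.notMem (by decide) hM (hdep1 M hM h0), fun g => ⟨fun hg => ?_, ?_⟩, T.dep 2,
    hv, hin, fun g => by rw [hcut, hQ₁, hQ₂], ?_⟩
  · obtain ⟨M, hM, hgM⟩ := hG.exists_mem g
    by_cases hg2 : g = h 2
    · exact Or.inr (Or.inr hg2)
    · rcases hinc g hg hg2 M hM hgM with h' | h'
      · exact Or.inl (hM.eq_of_inc hgM (T.dep 0 M hM h') hg (T.inc 0))
      · exact Or.inr (Or.inl (hM.eq_of_inc hgM (T.dep 1 M hM h') hg (T.inc 1)))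
  · rintro (rfl | rfl | rfl)
    exacts [T.inc 0, T.inc 1, T.inc 2]
  · intro e' f' c' hp hin'
    have hne : ∀ i, ¬ (e' = e i ∨ e' = f i) := by
      intro i hi
      have hnc : e' ∉ G.cut W := hin'.notMem_cut
      rw [hcut] at hnc
      fin_cases i
      · exact hnc (Or.inl hi)
      · exact hnc (Or.inr hi)
      · obtain ⟨a, b, hab⟩ := exists_ends e'
        exact hW2 e' a hi (inc_left hab) (hin' a (inc_left hab))
    have hne' : ∀ i, ¬ (f' = e i ∨ f' = f i) := by
      intro i hi
      have hdi : Dep e' (e i) ∧ Dep (e i) e' := by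
        rcases hi with hi | hi
        · exact ⟨hi ▸ hp.dep, hi ▸ hp.dep'⟩
        · exact ⟨(hi ▸ hp.dep : Dep e' (f i)).trans (T.pure i).dep',
            (T.pure i).dep.trans (hi ▸ hp.dep' : Dep (f i) e')⟩
      exact hne i ((T.pure i).eq_or_eq_of_dep hG hP hdi.1)
    have hex : ∀ i, ∃ M, G.IsPerfectMatching M ∧ e i ∈ M ∧ e' ∉ M := fun i =>
      (T.pure i).exists_mem_notMem hG hP hp (fun h => hne i (Or.inl h)) (fun h => hne i (Or.inr h))
    obtain ⟨N0, hN0, hN0e, hN0'⟩ := hex 0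
    obtain ⟨N1, hN1, hN1e, hN1'⟩ := hex 1
    obtain ⟨N2, hN2, hN2e, hN2'⟩ := hex 2
    have hsum1 := sum_mul_eq_zero hN2 (T.pure 0) (T.pure 1) hp (T.notMem (by decide) hN2 hN2e)
      (T.notMem (by decide) hN2 hN2e) hN2'
    have hsum2 := sum_mul_eq_zero hN2 (T.pure 1) (T.pure 0) hp (T.notMem (by decide) hN2 hN2e)
      (T.notMem (by decide) hN2 hN2e) hN2'
    have hh0 := (T.pure 0).eq_or_eq_of_dep hG hP hdep0
    have hh1 := (T.pure 1).eq_or_eq_of_dep hG hP hdep1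
    have hQ0 : ∀ g x, (g = e 0 ∨ g = f 0) → G.Inc x g → c 1 x * c' x = c 1 v * c' v :=
      fun g x hg hx => (T.pure 0).mul_eq (T.pure 1) hp hsum1 hN0 hN0e
        (T.notMem (by decide) hN0 hN0e) hN0' hg hh0 hx (T.inc 0)
    have hQ1 : ∀ g x, (g = e 1 ∨ g = f 1) → G.Inc x g → c 0 x * c' x = c 0 v * c' v :=
      fun g x hg hx => (T.pure 1).mul_eq (T.pure 0) hp hsum2 hN1 hN1e
        (T.notMem (by decide) hN1 hN1e) hN1' hg hh1 hx (T.inc 1)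
    set S : Set G.V := {x | x ∈ W ∧ c 0 x * c' x ≠ c 0 v * c' v} with hS
    have hSQ0 : ∀ g x, (g = e 0 ∨ g = f 0) → G.Inc x g → x ∉ S := by
      rintro g x hg hx ⟨hxW, hxS⟩
      have hxW : c 0 x * c 1 x = s 0 * s 1 := hxW
      have hvW : c 0 v * c 1 v = s 0 * s 1 := hv
      have := hQ0 g x hg hx
      apply hxS
      have q := (hsign 1).sq x
      have q' := (hsign 1).sq v
      calc c 0 x * c' x = (c 0 x * c 1 x) * (c 1 x * c' x) := by
            linear_combination (-c 0 x * c' x) * q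
        _ = (c 0 v * c 1 v) * (c 1 v * c' v) := by rw [hxW, hvW, this]
        _ = c 0 v * c' v := by linear_combination (c 0 v * c' v) * q'
    have hScut : G.cut S ⊆ {e', f'} := by
      rintro g ⟨a, ha, b, hb, hab⟩
      by_contra hg
      have hg : ¬ (g = e' ∨ g = f') := hg
      by_cases hg0 : g = e 0 ∨ g = f 0
      · exact hSQ0 g a hg0 (inc_left hab) ha
      by_cases hg1 : g = e 1 ∨ g = f 1
      · exact ha.2 (hQ1 g a hg1 (inc_left hab))
      have hbW : b ∈ W := by
        by_contra hbW
        have := (hcut g).1 ((Multigraph.mem_cut_iff hab).2 (Or.inl ⟨ha.1, hbW⟩))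
        tauto
      refine hb ⟨hbW, ?_⟩
      rw [← (T.pure 0).mul_eq_of_ends hp hab hg0 hg]
      exact ha.2
    have hSe : e' ∈ G.cut S := by
      obtain ⟨a, b, hab⟩ := exists_ends e'
      have := hp.mul_eq_neg_of_ends (T.pure 0) hab (Or.inl rfl) (hne 0)
      have hm := (hsign 0).mul hp.col.1 b
      have hm' := (hsign 0).mul hp.col.1 v
      rw [mul_comm, mul_comm (c' b)] at this
      rw [Multigraph.mem_cut_iff hab]
      have ha : a ∈ W := hin' a (inc_left hab)
      have hb : b ∈ W := hin' b (inc_right hab)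
      simp only [hS, Set.mem_ofPred_eq, ha, hb, true_and]
      omega
    have hSf : f' ∈ G.cut S := by
      by_contra hf
      have hsub : G.cut S ⊆ {e'} := fun g hg => (hScut hg).resolve_right fun h => hf (h ▸ hg)
      rcases hG.eq_empty_or_univ_of_subset h3 hsub with h | h
      · obtain ⟨a, ha, -⟩ := hSe
        rw [h] at ha
        exact ha
      · have : v ∈ S := h ▸ trivial
        exact this.2 rfl
    have hST : TwoCut e' f' S := ⟨hp.ne, hp.dep, hp.dep', Set.Subset.antisymm hScut (by
      rintro g (rfl | rfl)
      exacts [hSe, hSf])⟩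
    refine hp.notCut e' f' S (Dep.refl _) hST (bipartiteOn_iff.2 ⟨c 0, (T.pure 0).col.properOn
      (fun hi => ?_) fun hi => ?_⟩)
    · obtain ⟨a, b, hab⟩ := exists_ends (e 0)
      exact hSQ0 _ a (Or.inl rfl) (inc_left hab) (hi a (inc_left hab))
    · obtain ⟨a, b, hab⟩ := exists_ends (f 0)
      exact hSQ0 _ a (Or.inr rfl) (inc_left hab) (hi a (inc_left hab))

lemma exists_kAt_or_triAt (T : Triple v h e f c) (hG : G.MatchingCovered)
    (hP : G.TightShoresBipartite) : (∃ e f c, KAt v e f c) ∨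
      ∃ e₁ f₁ e₂ f₂ e₃ f₃ h c₁ c₂ c₃ W, TriAt v e₁ f₁ e₂ f₂ e₃ f₃ h c₁ c₂ c₃ W := by
  by_cases h0 : ∑ x, c 0 x * (c 1 x * c 2 x) = 0
  swap
  · exact Or.inl (T.exists_kAt hG hP h0)
  right
  obtain ⟨s, hs⟩ := T.exists_hasSigns hG h0
  have hprod : s 0 * s 1 * s 2 = -1 := by
    have h1 := T.prod_ne_one hG hs
    rcases hs.1 0 with h | h <;> rcases hs.1 1 with h' | h' <;> rcases hs.1 2 with h'' | h'' <;>
      simp [h, h', h''] at h1 ⊢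
  have hcase : c 0 v * c 1 v = s 0 * s 1 ∨ c 2 v * c 1 v = s 2 * s 1 ∨
      c 0 v * c 2 v = s 0 * s 2 := by
    have i0 := (T.pure 0).col.1 v
    have i1 := (T.pure 1).col.1 v
    have i2 := (T.pure 2).col.1 v
    rcases hs.1 0 with h | h <;> rcases hs.1 1 with h' | h' <;> rcases hs.1 2 with h'' | h'' <;>
      rcases i0 with k | k <;> rcases i1 with k' | k' <;> rcases i2 with k'' | k'' <;>
      simp [h, h', h'', k, k', k'']
  rcases hcase with hv | hv | hv
  · exact T.exists_triAt_of_mul_eq hG hP hs hprod hv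
  · refine (T.perm (Equiv.swap 0 2)).exists_triAt_of_mul_eq hG hP (hs.comp _) ?_ hv
    change s 2 * s 1 * s 0 = -1
    rw [← hprod]; ring
  · refine (T.perm (Equiv.swap 1 2)).exists_triAt_of_mul_eq hG hP (hs.comp _) ?_ hv
    change s 0 * s 2 * s 1 = -1
    rw [← hprod]; ring

end Triple

/-! ### The case of `K₄` -/

/-- Every vertex of degree other than two is of one of the two kinds arising from triples. -/
def AllKAtOrTriAt (G : Multigraph) : Prop :=
  ∀ v : G.V, G.degree v = 2 ∨ (∃ e f c, KAt v e f c) ∨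
    ∃ e₁ f₁ e₂ f₂ e₃ f₃ h c₁ c₂ c₃ W, TriAt v e₁ f₁ e₂ f₂ e₃ f₃ h c₁ c₂ c₃ W

lemma Pure.dep_of_mem {e f : G.E} {c : G.V → ℤ} (h : Pure e f c) {g : G.E} (hg : g = e ∨ g = f) :
    Dep g e ∧ Dep e g := by
  rcases hg with rfl | rfl
  · exact ⟨Dep.refl _, Dep.refl _⟩
  · exact ⟨h.dep', h.dep⟩

namespace KAt

variable {v : G.V} {e f : Fin 3 → G.E} {c : Fin 3 → G.V → ℤ}

lemma notMem (K : KAt v e f c) {i j : Fin 3} (hij : i ≠ j) {M : Set G.E}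
    (hM : G.IsPerfectMatching M) (hi : e i ∈ M) : e j ∉ M := fun hj =>
  hij (K.inj (hM.eq_of_inc hi hj ((K.inc _).2 ⟨i, rfl⟩) ((K.inc _).2 ⟨j, rfl⟩)))

lemma exists_mem (K : KAt v e f c) {M : Set G.E} (hM : G.IsPerfectMatching M) : ∃ i, e i ∈ M := by
  obtain ⟨g, hg, hvg⟩ := hM.exists_edge v
  obtain ⟨i, rfl⟩ := (K.inc g).1 hvg
  exact ⟨i, hg⟩

lemma exists_of_pure (K : KAt v e f c) (hG : G.MatchingCovered) (hP : G.TightShoresBipartite)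
    {e' f' : G.E} {c' : G.V → ℤ} (hp : Pure e' f' c') : ∃ i, e' = e i ∨ e' = f i := by
  by_contra! hne
  have hex : ∀ i, ∃ M, G.IsPerfectMatching M ∧ e i ∈ M ∧ e' ∉ M := fun i =>
    (K.pure i).exists_mem_notMem hG hP hp (hne i).1 (hne i).2
  obtain ⟨N0, hN0, hN0e, hN0'⟩ := hex 0
  obtain ⟨N1, hN1, hN1e, hN1'⟩ := hex 1
  obtain ⟨N2, hN2, hN2e, hN2'⟩ := hex 2
  have hsum1 := sum_mul_eq_zero hN2 (K.pure 0) (K.pure 1) hp (K.notMem (by decide) hN2 hN2e)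
    (K.notMem (by decide) hN2 hN2e) hN2'
  have hsum2 := sum_mul_eq_zero hN1 (K.pure 0) (K.pure 2) hp (K.notMem (by decide) hN1 hN1e)
    (K.notMem (by decide) hN1 hN1e) hN1'
  obtain ⟨x, x', hx⟩ := exists_ends (e 0)
  obtain ⟨y, y', hy⟩ := exists_ends (f 0)
  have h1 := (K.pure 0).mul_eq (K.pure 1) hp hsum1 hN0 hN0e (K.notMem (by decide) hN0 hN0e) hN0'
    (Or.inl rfl) (Or.inr rfl) (inc_left hx) (inc_left hy)
  have h2 := (K.pure 0).mul_eq (K.pure 2) hp hsum2 hN0 hN0e (K.notMem (by decide) hN0 hN0e) hN0'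
    (Or.inl rfl) (Or.inr rfl) (inc_left hx) (inc_left hy)
  have h := sum_mul_eq_sub hN0 (K.pure 0) (K.pure 1) (K.pure 2) hN0e
    (K.notMem (by decide) hN0 hN0e) (K.notMem (by decide) hN0 hN0e) (inc_left hx) (inc_left hy)
  refine K.sum_ne (h.trans ?_)
  have q := hp.col.1.sq x
  have q' := hp.col.1.sq y
  have : c 1 x * c 2 x = c 1 y * c 2 y :=
    calc c 1 x * c 2 x = (c 1 x * c' x) * (c 2 x * c' x) := by
          linear_combination (-c 1 x * c 2 x) * q
      _ = (c 1 y * c' y) * (c 2 y * c' y) := by rw [h1, h2]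
      _ = c 1 y * c 2 y := by linear_combination (c 1 y * c 2 y) * q'
  rw [this, sub_self, mul_zero]

lemma not_triAt (K : KAt v e f c) (hG : G.MatchingCovered) (hP : G.TightShoresBipartite) {u : G.V}
    {e₁ f₁ e₂ f₂ e₃ f₃ h : G.E} {c₁ c₂ c₃ : G.V → ℤ} {W : Set G.V}
    (T : TriAt u e₁ f₁ e₂ f₂ e₃ f₃ h c₁ c₂ c₃ W) : False := by
  obtain ⟨i₁, h₁⟩ := K.exists_of_pure hG hP T.pure₁
  obtain ⟨i₂, h₂⟩ := K.exists_of_pure hG hP T.pure₂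
  obtain ⟨i₃, h₃⟩ := K.exists_of_pure hG hP T.pure₃
  have d₁ := (K.pure _).dep_of_mem h₁
  have d₂ := (K.pure _).dep_of_mem h₂
  have d₃ := (K.pure _).dep_of_mem h₃
  have n₁₂ : i₁ ≠ i₂ := by
    rintro rfl
    obtain ⟨M, hM, hm⟩ := hG.exists_mem e₁
    exact T.excl₁₂ M hM hm (d₂.2 M hM (d₁.1 M hM hm))
  have n₁₃ : i₁ ≠ i₃ := by
    rintro rfl
    obtain ⟨M, hM, hm⟩ := hG.exists_mem e₁
    exact T.excl₁₃ M hM hm (d₃.2 M hM (d₁.1 M hM hm))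
  have n₂₃ : i₂ ≠ i₃ := by
    rintro rfl
    obtain ⟨M, hM, hm⟩ := hG.exists_mem e₂
    exact T.excl₂₃ M hM hm (d₃.2 M hM (d₂.1 M hM hm))
  obtain ⟨N, hN, hN3⟩ := hG.exists_mem e₃
  have hNh := T.dep N hN hN3
  have hh₁ : h ≠ e₁ := fun hh => T.excl₁₃ N hN (hh ▸ hNh) hN3
  have hh₂ : h ≠ e₂ := fun hh => T.excl₂₃ N hN (hh ▸ hNh) hN3
  have hinc₁ := (T.inc e₁).2 (Or.inl rfl)
  have hinc₂ := (T.inc e₂).2 (Or.inr (Or.inl rfl))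
  have hinch := (T.inc h).2 (Or.inr (Or.inr rfl))
  have hdep : Dep h e₃ := by
    intro M hM hhM
    obtain ⟨j, hj⟩ := K.exists_mem hM
    have : j = i₁ ∨ j = i₂ ∨ j = i₃ := by omega
    rcases this with rfl | rfl | rfl
    · exact absurd (hM.eq_of_inc hhM (d₁.2 M hM hj) hinch hinc₁) hh₁
    · exact absurd (hM.eq_of_inc hhM (d₂.2 M hM hj) hinch hinc₂) hh₂
    · exact d₃.2 M hM hj
  rcases T.pure₃.eq_or_eq_of_dep hG hP hdep with rfl | rfl
  · exact T.notInside _ _ _ T.pure₃ T.inside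
  · exact T.notInside _ _ _ T.pure₃.symm T.inside

lemma disjoint (K : KAt v e f c) (hG : G.MatchingCovered) {i j : Fin 3} {g : G.E}
    (hi : g = e i ∨ g = f i) (hj : g = e j ∨ g = f j) : i = j := by
  by_contra hij
  obtain ⟨M, hM, hg⟩ := hG.exists_mem g
  exact K.notMem hij hM (((K.pure i).dep_of_mem hi).1 M hM hg)
    (((K.pure j).dep_of_mem hj).1 M hM hg)

/-- Every vertex is incident with exactly one edge of each of the three pairs. -/
lemma exists_inc (K : KAt v e f c) (hG : G.MatchingCovered) (hP : G.TightShoresBipartite)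
    (hirr : G.Irreducible) (hall : AllKAtOrTriAt G) (u : G.V) :
    (∀ i, ∃ g, G.Inc u g ∧ (g = e i ∨ g = f i)) ∧ ∀ g, G.Inc u g → ∃ i, g = e i ∨ g = f i := by
  have h3 := card_ge_three_of_not_bipartite hP.1
  have key : ∀ u, G.degree u ≠ 2 → ∀ g, G.Inc u g → ∃ i, g = e i ∨ g = f i := by
    intro u hu g hg
    rcases hall u with h | ⟨e', f', c', K'⟩ | ⟨_, _, _, _, _, _, _, _, _, _, _, T⟩
    · exact absurd h hu
    · obtain ⟨j, rfl⟩ := (K'.inc g).1 hg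
      exact K.exists_of_pure hG hP (K'.pure j)
    · exact (K.not_triAt hG hP T).elim
  have key2 : ∀ g, G.Inc u g → ∃ i, g = e i ∨ g = f i := by
    intro g hg
    by_cases hu : G.degree u = 2
    · obtain ⟨w, hw⟩ := hg.exists_other
      exact key w (fun h => hirr.not_adj_degree_two hG h3 hw hu h) g (inc_right hw)
    · exact key u hu g hg
  refine ⟨fun i => ?_, key2⟩
  obtain ⟨M, hM, hi⟩ := hG.exists_mem (e i)
  obtain ⟨g, hg, hug⟩ := hM.exists_edge u
  obtain ⟨j, hj⟩ := key2 g hug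
  by_cases hij : i = j
  · exact ⟨g, hug, hij ▸ hj⟩
  · exact absurd (((K.pure j).dep_of_mem hj).1 M hM hg) (K.notMem hij hM hi)

lemma isIso (K : KAt v e f c) (hG : G.MatchingCovered) (hP : G.TightShoresBipartite)
    (hirr : G.Irreducible) (hall : AllKAtOrTriAt G) : IsIso G K4 := by
  have hinc := K.exists_inc hG hP hirr hall
  have hdisj : ∀ i x, G.Inc x (e i) → ¬ G.Inc x (f i) := by
    intro i x hx hx'
    obtain ⟨M, hM, hi⟩ := hG.exists_mem (e i)
    exact (K.pure i).ne (hM.eq_of_inc hi ((K.pure i).dep M hM hi) hx hx')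
  have hedge : ∀ g, ∃ i, g = e i ∨ g = f i := by
    intro g
    obtain ⟨a, b, hab⟩ := exists_ends g
    exact (hinc a).2 g (inc_left hab)
  have hpar : ∀ i j p p' q q', (p = e i ∧ p' = f i ∨ p = f i ∧ p' = e i) →
      (q = e j ∧ q' = f j ∨ q = f j ∧ q' = e j) → G.ends p = G.ends q → i = j := by
    intro i j p p' q q' hp hq hpq
    by_contra hij
    have hM : G.IsPerfectMatching {p', q} := by
      have hi : ∀ x, G.Inc x p ↔ G.Inc x q := fun x => by unfold Inc; rw [hpq]
      have hd : ∀ x, G.Inc x p → ¬ G.Inc x p' := by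
        intro x h1 h2
        rcases hp with ⟨rfl, rfl⟩ | ⟨rfl, rfl⟩
        · exact hdisj i x h1 h2
        · exact hdisj i x h2 h1
      intro x
      have hx : G.Inc x p ∨ G.Inc x p' := by
        obtain ⟨g, hg, hgi⟩ := (hinc x).1 i
        rcases hp with ⟨rfl, rfl⟩ | ⟨rfl, rfl⟩ <;> rcases hgi with rfl | rfl <;> tauto
      rcases hx with hx | hx
      · refine ⟨q, ⟨by simp, (hi x).1 hx⟩, ?_⟩
        rintro g ⟨rfl | rfl, hg⟩
        · exact absurd hg (hd x hx)
        · rfl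
      · refine ⟨p', ⟨by simp, hx⟩, ?_⟩
        rintro g ⟨rfl | rfl, hg⟩
        · rfl
        · exact absurd hx (hd x ((hi x).2 hg))
    have h1 : p' = e i ∨ p' = f i := by tauto
    have h2 : q = e j ∨ q = f j := by tauto
    exact K.notMem hij hM (((K.pure i).dep_of_mem h1).1 _ hM (by simp))
      (((K.pure j).dep_of_mem h2).1 _ hM (by simp))
  have hinj : Function.Injective G.ends := by
    intro g k hgk
    obtain ⟨i, hi⟩ := hedge g
    obtain ⟨j, hj⟩ := hedge k
    have hij : i = j := by
      rcases hi with hi | hi <;> rcases hj with hj | hj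
      · exact hpar i j g (f i) k (f j) (Or.inl ⟨hi, rfl⟩) (Or.inl ⟨hj, rfl⟩) hgk
      · exact hpar i j g (f i) k (e j) (Or.inl ⟨hi, rfl⟩) (Or.inr ⟨hj, rfl⟩) hgk
      · exact hpar i j g (e i) k (f j) (Or.inr ⟨hi, rfl⟩) (Or.inl ⟨hj, rfl⟩) hgk
      · exact hpar i j g (e i) k (e j) (Or.inr ⟨hi, rfl⟩) (Or.inr ⟨hj, rfl⟩) hgk
    subst hij
    obtain ⟨a, b, hab⟩ := exists_ends g
    have ha := inc_left hab
    have ha' := inc_left (hgk ▸ hab)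
    rcases hi with rfl | rfl <;> rcases hj with rfl | rfl
    · rfl
    · exact absurd ha' (hdisj i a ha)
    · exact absurd ha (hdisj i a ha')
    · rfl
  obtain ⟨a, b, hab⟩ := exists_ends (e 0)
  obtain ⟨a', b', hab'⟩ := exists_ends (f 0)
  have hbij : Function.Bijective (![a, b, a', b'] : Fin 4 → G.V) := by
    have n1 := ends_ne hab
    have n2 := ends_ne hab'
    have hd := hdisj 0
    simp only [inc_iff hab, inc_iff hab'] at hd
    have hda := hd a (Or.inl rfl)
    have hdb := hd b (Or.inr rfl)
    push Not at hda hdb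
    constructor
    · intro i j hij
      fin_cases i <;> fin_cases j <;> simp_all
    · intro x
      obtain ⟨g, hg, rfl | rfl⟩ := (hinc x).1 0
      · rcases (inc_iff hab).1 hg with rfl | rfl
        · exact ⟨0, rfl⟩
        · exact ⟨1, rfl⟩
      · rcases (inc_iff hab').1 hg with rfl | rfl
        · exact ⟨2, rfl⟩
        · exact ⟨3, rfl⟩
  set φ : G.V ≃ Fin 4 := (Equiv.ofBijective _ hbij).symm
  set ψ : G.E → {p : Sym2 (Fin 4) // ¬ p.IsDiag} := fun g => ⟨(G.ends g).map φ, fun hd => by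
    obtain ⟨x, y, hxy⟩ := exists_ends g
    rw [hxy, Sym2.map_mk, Sym2.mk_isDiag_iff] at hd
    exact ends_ne hxy (φ.injective hd)⟩ with hψ
  have hψinj : Function.Injective ψ := fun g k hgk =>
    hinj (Sym2.map.injective φ.injective (congrArg Subtype.val hgk))
  have hcard : Nat.card {p : Sym2 (Fin 4) // ¬ p.IsDiag} ≤ Nat.card G.E := by
    have h6 : Nat.card {p : Sym2 (Fin 4) // ¬ p.IsDiag} = 6 := by
      rw [Nat.card_eq_fintype_card, Sym2.card_subtype_not_diag]
      rfl
    have hE : Nat.card (Fin 3 × Bool) ≤ Nat.card G.E := by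
      refine Nat.card_le_card_of_injective (fun p => if p.2 then e p.1 else f p.1) ?_
      rintro ⟨i, x⟩ ⟨j, y⟩ h
      have hij : i = j := by
        refine K.disjoint hG (g := if x then e i else f i) ?_ ?_
        · cases x <;> simp
        · dsimp only at h
          rw [h]
          cases y <;> simp
      subst hij
      have := (K.pure i).ne
      cases x <;> cases y <;> simp_all
    rw [h6]
    simpa using hE
  exact ⟨φ, Equiv.ofBijective ψ (hψinj.bijective_of_nat_card_le hcard), fun g => rfl⟩

end KAt

/-! ### The case of the prism -/

/-- Two edges forcing the same member of a pure pair occur together. -/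
lemma Pure.mem_of_dep {e f : G.E} {c : G.V → ℤ} (hp : Pure e f c)
    (hG : G.MatchingCovered) (hP : G.TightShoresBipartite) {g k : G.E} (hg : Dep g e)
    (hk : Dep k e) : Dep g k :=
  hg.trans (hp.dep_of_mem (hp.eq_or_eq_of_dep hG hP hk)).2

namespace TriAt

variable {v : G.V} {e₁ f₁ e₂ f₂ e₃ f₃ h : G.E} {c₁ c₂ c₃ : G.V → ℤ} {W : Set G.V}

lemma swap (T : TriAt v e₁ f₁ e₂ f₂ e₃ f₃ h c₁ c₂ c₃ W) :
    TriAt v e₂ f₂ e₁ f₁ e₃ f₃ h c₂ c₁ c₃ W where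
  pure₁ := T.pure₂
  pure₂ := T.pure₁
  pure₃ := T.pure₃
  excl₁₂ M hM h2 h1 := T.excl₁₂ M hM h1 h2
  excl₁₃ := T.excl₂₃
  excl₂₃ := T.excl₁₃
  inc g := by rw [T.inc]; tauto
  dep := T.dep
  mem := T.mem
  inside := T.inside
  cut g := by rw [T.cut]; tauto
  notInside := T.notInside

lemma symm₃ (T : TriAt v e₁ f₁ e₂ f₂ e₃ f₃ h c₁ c₂ c₃ W) :
    TriAt v e₁ f₁ e₂ f₂ f₃ e₃ h c₁ c₂ (-c₃) W where
  pure₁ := T.pure₁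
  pure₂ := T.pure₂
  pure₃ := T.pure₃.symm
  excl₁₂ := T.excl₁₂
  excl₁₃ M hM h1 h3 := T.excl₁₃ M hM h1 (T.pure₃.dep' M hM h3)
  excl₂₃ M hM h2 h3 := T.excl₂₃ M hM h2 (T.pure₃.dep' M hM h3)
  inc := T.inc
  dep := T.pure₃.dep'.trans T.dep
  mem := T.mem
  inside := T.inside
  cut := T.cut
  notInside := T.notInside

lemma notPure (T : TriAt v e₁ f₁ e₂ f₂ e₃ f₃ h c₁ c₂ c₃ W) {e f : G.E} {c : G.V → ℤ}
    (hp : Pure e f c) : h ≠ e := fun he => T.notInside _ _ _ hp (he ▸ T.inside)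

lemma inc₁ (T : TriAt v e₁ f₁ e₂ f₂ e₃ f₃ h c₁ c₂ c₃ W) : G.Inc v e₁ :=
  (T.inc _).2 (Or.inl rfl)

lemma inc_h (T : TriAt v e₁ f₁ e₂ f₂ e₃ f₃ h c₁ c₂ c₃ W) : G.Inc v h :=
  (T.inc _).2 (Or.inr (Or.inr rfl))

lemma h_notMem (T : TriAt v e₁ f₁ e₂ f₂ e₃ f₃ h c₁ c₂ c₃ W) {M : Set G.E}
    (hM : G.IsPerfectMatching M) (h1 : e₁ ∈ M) : h ∉ M := fun hh =>
  T.notPure T.pure₁ (hM.eq_of_inc hh h1 T.inc_h T.inc₁)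

lemma not_inc_of_degree_two (T : TriAt v e₁ f₁ e₂ f₂ e₃ f₃ h c₁ c₂ c₃ W)
    (hG : G.MatchingCovered) (hP : G.TightShoresBipartite) {a w : G.V} {g : G.E}
    {e₁' f₁' e₂' f₂' e₃' f₃' h' : G.E} {c₁' c₂' c₃' : G.V → ℤ} {W' : Set G.V}
    (T' : TriAt w e₁' f₁' e₂' f₂' e₃' f₃' h' c₁' c₂' c₃' W')
    (ha : ∀ k, G.Inc a k ↔ k = e₁ ∨ k = g) (hw : G.Inc w g) : False := by
  have key : ∀ M, G.IsPerfectMatching M → e₁ ∉ M → g ∈ M := by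
    intro M hM h1
    obtain ⟨k, hk, hak⟩ := hM.exists_edge a
    rcases (ha k).1 hak with rfl | rfl
    · exact absurd hk h1
    · exact hk
  have d2 : Dep e₂ g := fun M hM h2 => key M hM fun h1 => T.excl₁₂ M hM h1 h2
  have d3 : Dep e₃ g := fun M hM h3 => key M hM fun h1 => T.excl₁₃ M hM h1 h3
  obtain ⟨M, hM, h2⟩ := hG.exists_mem e₂
  rcases (T'.inc g).1 hw with rfl | rfl | rfl
  · exact T.excl₂₃ M hM h2 (T'.pure₁.mem_of_dep hG hP d2 d3 M hM h2)
  · exact T.excl₂₃ M hM h2 (T'.pure₂.mem_of_dep hG hP d2 d3 M hM h2)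
  · have key' : ∀ M, G.IsPerfectMatching M → g ∉ M → e₁ ∈ M := fun M hM hg => by
      by_contra h1
      exact hg (key M hM h1)
    have d1' : Dep e₁' e₁ := fun M hM h1 => key' M hM (T'.h_notMem hM h1)
    have d2' : Dep e₂' e₁ := fun M hM h1 => key' M hM (T'.swap.h_notMem hM h1)
    obtain ⟨M, hM, h1⟩ := hG.exists_mem e₁'
    exact T'.excl₁₂ M hM h1 (T.pure₁.mem_of_dep hG hP d1' d2' M hM h1)

/-- A further vertex of `W` sees the second members of the two pairs. -/
lemma eq_or_eq_of_inc (T : TriAt v e₁ f₁ e₂ f₂ e₃ f₃ h c₁ c₂ c₃ W) {w : G.V} (hw : w ∈ W)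
    (hvw : v ≠ w) {e f : G.E} {c : G.V → ℤ} (hp : Pure e f c) (he : G.Inc w e) :
    e = f₁ ∨ e = f₂ := by
  have hn : ∀ g, G.Inc v g → G.Inc w g → G.Inside W g := fun g h1 h2 =>
    (inside_iff (ends_eq_of_inc h1 h2 hvw)).2 ⟨T.mem, hw⟩
  rcases inside_or_cut_of_inc hw he with hi | hc
  · exact absurd hi (T.notInside _ _ _ hp)
  · rcases (T.cut e).1 hc with (rfl | rfl) | rfl | rfl
    · exact absurd (hn _ T.inc₁ he) (T.notInside _ _ _ hp)
    · exact Or.inl rfl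
    · exact absurd (hn _ T.swap.inc₁ he) (T.notInside _ _ _ hp)
    · exact Or.inr rfl

end TriAt

/-- Every vertex is of the second kind arising from triples. -/
def AllTriAt (G : Multigraph) : Prop :=
  ∀ v : G.V, ∃ e₁ f₁ e₂ f₂ e₃ f₃ h c₁ c₂ c₃ W, TriAt v e₁ f₁ e₂ f₂ e₃ f₃ h c₁ c₂ c₃ W

lemma AllKAtOrTriAt.allTriAt (hall : AllKAtOrTriAt G) (hG : G.MatchingCovered)
    (hP : G.TightShoresBipartite) (hirr : G.Irreducible)
    (hK : ∀ v e f c, ¬ KAt (G := G) v e f c) : AllTriAt G := by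
  have h3 := card_ge_three_of_not_bipartite hP.1
  have htri : ∀ v, G.degree v ≠ 2 →
      ∃ e₁ f₁ e₂ f₂ e₃ f₃ h c₁ c₂ c₃ W, TriAt v e₁ f₁ e₂ f₂ e₃ f₃ h c₁ c₂ c₃ W := by
    intro v hv
    rcases hall v with h | ⟨e, f, c, K⟩ | h
    · exact absurd h hv
    · exact absurd K (hK _ _ _ _)
    · exact h
  intro a
  refine htri a fun ha => ?_
  obtain ⟨g₀, g₁, hne, hinc⟩ := degree_eq_two_iff.1 ha
  have hend : ∀ g, G.Inc a g → ∃ w, G.ends g = s(a, w) ∧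
      ∃ e₁ f₁ e₂ f₂ e₃ f₃ h c₁ c₂ c₃ W, TriAt w e₁ f₁ e₂ f₂ e₃ f₃ h c₁ c₂ c₃ W := by
    intro g hg
    obtain ⟨w, hw⟩ := hg.exists_other
    exact ⟨w, hw, htri w fun h => hirr.not_adj_degree_two hG h3 hw ha h⟩
  obtain ⟨u, hu, e₁, f₁, e₂, f₂, e₃, f₃, h, c₁, c₂, c₃, W, T⟩ := hend g₀ ((hinc _).2 (Or.inl rfl))
  obtain ⟨w, hw, e₁', f₁', e₂', f₂', e₃', f₃', h', c₁', c₂', c₃', W', T'⟩ :=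
    hend g₁ ((hinc _).2 (Or.inr rfl))
  have hinc' : ∀ k, G.Inc a k ↔ k = g₁ ∨ k = g₀ := fun k => (hinc k).trans or_comm
  rcases (T.inc g₀).1 (inc_right hu) with rfl | rfl | rfl
  · exact T.not_inc_of_degree_two hG hP T' hinc (inc_right hw)
  · exact T.swap.not_inc_of_degree_two hG hP T' hinc (inc_right hw)
  rcases (T'.inc g₁).1 (inc_right hw) with rfl | rfl | rfl
  · exact T'.not_inc_of_degree_two hG hP T hinc' (inc_right hu)
  · exact T'.swap.not_inc_of_degree_two hG hP T hinc' (inc_right hu)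
  have haW := ((inside_iff hu).1 T.inside).1
  have hwW : w ∈ W := by
    rcases inside_or_cut_of_inc haW (inc_left hw) with hi | hc
    · exact ((inside_iff hw).1 hi).2
    · rcases (T.cut _).1 hc with (hh | hh) | hh | hh
      · exact absurd hh (T'.notPure T.pure₁)
      · exact absurd hh (T'.notPure T.pure₁.symm)
      · exact absurd hh (T'.notPure T.pure₂)
      · exact absurd hh (T'.notPure T.pure₂.symm)
  have huw : u ≠ w := by
    rintro rfl
    rcases (T.inc g₁).1 T'.inc_h with hh | hh | hh
    · exact T'.notPure T.pure₁ hh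
    · exact T'.notPure T.pure₂ hh
    · exact hne hh.symm
  have key : ∀ M, G.IsPerfectMatching M → g₀ ∉ M → e₁' ∉ M := by
    intro M hM h0 h1
    obtain ⟨k, hk, hak⟩ := hM.exists_edge a
    rcases (hinc k).1 hak with rfl | rfl
    · exact h0 hk
    · exact T'.h_notMem hM h1 hk
  rcases T.eq_or_eq_of_inc hwW huw T'.pure₁ T'.inc₁ with rfl | rfl
  · obtain ⟨M, hM, h1⟩ := hG.exists_mem e₁
    exact key M hM (T.h_notMem hM h1) (T.pure₁.dep M hM h1)
  · obtain ⟨M, hM, h2⟩ := hG.exists_mem e₂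
    exact key M hM (T.swap.h_notMem hM h2) (T.pure₂.dep M hM h2)

/-- An edge `h` joining two cubic vertices, each incident with one edge of each of two pairs. -/
structure Rung (v v' : G.V) (h e₁ f₁ e₂ f₂ : G.E) : Prop where
  ends : G.ends h = s(v, v')
  inc : ∀ g, G.Inc v g ↔ g = e₁ ∨ g = e₂ ∨ g = h
  inc' : ∀ g, G.Inc v' g ↔ g = f₁ ∨ g = f₂ ∨ g = h
  notPure : ∀ e f c, Pure e f c → h ≠ e

lemma Rung.swap {v v' : G.V} {h e₁ f₁ e₂ f₂ : G.E} (R : Rung v v' h e₁ f₁ e₂ f₂) :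
    Rung v v' h e₂ f₂ e₁ f₁ :=
  ⟨R.ends, fun g => by rw [R.inc]; tauto, fun g => by rw [R.inc']; tauto, R.notPure⟩

lemma AllTriAt.exists_rung (hall : AllTriAt G) (hG : G.MatchingCovered) {v : G.V}
    {e₁ f₁ e₂ f₂ e₃ f₃ h : G.E} {c₁ c₂ c₃ : G.V → ℤ} {W : Set G.V}
    (T : TriAt v e₁ f₁ e₂ f₂ e₃ f₃ h c₁ c₂ c₃ W) : ∃ v', Rung v v' h e₁ f₁ e₂ f₂ := by
  obtain ⟨v', hv⟩ := T.inc_h.exists_other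
  obtain ⟨e₁', f₁', e₂', f₂', e₃', f₃', h', c₁', c₂', c₃', W', T'⟩ := hall v'
  refine ⟨v', hv, T.inc, fun g => ?_, fun _ _ _ hp => T.notPure hp⟩
  have hW := ((inside_iff hv).1 T.inside).2
  have h1 := T.eq_or_eq_of_inc hW (ends_ne hv) T'.pure₁ T'.inc₁
  have h2 := T.eq_or_eq_of_inc hW (ends_ne hv) T'.pure₂ T'.swap.inc₁
  have hne : e₁' ≠ e₂' := by
    rintro rfl
    obtain ⟨M, hM, h⟩ := hG.exists_mem e₁'
    exact T'.excl₁₂ M hM h h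
  have hh : h = h' := by
    rcases (T'.inc h).1 (inc_right hv) with hh | hh | hh
    · exact absurd hh (T.notPure T'.pure₁)
    · exact absurd hh (T.notPure T'.pure₂)
    · exact hh
  rw [T'.inc, ← hh]
  rcases h1 with rfl | rfl <;> rcases h2 with rfl | rfl <;> first | exact absurd rfl hne | tauto

lemma AllTriAt.exists_rung_of_inc (hall : AllTriAt G) (hG : G.MatchingCovered)
    (hP : G.TightShoresBipartite) {a : G.V} {e f : G.E} {c : G.V → ℤ} (hp : Pure e f c)
    (ha : G.Inc a e) : ∃ a' k p p' d, Rung a a' k e f p p' ∧ Pure p p' d ∧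
      ∀ M, G.IsPerfectMatching M → e ∈ M → p ∉ M := by
  obtain ⟨e₁, f₁, e₂, f₂, e₃, f₃, h, c₁, c₂, c₃, W, T⟩ := hall a
  have key : ∀ {f'} {c' : G.V → ℤ}, Pure e f' c' → f' = f := fun h => by
    rcases hp.eq_or_eq_of_dep hG hP h.dep' with hh | hh
    · exact absurd hh h.ne.symm
    · exact hh
  rcases (T.inc e).1 ha with rfl | rfl | rfl
  · obtain rfl := key T.pure₁
    obtain ⟨a', R⟩ := hall.exists_rung hG T
    exact ⟨a', h, e₂, f₂, c₂, R, T.pure₂, T.excl₁₂⟩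
  · obtain rfl := key T.pure₂
    obtain ⟨a', R⟩ := hall.exists_rung hG T.swap
    exact ⟨a', h, e₁, f₁, c₁, R, T.pure₁, T.swap.excl₁₂⟩
  · exact absurd rfl (T.notPure hp)

/-- The rungs at both ends of an edge of a pure pair determine the third pair. -/
lemma TriAt.eq_or_eq_of_rung {v v' : G.V} {e₁ f₁ e₂ f₂ e₃ f₃ h : G.E} {c₁ c₂ c₃ : G.V → ℤ}
    {W : Set G.V} (T : TriAt v e₁ f₁ e₂ f₂ e₃ f₃ h c₁ c₂ c₃ W) (hG : G.MatchingCovered)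
    (hP : G.TightShoresBipartite) (R : Rung v v' h e₁ f₁ e₂ f₂) {a a' : G.V} {k p p' : G.E}
    {d : G.V → ℤ} (hva : G.ends e₁ = s(v, a)) (Ra : Rung a a' k e₁ f₁ p p') (hp : Pure p p' d)
    (hex : ∀ M, G.IsPerfectMatching M → e₁ ∈ M → p ∉ M) : e₃ = p ∨ e₃ = p' := by
  by_contra! hne
  have hnd : ¬ Dep e₃ p := fun hd => by
    rcases hp.eq_or_eq_of_dep hG hP hd with hh | hh
    · exact hne.1 hh
    · exact hne.2 hh
  obtain ⟨M, hM, hM3, hMp⟩ : ∃ M, G.IsPerfectMatching M ∧ e₃ ∈ M ∧ p ∉ M := by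
    unfold Dep at hnd
    push Not at hnd
    obtain ⟨M, hM, h1, h2⟩ := hnd
    exact ⟨M, hM, h1, h2⟩
  obtain ⟨N, hN, hN1⟩ := hG.exists_mem e₁
  have hva' : v' ≠ a' := by
    rintro rfl
    have hk := (R.inc' k).1 (inc_right Ra.ends)
    rcases hk with rfl | rfl | rfl
    · exact Ra.notPure _ _ _ T.pure₁.symm rfl
    · exact Ra.notPure _ _ _ T.pure₂.symm rfl
    · have := R.ends.symm.trans Ra.ends
      exact ends_ne hva (Sym2.congr_left.1 this)
  have hf : G.ends f₁ = s(v', a') :=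
    ends_eq_of_inc ((R.inc' _).2 (Or.inl rfl)) ((Ra.inc' _).2 (Or.inl rfl)) hva'
  set X : Set G.V := {v, v', a, a'} with hX
  have hXinc : ∀ x ∈ X, ∀ g, G.Inc x g →
      g = e₁ ∨ g = e₂ ∨ g = h ∨ g = f₁ ∨ g = f₂ ∨ g = p ∨ g = p' ∨ g = k := by
    rintro x (rfl | rfl | rfl | rfl) g hg
    · have := (R.inc g).1 hg; tauto
    · have := (R.inc' g).1 hg; tauto
    · have := (Ra.inc g).1 hg; tauto
    · have := (Ra.inc' g).1 hg; tauto
  have hins : ∀ {g x y}, G.ends g = s(x, y) → x ∈ X → y ∈ X → g ∉ G.cut X := fun hg hx hy hc =>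
    (Multigraph.mem_cut_iff hg).1 hc |>.elim (fun h => h.2 hy) (fun h => h.1 hx)
  have hcut : ∀ g ∈ G.cut X, g = e₂ ∨ g = f₂ ∨ g = p ∨ g = p' := by
    intro g hg
    obtain ⟨x, hx, hxg⟩ : ∃ x ∈ X, G.Inc x g := by
      obtain ⟨y, z, hyz⟩ := exists_ends g
      rcases (Multigraph.mem_cut_iff hyz).1 hg with hh | hh
      · exact ⟨y, hh.1, inc_left hyz⟩
      · exact ⟨z, hh.2, inc_right hyz⟩
    rcases hXinc x hx g hxg with rfl | rfl | rfl | rfl | rfl | rfl | rfl | rfl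
    · exact absurd hg (hins hva (by simp [X]) (by simp [X]))
    · tauto
    · exact absurd hg (hins R.ends (by simp [X]) (by simp [X]))
    · exact absurd hg (hins hf (by simp [X]) (by simp [X]))
    · tauto
    · tauto
    · tauto
    · exact absurd hg (hins Ra.ends (by simp [X]) (by simp [X]))
  have hMc : ∀ g ∈ G.cut X, g ∉ M := by
    intro g hg hgM
    rcases hcut g hg with rfl | rfl | rfl | rfl
    · exact T.excl₂₃ M hM hgM hM3
    · exact T.excl₂₃ M hM (T.pure₂.dep' M hM hgM) hM3
    · exact hMp hgM
    · exact hMp (hp.dep' M hM hgM)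
  have hNc : ∀ g ∈ G.cut X, g ∉ N := by
    intro g hg hgN
    rcases hcut g hg with rfl | rfl | rfl | rfl
    · exact T.excl₁₂ N hN hN1 hgN
    · exact T.excl₁₂ N hN hN1 (T.pure₂.dep' N hN hgN)
    · exact hex N hN hN1 hgN
    · exact hex N hN hN1 (hp.dep' N hN hgN)
  have hS := hN.splice hM (X := X) fun g hg => iff_of_false (hNc g hg) (hMc g hg)
  refine T.excl₁₃ _ hS (Or.inl ⟨(inside_iff hva).2 ⟨by simp [X], by simp [X]⟩, hN1⟩)
    (Or.inr ⟨fun hi => ?_, hM3⟩)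
  obtain ⟨y, z, hyz⟩ := exists_ends e₃
  rcases hXinc y ((inside_iff hyz).1 hi).1 e₃ (inc_left hyz) with
    hh | hh | hh | hh | hh | hh | hh | hh
  · exact T.excl₁₃ N hN hN1 (hh ▸ hN1)
  · exact T.excl₂₃ M hM (hh ▸ hM3) hM3
  · exact T.notPure T.pure₃ hh.symm
  · exact T.excl₁₃ N hN hN1 (hh ▸ T.pure₁.dep N hN hN1)
  · exact T.excl₂₃ M hM (T.pure₂.dep' M hM (hh ▸ hM3)) hM3
  · exact hne.1 hh
  · exact hne.2 hh
  · exact Ra.notPure _ _ _ T.pure₃ hh.symm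

lemma isIso_C6bar {N : ZMod 6 → G.V} (hN : Function.Bijective N) {E : Fin 9 → G.E}
    (hE : Function.Surjective E) (hends : ∀ i, G.ends (E i) =
      s(N (![0, 3, 0, 3, 2, 5, 0, 2, 4] i), N (![2, 5, 4, 1, 4, 1, 3, 5, 1] i))) :
    IsIso G C6bar := by
  set A : Fin 9 → ZMod 6 := ![0, 3, 0, 3, 2, 5, 0, 2, 4] with hA
  set B : Fin 9 → ZMod 6 := ![2, 5, 4, 1, 4, 1, 3, 5, 1] with hB
  set φ : G.V ≃ ZMod 6 := (Equiv.ofBijective N hN).symm with hφ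
  have hφN : ∀ x, φ (N x) = x := fun x => (Equiv.ofBijective N hN).symm_apply_apply x
  have hmem : ∀ i, ¬ (s(A i, B i)).IsDiag ∧
      ∀ a b : ZMod 6, s(A i, B i) = s(a, b) → b ≠ a + 1 ∧ a ≠ b + 1 := by
    rw [hA, hB]; decide
  have hinj : ∀ i j, s(A i, B i) = s(A j, B j) → i = j := by
    rw [hA, hB]; decide
  have hsurj : ∀ x y : ZMod 6, x ≠ y → (y ≠ x + 1 ∧ x ≠ y + 1) → ∃ i, s(A i, B i) = s(x, y) := by
    rw [hA, hB]; decide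
  set F : Fin 9 → C6bar.E := fun i => ⟨s(A i, B i), hmem i⟩ with hF
  have hFbij : Function.Bijective F := by
    refine ⟨fun i j hij => hinj i j (congrArg Subtype.val hij), ?_⟩
    rintro ⟨p, hp, hp'⟩
    induction p using Sym2.ind with | _ x y => ?_
    obtain ⟨i, hi⟩ := hsurj x y (fun h => hp (Sym2.mk_isDiag_iff.2 h)) (hp' x y rfl)
    exact ⟨i, Subtype.ext hi⟩
  have hEbij : Function.Bijective E := by
    refine ⟨fun i j hij => hinj i j ?_, hE⟩
    have := congrArg (fun g => (G.ends g).map φ) hij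
    simpa only [hends, Sym2.map_mk, hφN] using this
  refine ⟨φ, (Equiv.ofBijective E hEbij).symm.trans (Equiv.ofBijective F hFbij), fun g => ?_⟩
  obtain ⟨i, rfl⟩ := hE g
  have : (Equiv.ofBijective E hEbij).symm (E i) = i :=
    (Equiv.ofBijective E hEbij).symm_apply_apply i
  rw [Equiv.trans_apply, this, hends, Sym2.map_mk]
  exact (congrArg₂ (fun x y => s(x, y)) (hφN (A i)) (hφN (B i))).symm

lemma isIso_C6bar_of_rung (hG : G.MatchingCovered) {v v' a a' c c' : G.V}
    {h k l e₁ f₁ e₂ f₂ e₃ f₃ : G.E}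
    (hinj : Function.Injective (![v, c', a, v', c, a'] : Fin 6 → G.V))
    (R : Rung v v' h e₁ f₁ e₂ f₂) (Ra : Rung a a' k e₁ f₁ e₃ f₃) (Rc : Rung c c' l e₂ f₂ e₃ f₃)
    (hva : G.ends e₁ = s(v, a)) (hf1 : G.ends f₁ = s(v', a')) (hvc : G.ends e₂ = s(v, c))
    (hf2 : G.ends f₂ = s(v', c')) (he3 : G.ends e₃ = s(a, c)) (hf3 : G.ends f₃ = s(a', c')) :
    IsIso G C6bar := by
  set N : ZMod 6 → G.V := ![v, c', a, v', c, a']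
  have hNE : ∀ x ∈ Set.range N, ∀ g, G.Inc x g → g = e₁ ∨ g = f₁ ∨ g = e₂ ∨ g = f₂ ∨ g = e₃ ∨
      g = f₃ ∨ g = h ∨ g = k ∨ g = l := by
    rintro _ ⟨i, rfl⟩ g hg
    fin_cases i
    · have := (R.inc g).1 hg; tauto
    · have := (Rc.inc' g).1 hg; tauto
    · have := (Ra.inc g).1 hg; tauto
    · have := (R.inc' g).1 hg; tauto
    · have := (Rc.inc g).1 hg; tauto
    · have := (Ra.inc' g).1 hg; tauto
  have mv : v ∈ Set.range N := ⟨0, rfl⟩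
  have mc' : c' ∈ Set.range N := ⟨1, rfl⟩
  have ma : a ∈ Set.range N := ⟨2, rfl⟩
  have mv' : v' ∈ Set.range N := ⟨3, rfl⟩
  have mc : c ∈ Set.range N := ⟨4, rfl⟩
  have ma' : a' ∈ Set.range N := ⟨5, rfl⟩
  have hNsurj : Set.range N = Set.univ := by
    refine (hG.eq_empty_or_univ ?_).resolve_left (Set.range_nonempty N).ne_empty
    rw [Set.eq_empty_iff_forall_notMem]
    intro g hg
    obtain ⟨y, z, hyz⟩ := exists_ends g
    have hgE : ∃ x ∈ Set.range N, G.Inc x g := by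
      rcases (Multigraph.mem_cut_iff hyz).1 hg with hh | hh
      · exact ⟨y, hh.1, inc_left hyz⟩
      · exact ⟨z, hh.2, inc_right hyz⟩
    obtain ⟨x, hx, hxg⟩ := hgE
    have hins : ∀ {x y}, G.ends g = s(x, y) → x ∈ Set.range N → y ∈ Set.range N → False :=
      fun hxy hx hy => ((Multigraph.mem_cut_iff hxy).1 hg).elim (fun h => h.2 hy) fun h => h.1 hx
    rcases hNE x hx g hxg with rfl | rfl | rfl | rfl | rfl | rfl | rfl | rfl | rfl
    exacts [hins hva mv ma, hins hf1 mv' ma', hins hvc mv mc, hins hf2 mv' mc', hins he3 ma mc,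
      hins hf3 ma' mc', hins R.ends mv mv', hins Ra.ends ma ma', hins Rc.ends mc mc']
  refine isIso_C6bar ⟨hinj, Set.range_eq_univ.1 hNsurj⟩
    (E := ![e₁, f₁, e₂, f₂, e₃, f₃, h, k, l]) (fun g => ?_) (fun i => ?_)
  · obtain ⟨x, y, hxy⟩ := exists_ends g
    rcases hNE x (hNsurj ▸ trivial) g (inc_left hxy) with
      rfl | rfl | rfl | rfl | rfl | rfl | rfl | rfl | rfl
    exacts [⟨0, rfl⟩, ⟨1, rfl⟩, ⟨2, rfl⟩, ⟨3, rfl⟩, ⟨4, rfl⟩, ⟨5, rfl⟩, ⟨6, rfl⟩, ⟨7, rfl⟩,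
      ⟨8, rfl⟩]
  · fin_cases i
    exacts [hva, hf1, hvc, hf2, he3, hf3, R.ends, Ra.ends, Rc.ends]

lemma TriAt.isIso_of_rung {v v' : G.V} {e₁ f₁ e₂ f₂ e₃ f₃ h : G.E} {c₁ c₂ c₃ : G.V → ℤ}
    {W : Set G.V} (T : TriAt v e₁ f₁ e₂ f₂ e₃ f₃ h c₁ c₂ c₃ W) (hG : G.MatchingCovered)
    (hP : G.TightShoresBipartite) (hall : AllTriAt G) (R : Rung v v' h e₁ f₁ e₂ f₂) {a a' : G.V}
    {k : G.E} (hva : G.ends e₁ = s(v, a)) (Ra : Rung a a' k e₁ f₁ e₃ f₃) : IsIso G C6bar := by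
  obtain ⟨c, hvc⟩ := T.swap.inc₁.exists_other
  obtain ⟨c', l, q, q', d, Rc, hq, hex⟩ := hall.exists_rung_of_inc hG hP T.pure₂ (inc_right hvc)
  have h12 : ¬ (e₂ = e₁ ∨ e₂ = f₁) := fun hh => by
    obtain ⟨M, hM, hm⟩ := hG.exists_mem e₂
    exact T.excl₁₂ M hM ((T.pure₁.dep_of_mem hh).1 M hM hm) hm
  have h21 : ¬ (e₁ = e₂ ∨ e₁ = f₂) := fun hh => by
    obtain ⟨M, hM, hm⟩ := hG.exists_mem e₁
    exact T.excl₁₂ M hM hm ((T.pure₂.dep_of_mem hh).1 M hM hm)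
  have h13 : ¬ (e₁ = e₃ ∨ e₁ = f₃) := fun hh => by
    obtain ⟨M, hM, hm⟩ := hG.exists_mem e₁
    exact T.excl₁₃ M hM hm ((T.pure₃.dep_of_mem hh).1 M hM hm)
  have h23 : ¬ (e₂ = e₃ ∨ e₂ = f₃) := fun hh => by
    obtain ⟨M, hM, hm⟩ := hG.exists_mem e₂
    exact T.excl₂₃ M hM hm ((T.pure₃.dep_of_mem hh).1 M hM hm)
  have h3a : c₃ a = 1 := T.pure₃.col.2.2.1 a ((Ra.inc _).2 (by tauto))
  have h3a' : c₃ a' = -1 := T.pure₃.col.2.2.2 a' ((Ra.inc' _).2 (by tauto))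
  have h3v := T.pure₃.add_eq_zero hva h13
  have h3vc := T.pure₃.add_eq_zero hvc h23
  have hqe : q = e₃ ∧ q' = f₃ := by
    rcases T.swap.eq_or_eq_of_rung hG hP R.swap hvc Rc hq hex with rfl | rfl
    · refine ⟨rfl, (T.pure₃.eq_or_eq_of_dep hG hP hq.dep').resolve_left hq.ne.symm⟩
    · have := T.pure₃.col.2.2.1 c' ((Rc.inc' _).2 (by tauto))
      obtain rfl := (T.pure₃.eq_or_eq_of_dep hG hP hq.dep).resolve_left hq.ne
      have := T.pure₃.col.2.2.2 c ((Rc.inc _).2 (by tauto))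
      omega
  obtain ⟨rfl, rfl⟩ := hqe
  have h3c' : c₃ c' = -1 := T.pure₃.col.2.2.2 c' ((Rc.inc' _).2 (by tauto))
  have h3v' := T.pure₃.add_eq_zero R.ends fun hh => hh.elim (T.notPure T.pure₃)
    (T.notPure T.pure₃.symm)
  have h1v : c₁ v = 1 := T.pure₁.col.2.2.1 v ((R.inc _).2 (by tauto))
  have h1v' : c₁ v' = -1 := T.pure₁.col.2.2.2 v' ((R.inc' _).2 (by tauto))
  have h1a : c₁ a = 1 := T.pure₁.col.2.2.1 a ((Ra.inc _).2 (by tauto))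
  have h1a' : c₁ a' = -1 := T.pure₁.col.2.2.2 a' ((Ra.inc' _).2 (by tauto))
  have h1c := T.pure₁.add_eq_zero hvc h12
  have h1c' := T.pure₁.add_eq_zero Rc.ends fun hh => hh.elim (Rc.notPure _ _ _ T.pure₁)
    (Rc.notPure _ _ _ T.pure₁.symm)
  have h2v : c₂ v = 1 := T.pure₂.col.2.2.1 v ((R.inc _).2 (by tauto))
  have h2v' : c₂ v' = -1 := T.pure₂.col.2.2.2 v' ((R.inc' _).2 (by tauto))
  have h2c : c₂ c = 1 := T.pure₂.col.2.2.1 c ((Rc.inc _).2 (by tauto))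
  have h2c' : c₂ c' = -1 := T.pure₂.col.2.2.2 c' ((Rc.inc' _).2 (by tauto))
  have h2a := T.pure₂.add_eq_zero hva h21
  have h2a' := T.pure₂.add_eq_zero Ra.ends fun hh => hh.elim (Ra.notPure _ _ _ T.pure₂)
    (Ra.notPure _ _ _ T.pure₂.symm)
  have hf1 : G.ends f₁ = s(v', a') := ends_eq_of_inc ((R.inc' _).2 (by tauto))
    ((Ra.inc' _).2 (by tauto)) (by rintro rfl; omega)
  have hf2 : G.ends f₂ = s(v', c') := ends_eq_of_inc ((R.inc' _).2 (by tauto))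
    ((Rc.inc' _).2 (by tauto)) (by rintro rfl; omega)
  have he3 : G.ends q = s(a, c) := ends_eq_of_inc ((Ra.inc _).2 (by tauto))
    ((Rc.inc _).2 (by tauto)) (by rintro rfl; omega)
  have hf3 : G.ends q' = s(a', c') := ends_eq_of_inc ((Ra.inc' _).2 (by tauto))
    ((Rc.inc' _).2 (by tauto)) (by rintro rfl; omega)
  set N : Fin 6 → G.V := ![v, c', a, v', c, a']
  have hNinj : Function.Injective N := by
    have hcol : ∀ i, (c₁ (N i), c₂ (N i), c₃ (N i)) =
        (![((1 : ℤ), (1 : ℤ), (-1 : ℤ)), (1, -1, -1), (1, -1, 1), (-1, -1, 1), (-1, 1, 1),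
          (-1, 1, -1)] : Fin 6 → ℤ × ℤ × ℤ) i := by
      intro i
      fin_cases i <;> simp [N, Prod.ext_iff] <;> omega
    have hdec : ∀ i j : Fin 6, (![((1 : ℤ), (1 : ℤ), (-1 : ℤ)), (1, -1, -1), (1, -1, 1),
        (-1, -1, 1), (-1, 1, 1), (-1, 1, -1)] : Fin 6 → ℤ × ℤ × ℤ) i =
        (![((1 : ℤ), (1 : ℤ), (-1 : ℤ)), (1, -1, -1), (1, -1, 1), (-1, -1, 1), (-1, 1, 1),
          (-1, 1, -1)] : Fin 6 → ℤ × ℤ × ℤ) j → i = j := by decide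
    intro i j hij
    exact hdec i j (by rw [← hcol, ← hcol, hij])
  exact isIso_C6bar_of_rung hG hNinj R Ra Rc hva hf1 hvc hf2 he3 hf3

lemma AllTriAt.isIso (hall : AllTriAt G) (hG : G.MatchingCovered) (hP : G.TightShoresBipartite)
    (v : G.V) : IsIso G C6bar := by
  obtain ⟨e₁, f₁, e₂, f₂, e₃, f₃, h, c₁, c₂, c₃, W, T⟩ := hall v
  obtain ⟨v', R⟩ := hall.exists_rung hG T
  obtain ⟨a, hva⟩ := T.inc₁.exists_other
  obtain ⟨a', k, p, p', d, Ra, hp, hex⟩ := hall.exists_rung_of_inc hG hP T.pure₁ (inc_right hva)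
  rcases T.eq_or_eq_of_rung hG hP R hva Ra hp hex with rfl | rfl
  · obtain rfl := (T.pure₃.eq_or_eq_of_dep hG hP hp.dep').resolve_left hp.ne.symm
    exact T.isIso_of_rung hG hP hall R hva Ra
  · obtain rfl := (T.pure₃.eq_or_eq_of_dep hG hP hp.dep).resolve_left hp.ne
    exact T.symm₃.isIso_of_rung hG hP hall R hva Ra

lemma KAt.degree_le {v : G.V} {e f : Fin 3 → G.E} {c : Fin 3 → G.V → ℤ} (K : KAt v e f c) :
    G.degree v ≤ 3 := by
  have : {g | G.Inc v g} = {e 0, e 1, e 2} := by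
    ext g
    simp only [Set.mem_ofPred_eq, K.inc, Fin.exists_fin_succ, Set.mem_insert_iff]
    simp
  rw [degree_eq_ncard, this]
  exact (Set.ncard_insert_le _ _).trans
    (Nat.succ_le_succ ((Set.ncard_insert_le _ _).trans (by simp)))

lemma TriAt.degree_le {v : G.V} {e₁ f₁ e₂ f₂ e₃ f₃ h : G.E} {c₁ c₂ c₃ : G.V → ℤ} {W : Set G.V}
    (T : TriAt v e₁ f₁ e₂ f₂ e₃ f₃ h c₁ c₂ c₃ W) : G.degree v ≤ 3 := by
  have : {g | G.Inc v g} = {e₁, e₂, h} := by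
    ext g
    exact T.inc g
  rw [degree_eq_ncard, this]
  exact (Set.ncard_insert_le _ _).trans
    (Nat.succ_le_succ ((Set.ncard_insert_le _ _).trans (by simp)))

lemma allKAtOrTriAt_of_lt (hG : G.MatchingCovered) (hP : G.TightShoresBipartite)
    (hirr : G.Irreducible) (hlt : Nat.card {e : G.E // G.Removable e} < G.maxDegree - 2) :
    AllKAtOrTriAt G := by
  have h3 := card_ge_three_of_not_bipartite hP.1
  have hle : ∀ u, G.degree u ≤ G.maxDegree := fun u => Finset.le_sup (Finset.mem_univ u)
  have key : ∀ u, 3 ≤ G.degree u → Nat.card {e : G.E // G.Removable e} + 2 < G.degree u →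
      G.degree u ≤ 3 ∧ ((∃ e f c, KAt u e f c) ∨
        ∃ e₁ f₁ e₂ f₂ e₃ f₃ h c₁ c₂ c₃ W, TriAt u e₁ f₁ e₂ f₂ e₃ f₃ h c₁ c₂ c₃ W) := by
    intro u hu hlt
    obtain ⟨h, e, f, c, T⟩ :=
      (degree_le_or_exists_triple hG hP hirr hu).resolve_left (not_le.2 hlt)
    have := T.exists_kAt_or_triAt hG hP
    refine ⟨?_, this⟩
    rcases this with ⟨_, _, _, K⟩ | ⟨_, _, _, _, _, _, _, _, _, _, _, T⟩
    · exact K.degree_le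
    · exact T.degree_le
  obtain ⟨v, -, hv⟩ : ∃ v ∈ Finset.univ, Finset.univ.sup G.degree = G.degree v := by
    refine Finset.exists_mem_eq_sup _ ?_ _
    rw [← Finset.card_pos, Finset.card_univ, ← Nat.card_eq_fintype_card]
    omega
  change G.maxDegree = _ at hv
  have hvle := (key v (by omega) (by omega)).1
  intro u
  by_cases hu : G.degree u = 2
  · exact Or.inl hu
  · have := hG.two_le_degree h3 u
    have := hle u
    exact Or.inr (key u (by omega) (by omega)).2

end Multigraph

/-- Main theorem: every irreducible near-brick different from `K₄` and `C̄₆`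
has at least `Δ - 2` removable edges. -/
theorem irreducible_near_brick_removable_edges_ge_maxDegree_sub_two
    (G : Multigraph) (hG : G.IsNearBrick) (hirr : G.Irreducible)
    (hK4 : ¬ Multigraph.IsIso G K4) (hC6 : ¬ Multigraph.IsIso G C6bar) :
    G.maxDegree - 2 ≤ Nat.card {e : G.E // G.Removable e} := by
  have hP := (hG.2.bipartite_or hG.1).2 rfl
  by_contra! hlt
  have hall := allKAtOrTriAt_of_lt hG.1 hP hirr hlt
  have hT := hall.allTriAt hG.1 hP hirr fun v e f c K => hK4 (K.isIso hG.1 hP hirr hall)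
  have h3 := card_ge_three_of_not_bipartite hP.1
  have : Nonempty G.V := by
    rw [← Fintype.card_pos_iff, ← Nat.card_eq_fintype_card]
    omega
  exact hC6 (hT.isIso hG.1 hP this.some)
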